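/- Let U be a nonempty open subset of ℂ^N and let A : U → Matrix (Fin p) (Fin n) ℂ be a matrix-valued map all of whose entries are holomorphic (complex-analytic) on U. Let k = min_{x ∈ U} dim_ℂ ker A(x) and assume k ≥ 1. Let ℙ(L) = {(x,ℓ) : x ∈ U, ℓ a one-dimensional ℂ-linear subspace of ℂ^n with ℓ ⊆ ker A(x)}, topologized as a subspace of U × ℙ(ℂ^n), with projection ℙ(π) : ℙ(L) → U, (x,ℓ) ↦ x. Then ℙ(π) is a quasifibration up to dimension 2k − 1. -/

import Mathlib

open unitInterval

noncomputable section

/-- The map on generalized loops induced by a continuous map. -/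
def GenLoop.induced {A B : Type*} [TopologicalSpace A] [TopologicalSpace B] (N : Type*)
    (g : A → B) (hg : Continuous g) (a : A) (l : GenLoop N A a) : GenLoop N B (g a) :=
  ⟨(⟨g, hg⟩ : C(A, B)).comp l.1, fun y hy => by
    simp [ContinuousMap.comp_apply, l.2 y hy]⟩

/-- The map on homotopy groups induced by a continuous map. -/
def piMap {A B : Type*} [TopologicalSpace A] [TopologicalSpace B] (n : ℕ)
    (g : A → B) (hg : Continuous g) (a : A) :
    HomotopyGroup (Fin n) A a → HomotopyGroup (Fin n) B (g a) :=
  Quotient.map (GenLoop.induced (Fin n) g hg a)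
    (fun _ _ h => h.map (fun F => F.compContinuousMap ⟨g, hg⟩))

/-- `g` induces an isomorphism on homotopy groups `π_j` for `j < p` and a surjection on `π_p`,
at every basepoint. -/
def IsWeakEquivUpTo (p : ℕ) {A B : Type*} [TopologicalSpace A] [TopologicalSpace B]
    (g : A → B) : Prop :=
  ∃ hg : Continuous g,
    (∀ a : A, ∀ j : ℕ, j < p → Function.Bijective (piMap j g hg a)) ∧
      ∀ a : A, Function.Surjective (piMap p g hg a)

/-- The homotopy fibre of `f` over `b`. -/
abbrev HomotopyFiber {E B : Type*} [TopologicalSpace E] [TopologicalSpace B]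
    (f : E → B) (b : B) : Type _ :=
  {q : E × C(unitInterval, B) // q.2 0 = b ∧ q.2 1 = f q.1}

/-- The canonical map from the fibre to the homotopy fibre. -/
def fiberToHomotopyFiber {E B : Type*} [TopologicalSpace E] [TopologicalSpace B]
    (f : E → B) (b : B) : (f ⁻¹' {b}) → HomotopyFiber f b :=
  fun x => ⟨(x.1, ContinuousMap.const unitInterval b), rfl, x.2.symm⟩

/-- `f` is a quasifibration up to dimension `p`. -/
def IsQuasifibrationUpTo (p : ℕ) {E B : Type*} [TopologicalSpace E] [TopologicalSpace B]
    (f : E → B) : Prop :=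
  Continuous f ∧ ∀ b : B, IsWeakEquivUpTo p (fiberToHomotopyFiber f b)

/-- A strong deformation retraction of `Z` onto the subset `S`. -/
def IsStrongDeformationRetraction {Z : Type*} [TopologicalSpace Z] (S : Set Z)
    (H : Z × unitInterval → Z) : Prop :=
  Continuous H ∧ (∀ z, H (z, 0) = z) ∧ (∀ z, H (z, 1) ∈ S) ∧
    ∀ z ∈ S, ∀ t, H (z, t) = z


open Projectivization in
instance {K V : Type*} [DivisionRing K] [AddCommGroup V] [Module K V] [TopologicalSpace V] :
    TopologicalSpace (Projectivization K V) :=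
  inferInstanceAs (TopologicalSpace (Quotient (projectivizationSetoid K V)))

section
open Filter Topology
open Filter Topology

noncomputable section

section Had
variable {E : Type*} [NormedAddCommGroup E] [NormedSpace ℂ E]

/-- projection along `d` -/
def hproj (l : E →L[ℂ] ℂ) (d : E) : E →L[ℂ] E := ContinuousLinearMap.id ℂ E - l.smulRight d

lemma hproj_apply (l : E →L[ℂ] ℂ) (d h : E) : hproj l d h = h - l h • d := by
  simp [hproj]

def hadSeries (p : FormalMultilinearSeries ℂ E ℂ) (l : E →L[ℂ] ℂ) (d : E) :
    FormalMultilinearSeries ℂ E ℂ := fun m =>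
  ∑ k : Fin (m + 1), (ContinuousMultilinearMap.curryMid k (p (m + 1)) d).compContinuousLinearMap
    (fun i => if k.succAbove i < k then ContinuousLinearMap.id ℂ E else hproj l d)

lemma hadSeries_apply (p : FormalMultilinearSeries ℂ E ℂ) (l : E →L[ℂ] ℂ) (d : E) (m : ℕ) (h : E) :
    p (m + 1) (fun _ => h) - p (m + 1) (fun _ => hproj l d h) =
      l h * hadSeries p l d m (fun _ => h) := by
  have := (p (m + 1)).toMultilinearMap.map_piecewise_sub_map_piecewise (fun _ => h)
    (fun _ => hproj l d h) 0 Finset.univ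
  simp only [Finset.piecewise_univ, Finset.mem_univ, if_true] at this
  simp only [ContinuousMultilinearMap.coe_coe] at this
  rw [this, hadSeries, _root_.sum_apply, Finset.mul_sum]
  refine Finset.sum_congr rfl fun k _ => ?_
  rw [ContinuousMultilinearMap.compContinuousLinearMap_apply,
    ContinuousMultilinearMap.curryMid_apply, ← smul_eq_mul]
  have key : (fun j => if j < k then h else if j = k then h - hproj l d h else hproj l d h) =
      Function.update (k.insertNth d (fun i => (if k.succAbove i < k then
        ContinuousLinearMap.id ℂ E else hproj l d) h)) k (l h • d) := by
    funext j
    refine Fin.succAboveCases k ?_ (fun i => ?_) j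
    · simp [hproj_apply]
    · rw [Function.update_of_ne (Fin.succAbove_ne k i)]
      rw [Fin.insertNth_apply_succAbove]
      simp only [Fin.succAbove_ne, if_false]
      split_ifs <;> simp
  rw [key]
  have h2 := (p (m + 1)).map_update_smul (k.insertNth d (fun i => (if k.succAbove i < k then
        ContinuousLinearMap.id ℂ E else hproj l d) h)) k (l h) d
  rw [h2]
  congr 2
  funext j
  refine Fin.succAboveCases k ?_ (fun i => ?_) j
  · simp
  · rw [Function.update_of_ne (Fin.succAbove_ne k i)]

lemma hadSeries_radius (p : FormalMultilinearSeries ℂ E ℂ) (hp : 0 < p.radius)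
    (l : E →L[ℂ] ℂ) (d : E) : 0 < (hadSeries p l d).radius := by
  obtain ⟨C, r, hC, hr, hb⟩ := p.le_mul_pow_of_radius_pos hp
  set K : ℝ := max 1 ‖hproj l d‖ with hK
  have hK1 : 1 ≤ K := le_max_left _ _
  have hK2 : ‖hproj l d‖ ≤ K := le_max_right _ _
  have hpos : 0 < 1 / (2 * r * K) := by positivity
  obtain ⟨ρ, hρ⟩ : ∃ ρ : NNReal, (ρ : ℝ) = 1 / (2 * r * K) := ⟨⟨_, hpos.le⟩, rfl⟩
  have hle : (ρ : ENNReal) ≤ (hadSeries p l d).radius := by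
    apply FormalMultilinearSeries.le_radius_of_bound _ (C * r * ‖d‖)
    intro m
    rw [hρ]
    have h1 : ‖hadSeries p l d m‖ ≤ (m + 1) * (C * r ^ (m + 1) * ‖d‖ * K ^ m) := by
      unfold hadSeries
      refine (norm_sum_le _ _).trans ?_
      refine (Finset.sum_le_card_nsmul _ _ (C * r ^ (m + 1) * ‖d‖ * K ^ m) ?_).trans ?_
      · intro k _
        refine (ContinuousMultilinearMap.norm_compContinuousLinearMap_le _ _).trans ?_
        have e1 : ‖ContinuousMultilinearMap.curryMid k (p (m + 1)) d‖ ≤ C * r ^ (m + 1) * ‖d‖ := by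
          refine (ContinuousLinearMap.le_opNorm _ _).trans ?_
          rw [ContinuousMultilinearMap.norm_curryMid]
          gcongr
          exact hb _
        have e2 : ∏ i : Fin m, ‖(if k.succAbove i < k then ContinuousLinearMap.id ℂ E
            else hproj l d)‖ ≤ K ^ m := by
          refine (Finset.prod_le_prod (g := fun _ => K) (fun _ _ => norm_nonneg _)
            (fun i _ => ?_)).trans (by simp)
          split_ifs
          · exact ContinuousLinearMap.norm_id_le.trans hK1
          · exact hK2
        gcongr
      · simp
    have h2 : ((m : ℝ) + 1) ≤ 2 ^ m := by
      exact_mod_cast Nat.lt_two_pow_self (n := m)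
    calc ‖hadSeries p l d m‖ * (1 / (2 * r * K)) ^ m
        ≤ (2 ^ m * (C * r ^ (m + 1) * ‖d‖ * K ^ m)) * (1 / (2 * r * K)) ^ m := by
          gcongr
          refine h1.trans ?_
          gcongr
      _ = C * r * ‖d‖ := by
          rw [div_pow, mul_pow, mul_pow, one_pow, pow_succ]
          field_simp
  refine lt_of_lt_of_le ?_ hle
  rw [← hρ] at hpos
  exact_mod_cast hpos

/-- Hadamard division. -/
theorem hadamard {p : E → ℂ} {z : E} (hp : AnalyticAt ℂ p z) (l : E →L[ℂ] ℂ) (d : E) :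
    ∃ q : E → ℂ, AnalyticAt ℂ q z ∧
      ∀ᶠ s in 𝓝 z, p s = p (s - l (s - z) • d) + l (s - z) * q s := by
  obtain ⟨P, hP⟩ := hp
  have hr := hadSeries_radius P (by obtain ⟨r, h⟩ := hP; exact h.r_pos.trans_le h.r_le) l d
  have hQ := ((hadSeries P l d).hasFPowerSeriesOnBall hr)
  refine ⟨fun s => (hadSeries P l d).sum (s - z), ?_, ?_⟩
  · exact AnalyticAt.comp_of_eq (f := fun s => s - z) hQ.analyticAt (by fun_prop) (by simp)
  · have c1 : Tendsto (fun s : E => s - z) (𝓝 z) (𝓝 0) := by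
      have : Continuous (fun s : E => s - z) := by fun_prop
      simpa using this.tendsto z
    have c2 : Tendsto (fun s : E => hproj l d (s - z)) (𝓝 z) (𝓝 0) := by
      have : Continuous (fun s : E => hproj l d (s - z)) := by fun_prop
      simpa using this.tendsto z
    have a1 := c1.eventually hP.eventually_hasSum
    have a2 := c2.eventually hP.eventually_hasSum
    have a3 := c1.eventually hQ.hasFPowerSeriesAt.eventually_hasSum
    filter_upwards [a1, a2, a3] with s h1 h2 h3
    have h4 := h1.sub h2
    have h5 := h3.mul_left (l (s - z))
    have e : z + hproj l d (s - z) = s - l (s - z) • d := by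
      rw [hproj_apply]; abel
    rw [e] at h4
    have h6 := (hasSum_nat_add_iff' 1).mpr h4
    simp only [hadSeries_apply] at h6
    have h7 := h6.unique h5
    simp only [Finset.range_one, Finset.sum_singleton] at h7
    have h8 : (P 0) (fun _ => s - z) = (P 0) (fun _ => hproj l d (s - z)) := by
      congr 1; ext i; exact i.elim0
    rw [h8] at h7
    simp only [sub_self, sub_zero, zero_add, add_sub_cancel] at h7
    rw [← h7]; ring

end Had
end
end

section
open Filter Topology
open Filter Topology

noncomputable section

section Mono
variable {E : Type*} [NormedAddCommGroup E] [NormedSpace ℂ E]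

theorem germ_domain {p q : E → ℂ} {z : E} (hp : AnalyticAt ℂ p z) (hq : AnalyticAt ℂ q z)
    (h : ∀ᶠ s in 𝓝 z, p s * q s = 0) : (∀ᶠ s in 𝓝 z, p s = 0) ∨ ∀ᶠ s in 𝓝 z, q s = 0 := by
  by_contra hcon
  push Not at hcon
  obtain ⟨h1, h2⟩ := hcon
  obtain ⟨r, hr, hqr⟩ := hq.exists_ball_analyticOnNhd
  have hev := (h.and hp.eventually_analyticAt)
  obtain ⟨r', hr', hb⟩ := Metric.eventually_nhds_iff_ball.mp hev
  have hm : Metric.ball z (min r r') ∈ 𝓝 z := Metric.ball_mem_nhds _ (lt_min hr hr')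
  obtain ⟨s, hs1, hs2⟩ := (h1.and_eventually hm).exists
  have hsq : s ∈ Metric.ball z r := Metric.ball_subset_ball (min_le_left _ _) hs2
  have hsp : s ∈ Metric.ball z r' := Metric.ball_subset_ball (min_le_right _ _) hs2
  have e1 : ∀ᶠ x in 𝓝 s, p x ≠ 0 := (hb s hsp).2.continuousAt.eventually_ne hs1
  have e2 : ∀ᶠ x in 𝓝 s, q x = 0 := by
    filter_upwards [e1, Metric.isOpen_ball.mem_nhds hsp] with x hx1 hx2
    have := (hb x hx2).1
    simpa [hx1] using this
  have e3 := hqr.eqOn_zero_of_preconnected_of_eventuallyEq_zero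
    (convex_ball z r).isPreconnected hsq e2
  exact h2 (by filter_upwards [Metric.ball_mem_nhds z hr] with x hx using not_not.mpr (e3 hx))

/-- A partial dual basis. -/
structure DualSys {ι : Type} (l : ι → E →L[ℂ] ℂ) (d : ι → E) : Prop where
  one : ∀ i, l i (d i) = 1
  zero : ∀ i j, i ≠ j → l i (d j) = 0

def mono {ι : Type} [Fintype ι] (l : ι → E →L[ℂ] ℂ) (z : E) (a : ι → ℕ) (s : E) : ℂ :=
  ∏ i, (l i (s - z)) ^ (a i)

variable {ι : Type} [Fintype ι] {l : ι → E →L[ℂ] ℂ} {d : ι → E} {z : E}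

lemma mono_analyticAt (l : ι → E →L[ℂ] ℂ) (z : E) (a : ι → ℕ) (s : E) :
    AnalyticAt ℂ (mono l z a) s := by
  unfold mono
  have : ∀ i ∈ (Finset.univ : Finset ι), AnalyticAt ℂ (fun s => (l i (s - z)) ^ (a i)) s := by
    intro i _
    exact (((l i).analyticAt _).comp_of_eq (f := fun s => s - z) (by fun_prop) rfl).pow _
  exact Finset.analyticAt_fun_prod _ this

lemma mono_add (a b : ι → ℕ) (s : E) : mono l z (a + b) s = mono l z a s * mono l z b s := by
  simp [mono, pow_add, Finset.prod_mul_distrib]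

lemma mono_zero (s : E) : mono l z 0 s = 1 := by simp [mono]

lemma mono_nsmul (n : ℕ) (a : ι → ℕ) (s : E) : mono l z (n • a) s = mono l z a s ^ n := by
  simp [mono, ← Finset.prod_pow, pow_mul, mul_comm n]

lemma mono_single [DecidableEq ι] (i : ι) (s : E) : mono l z (Pi.single i 1) s = l i (s - z) := by
  unfold mono
  rw [Finset.prod_eq_single i]
  · simp
  · intro b _ hb; simp [hb]
  · simp

lemma mono_eq_zero {a : ι → ℕ} {s : E} {i : ι} (hi : a i ≠ 0) (hs : l i (s - z) = 0) :
    mono l z a s = 0 := by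
  unfold mono
  exact Finset.prod_eq_zero (Finset.mem_univ i) (by rw [hs, zero_pow hi])

lemma mono_ne_zero {a : ι → ℕ} {s : E} (h : ∀ i, a i ≠ 0 → l i (s - z) ≠ 0) :
    mono l z a s ≠ 0 := by
  unfold mono
  refine Finset.prod_ne_zero_iff.mpr fun i _ => ?_
  by_cases hi : a i = 0
  · simp [hi]
  · exact pow_ne_zero _ (h i hi)

lemma mono_self {a : ι → ℕ} (h : a ≠ 0) : mono l z a z = 0 := by
  obtain ⟨i, hi⟩ := Function.ne_iff.mp h
  exact mono_eq_zero hi (by simp)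

lemma DualSys.exists_pt (D : DualSys l d) (T : Set ι) {P : E → Prop}
    (h : ∀ᶠ s in 𝓝 z, P s) :
    ∃ s, P s ∧ (∀ i ∈ T, l i (s - z) = 0) ∧ ∀ i ∉ T, l i (s - z) ≠ 0 := by
  classical
  set w : E := ∑ i ∈ Finset.univ.filter (· ∉ T), d i with hw
  have hlw : ∀ i, l i w = if i ∈ T then 0 else 1 := by
    intro i
    rw [hw, map_sum]
    split_ifs with hi
    · refine Finset.sum_eq_zero fun j hj => D.zero i j ?_
      rintro rfl
      simp at hj; exact hj hi
    · rw [Finset.sum_eq_single i]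
      · exact D.one i
      · intro j _ hj; exact D.zero i j (Ne.symm hj)
      · intro hh; simp [hi] at hh
  have hc : Tendsto (fun t : ℂ => z + t • w) (𝓝[≠] 0) (𝓝 z) := by
    have : Continuous (fun t : ℂ => z + t • w) := by fun_prop
    have h0 := this.tendsto 0
    simp only [zero_smul, add_zero] at h0
    exact h0.mono_left nhdsWithin_le_nhds
  obtain ⟨t, ht1, ht2⟩ := ((hc.eventually h).and self_mem_nhdsWithin).exists
  refine ⟨z + t • w, ht1, fun i hi => ?_, fun i hi => ?_⟩
  · simp [hlw, hi]
  · have ht2' : t ≠ 0 := ht2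
    simp [hlw, hi, ht2']

lemma DualSys.mono_not_ev (D : DualSys l d) (a : ι → ℕ) : ¬ ∀ᶠ s in 𝓝 z, mono l z a s = 0 := by
  intro h
  obtain ⟨s, h1, -, h2⟩ := D.exists_pt ∅ h
  exact mono_ne_zero (fun i _ => h2 i (by simp)) h1

lemma DualSys.cancel (D : DualSys l d) (a : ι → ℕ) {p q : E → ℂ} (hp : AnalyticAt ℂ p z)
    (hq : AnalyticAt ℂ q z) (h : ∀ᶠ s in 𝓝 z, mono l z a s * p s = mono l z a s * q s) :
    ∀ᶠ s in 𝓝 z, p s = q s := by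
  have := germ_domain (mono_analyticAt l z a z) (hp.fun_sub hq)
    (by filter_upwards [h] with s hs; rw [mul_sub, hs, sub_self])
  rcases this with h' | h'
  · exact absurd h' (D.mono_not_ev a)
  · filter_upwards [h'] with s hs using sub_eq_zero.mp hs

/-- Division by a coordinate. -/
lemma div_coord (i : ι) {p : E → ℂ} (hp : AnalyticAt ℂ p z)
    (h : ∀ᶠ s in 𝓝 z, p (s - l i (s - z) • d i) = 0) :
    ∃ q : E → ℂ, AnalyticAt ℂ q z ∧ ∀ᶠ s in 𝓝 z, p s = l i (s - z) * q s := by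
  obtain ⟨q, hq, hq'⟩ := hadamard hp (l i) (d i)
  refine ⟨q, hq, ?_⟩
  filter_upwards [hq', h] with s h1 h2
  rw [h1, h2, zero_add]

theorem DualSys.factor (D : DualSys l d) : ∀ (n : ℕ) (a : ι → ℕ), ∑ i, a i = n →
    ∀ (p q u : E → ℂ), AnalyticAt ℂ p z → AnalyticAt ℂ q z → AnalyticAt ℂ u z → u z ≠ 0 →
    (∀ᶠ s in 𝓝 z, p s * q s = mono l z a s * u s) →
    ∃ (b : ι → ℕ) (v : E → ℂ), AnalyticAt ℂ v z ∧ v z ≠ 0 ∧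
      ∀ᶠ s in 𝓝 z, p s = mono l z b s * v s := by
  classical
  intro n
  induction n with
  | zero =>
    intro a ha p q u hp hq hu hu0 h
    have ha0 : a = 0 := by
      funext i
      exact (Finset.sum_eq_zero_iff.mp ha) i (Finset.mem_univ i)
    subst ha0
    refine ⟨0, p, hp, ?_, by simp [mono_zero]⟩
    have := h.self_of_nhds
    rw [mono_zero, one_mul] at this
    intro h0
    rw [h0, zero_mul] at this
    exact hu0 this.symm
  | succ n ih =>
    intro a ha p q u hp hq hu hu0 h
    obtain ⟨i, hi⟩ : ∃ i, a i ≠ 0 := by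
      by_contra hcon
      push Not at hcon
      simp [hcon] at ha
    set a' : ι → ℕ := a - Pi.single i 1 with ha'
    have haa : a = a' + Pi.single i 1 := by
      funext j
      by_cases hj : j = i
      · subst hj; simp [ha']; omega
      · simp [ha', hj]
    have hsum : ∑ j, a' j = n := by
      have : ∑ j, a j = ∑ j, a' j + 1 := by
        conv_lhs => rw [haa]
        simp [Finset.sum_add_distrib]
      omega
    set π : E → E := fun s => s - l i (s - z) • d i with hπ
    have hπz : π z = z := by simp [hπ]
    have hπa : AnalyticAt ℂ π z := by
      have : AnalyticAt ℂ (fun s => l i (s - z)) z :=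
        ((l i).analyticAt _).comp_of_eq (f := fun s => s - z) (by fun_prop) rfl
      exact analyticAt_id.fun_sub (this.fun_smul analyticAt_const)
    have hπt : Tendsto π (𝓝 z) (𝓝 z) := by
      have := hπa.continuousAt.tendsto; rwa [hπz] at this
    have hpq := germ_domain (hp.comp_of_eq hπa hπz) (hq.comp_of_eq hπa hπz) (by
      filter_upwards [hπt.eventually h] with s hs
      simp only [Function.comp]
      rw [hs, mono_eq_zero hi, zero_mul]
      simp [hπ, D.one])
    have hsplit : ∀ s, mono l z a s = mono l z (Pi.single i 1) s * mono l z a' s := by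
      intro s; rw [haa, mono_add, mul_comm]
    rcases hpq with h0 | h0
    · obtain ⟨p', hp', hpp⟩ := div_coord i hp h0
      have hc : ∀ᶠ s in 𝓝 z, p' s * q s = mono l z a' s * u s := by
        refine D.cancel (Pi.single i 1) (hp'.fun_mul hq) ((mono_analyticAt l z a' z).fun_mul hu) ?_
        filter_upwards [h, hpp] with s h1 h2
        rw [← mul_assoc, ← mul_assoc, ← hsplit, ← h1, h2, mono_single]
      obtain ⟨b, v, hv, hv0, hb⟩ := ih a' hsum p' q u hp' hq hu hu0 hc
      refine ⟨b + Pi.single i 1, v, hv, hv0, ?_⟩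
      filter_upwards [hpp, hb] with s h1 h2
      rw [h1, h2, mono_add, mono_single]; ring
    · obtain ⟨q', hq', hqq⟩ := div_coord i hq h0
      have hc : ∀ᶠ s in 𝓝 z, p s * q' s = mono l z a' s * u s := by
        refine D.cancel (Pi.single i 1) (hp.fun_mul hq') ((mono_analyticAt l z a' z).fun_mul hu) ?_
        filter_upwards [h, hqq] with s h1 h2
        rw [← mul_assoc, ← mul_assoc, ← hsplit, ← h1, h2, mono_single]; ring
      exact ih a' hsum p q' u hp hq' hu hu0 hc

/-- comparability of exponents -/
lemma DualSys.ord_aux (D : DualSys l d) {a b : ι → ℕ} (hab : ∀ i, a i = 0 ∨ b i = 0)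
    {u v : E → ℂ} (hu : AnalyticAt ℂ u z) (hv : AnalyticAt ℂ v z) (hu0 : u z ≠ 0) (hv0 : v z ≠ 0)
    (j : ι) (hz : ∀ᶠ s in 𝓝 z, l j (s - z) = 0 → mono l z a s * u s = mono l z b s * v s) :
    a = 0 ∨ b = 0 := by
  classical
  by_contra hcon
  push Not at hcon
  obtain ⟨h1, h2⟩ := hcon
  obtain ⟨i, hi⟩ := Function.ne_iff.mp h1
  obtain ⟨i', hi'⟩ := Function.ne_iff.mp h2
  simp only [Pi.zero_apply] at hi hi'
  have hun := hu.continuousAt.eventually_ne hu0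
  have hvn := hv.continuousAt.eventually_ne hv0
  by_cases hj : b j = 0
  · obtain ⟨s, ⟨⟨hs1, hs2⟩, hs3⟩, hs4, hs5⟩ := D.exists_pt {i, j} ((hz.and hun).and hvn)
    have := hs1 (hs4 j (by simp))
    rw [mono_eq_zero hi (hs4 i (by simp)), zero_mul] at this
    refine mul_ne_zero (mono_ne_zero ?_) hs3 this.symm
    intro k hk
    refine hs5 k ?_
    rintro (rfl | rfl)
    · exact (hab k).elim hi hk
    · exact hk hj
  · have hj' : a j = 0 := (hab j).resolve_right hj
    obtain ⟨s, ⟨⟨hs1, hs2⟩, hs3⟩, hs4, hs5⟩ := D.exists_pt {i', j} ((hz.and hun).and hvn)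
    have := hs1 (hs4 j (by simp))
    rw [mono_eq_zero hi' (hs4 i' (by simp)), zero_mul] at this
    refine mul_ne_zero (mono_ne_zero ?_) hs2 this
    intro k hk
    refine hs5 k ?_
    rintro (rfl | rfl)
    · exact (hab k).elim hk hi'
    · exact hk hj'

theorem DualSys.ord (D : DualSys l d) {a b : ι → ℕ}
    {u v : E → ℂ} (hu : AnalyticAt ℂ u z) (hv : AnalyticAt ℂ v z) (hu0 : u z ≠ 0) (hv0 : v z ≠ 0)
    (h : (∀ᶠ s in 𝓝 z, mono l z a s * u s - mono l z b s * v s = 0) ∨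
      ∃ (c : ι → ℕ) (w : E → ℂ), AnalyticAt ℂ w z ∧ w z ≠ 0 ∧
      ∀ᶠ s in 𝓝 z, mono l z a s * u s - mono l z b s * v s = mono l z c s * w s) :
    a ≤ b ∨ b ≤ a := by
  classical
  set c := a ⊓ b with hc
  set a' := a - c with ha'
  set b' := b - c with hb'
  have haa : a = c + a' := by funext i; simp [ha', hc]
  have hbb : b = c + b' := by funext i; simp [hb', hc]
  have hab : ∀ i, a' i = 0 ∨ b' i = 0 := by
    intro i; simp [ha', hb', hc]; omega
  have hP : AnalyticAt ℂ (fun s => mono l z a' s * u s - mono l z b' s * v s) z :=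
    ((mono_analyticAt l z a' z).fun_mul hu).fun_sub ((mono_analyticAt l z b' z).fun_mul hv)
  have hsplit : ∀ s, mono l z a s * u s - mono l z b s * v s =
      mono l z c s * (mono l z a' s * u s - mono l z b' s * v s) := by
    intro s
    conv_lhs => rw [haa, hbb, mono_add, mono_add]
    ring
  suffices hs : a' = 0 ∨ b' = 0 by
    rcases hs with h0 | h0
    · left; rw [haa, h0]; simp [hc]
    · right; rw [hbb, h0]; simp [hc]
  rcases h with h | ⟨g, w, hw, hw0, h⟩
  · have h1 := D.cancel c hP (analyticAt_const (v := (0 : ℂ))) (by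
      filter_upwards [h] with s hs
      rw [← hsplit, hs, mul_zero])
    by_contra hcon
    push Not at hcon
    obtain ⟨i, hi⟩ := Function.ne_iff.mp hcon.1
    have := D.ord_aux hab hu hv hu0 hv0 i (by
      filter_upwards [h1] with s hs _ using sub_eq_zero.mp hs)
    tauto
  · obtain ⟨e, x, hx, hx0, hxe⟩ := D.factor _ g rfl _ _ w hP (mono_analyticAt l z c z) hw hw0 (by
      filter_upwards [h] with s hs
      rw [← hs, hsplit, mul_comm])
    by_contra hcon
    push Not at hcon
    have he : e ≠ 0 := by
      rintro rfl
      have := hxe.self_of_nhds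
      rw [mono_self hcon.1, mono_self hcon.2, mono_zero] at this
      simp at this
      exact hx0 this.symm
    obtain ⟨i, hi⟩ := Function.ne_iff.mp he
    have := D.ord_aux hab hu hv hu0 hv0 i (by
      filter_upwards [hxe] with s hs hs'
      rw [mono_eq_zero hi hs', zero_mul] at hs
      exact sub_eq_zero.mp hs)
    tauto

end Mono
end
end

section
open Filter Topology
open Filter Topology

noncomputable section

section Loj
variable {E : Type*} [NormedAddCommGroup E] [NormedSpace ℂ E]

def MonAt (f : E → ℂ) (z : E) : Prop :=
  ∃ (ι : Type) (_ : Fintype ι) (l : ι → E →L[ℂ] ℂ) (d : ι → E) (a : ι → ℕ) (u : E → ℂ),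
    DualSys l d ∧ AnalyticAt ℂ u z ∧ u z ≠ 0 ∧ ∀ᶠ s in 𝓝 z, f s = mono l z a s * u s

inductive Good : (E → ℂ) → E → Prop
  | mon (f : E → ℂ) (z : E) (h : MonAt f z) : Good f z
  | cover (f : E → ℂ) (z : E) (π : Bool → E → E) (K : Bool → Set E)
      (hK : ∀ b, IsCompact (K b)) (hπ : ∀ b, ∀ κ ∈ K b, AnalyticAt ℂ (π b) κ)
      (hz : ∀ b, ∀ κ ∈ K b, π b κ = z)
      (hg : ∀ b, ∀ κ ∈ K b, Good (fun s => f (π b s)) κ)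
      (hcov : ∀ O : Bool → Set E, (∀ b, O b ∈ 𝓝ˢ (K b)) → (⋃ b, π b '' O b) ∈ 𝓝 z) : Good f z

def LojSet (f : E → ℂ) (S : Set E) : Prop :=
  ∃ θ : ℝ, 0 < θ ∧ θ < 1 ∧ ∃ C : ℝ, 0 < C ∧ ∀ s ∈ S, ‖f s‖ ≤ 1 → ‖f s‖ ^ θ ≤ C * ‖fderiv ℂ f s‖

lemma LojSet.mono_set {f : E → ℂ} {S T : Set E} (h : LojSet f T) (hST : S ⊆ T) : LojSet f S := by
  obtain ⟨θ, h0, h1, C, hC, h⟩ := h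
  exact ⟨θ, h0, h1, C, hC, fun s hs => h s (hST hs)⟩

lemma LojSet.union {f : E → ℂ} {S T : Set E} (h : LojSet f S) (h' : LojSet f T) :
    LojSet f (S ∪ T) := by
  obtain ⟨θ, h0, h1, C, hC, h⟩ := h
  obtain ⟨θ', h0', h1', C', hC', h'⟩ := h'
  refine ⟨max θ θ', lt_max_of_lt_left h0, max_lt h1 h1', max C C', lt_max_of_lt_left hC, ?_⟩
  rintro s (hs | hs) hf
  · calc ‖f s‖ ^ max θ θ' ≤ ‖f s‖ ^ θ := Real.rpow_le_rpow_of_exponent_ge' (norm_nonneg _) hf h0.le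
          (le_max_left _ _)
      _ ≤ _ := (h s hs hf).trans (by gcongr; exact le_max_left _ _)
  · calc ‖f s‖ ^ max θ θ' ≤ ‖f s‖ ^ θ' := Real.rpow_le_rpow_of_exponent_ge' (norm_nonneg _) hf
          h0'.le (le_max_right _ _)
      _ ≤ _ := (h' s hs hf).trans (by gcongr; exact le_max_right _ _)

lemma MonAt.loj {f : E → ℂ} {z : E} (h : MonAt f z) (hf : AnalyticAt ℂ f z) (hf0 : f z = 0) :
    ∃ S ∈ 𝓝 z, LojSet f S := by
  classical
  obtain ⟨ι, _, l, d, a, u, D, hu, hu0, h⟩ := h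
  have ha : a ≠ 0 := by
    rintro rfl
    have := h.self_of_nhds
    rw [mono_zero, one_mul, hf0] at this
    exact hu0 this.symm
  obtain ⟨i₀, hi₀⟩ := Function.ne_iff.mp ha
  simp only [Pi.zero_apply] at hi₀
  set q : ℕ := ∑ i, a i + 1 with hq
  set c : ℝ := min (‖u z‖ / 2) 1 with hc
  have hupos : 0 < ‖u z‖ := norm_pos_iff.mpr hu0
  have hcpos : 0 < c := lt_min (by positivity) one_pos
  set Dm : ℝ := ∑ i, ‖d i‖ + 1 with hDm
  have hDmpos : 0 < Dm := by positivity
  have hdD : ∀ i, ‖d i‖ ≤ Dm := by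
    intro i
    have := Finset.single_le_sum (f := fun i => ‖d i‖) (fun i _ => norm_nonneg _)
      (Finset.mem_univ i)
    linarith
  set M : ℝ := ‖fderiv ℂ u z‖ + 1 with hM
  have e1 : ∀ᶠ s in 𝓝 z, c ≤ ‖u s‖ := by
    have := hu.continuousAt.norm.eventually (lt_mem_nhds (show ‖u z‖ / 2 < ‖u z‖ by linarith))
    filter_upwards [this] with s hs
    exact (min_le_left _ _).trans hs.le
  have e2 : ∀ᶠ s in 𝓝 z, ‖fderiv ℂ u s‖ ≤ M := by
    have := hu.fderiv.continuousAt.norm.eventually (gt_mem_nhds (show ‖fderiv ℂ u z‖ < M by linarith))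
    filter_upwards [this] with s hs using hs.le
  set δ : ℝ := min 1 (c / (2 * M * Dm)) with hδ
  have hMpos : 0 < M := by positivity
  have hδpos : 0 < δ := lt_min one_pos (by positivity)
  have e3 : ∀ᶠ s in 𝓝 z, ∀ i, ‖l i (s - z)‖ ≤ δ := by
    rw [eventually_all]
    intro i
    have hcont : Continuous (fun s => ‖l i (s - z)‖) := by fun_prop
    have := hcont.tendsto z
    simp only [sub_self, map_zero, norm_zero] at this
    filter_upwards [this.eventually (gt_mem_nhds hδpos)] with s hs using hs.le
  have e4 := h.eventually_nhds
  have e5 := hu.eventually_analyticAt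
  have e6 := hf.eventually_analyticAt
  refine ⟨_, (e1.and (e2.and (e3.and (e4.and (e5.and e6))))), 1 - 1 / q, ?_, ?_,
    2 * Dm / c, by positivity, ?_⟩
  · have : (2 : ℝ) ≤ q := by
      have : 1 ≤ ∑ i, a i := by
        have := Finset.single_le_sum (f := a) (fun i _ => Nat.zero_le _) (Finset.mem_univ i₀)
        omega
      rw [hq]; exact_mod_cast (by omega : 2 ≤ ∑ i, a i + 1)
    have : 1 / (q : ℝ) ≤ 1 / 2 := by gcongr
    linarith
  · have : (0 : ℝ) < 1 / q := by positivity
    linarith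
  rintro s ⟨h1, h2, h3, h4, h5, h6⟩ hfs
  by_cases hfz : f s = 0
  · rw [hfz, norm_zero, Real.zero_rpow]
    · positivity
    · have : (2 : ℝ) ≤ q := by
        have : 1 ≤ ∑ i, a i := by
          have := Finset.single_le_sum (f := a) (fun i _ => Nat.zero_le _) (Finset.mem_univ i₀)
          omega
        rw [hq]; exact_mod_cast (by omega : 2 ≤ ∑ i, a i + 1)
      have : 1 / (q : ℝ) ≤ 1 / 2 := by gcongr
      linarith
  have hfs' := h4.self_of_nhds
  -- minimal coordinate
  obtain ⟨j, hj, hjmin⟩ := Finset.exists_min_image (Finset.univ.filter (fun i => a i ≠ 0))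
    (fun i => ‖l i (s - z)‖) ⟨i₀, by simp [hi₀]⟩
  simp only [Finset.mem_filter, Finset.mem_univ, true_and] at hj hjmin
  set x : ℂ := l j (s - z) with hx
  have hx0 : x ≠ 0 := by
    intro hx0
    exact hfz (by rw [hfs', mono_eq_zero hj hx0, zero_mul])
  have hxpos : 0 < ‖x‖ := norm_pos_iff.mpr hx0
  have hxδ : ‖x‖ ≤ δ := h3 j
  have hx1 : ‖x‖ ≤ 1 := hxδ.trans (min_le_left _ _)
  -- derivative
  set R : ℂ := ∏ i ∈ Finset.univ.erase j, (l i (s - z)) ^ (a i) with hR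
  have hline : ∀ t : ℂ, mono l z a (s + t • d j) = (x + t) ^ (a j) * R := by
    intro t
    unfold mono
    rw [← Finset.mul_prod_erase _ _ (Finset.mem_univ j), hR]
    have : s + t • d j - z = (s - z) + t • d j := by abel
    rw [this]
    congr 1
    · simp [D.one, hx]
    · refine Finset.prod_congr rfl fun i hi => ?_
      have hij : i ≠ j := (Finset.mem_erase.mp hi).1
      simp [D.zero i j hij]
  have hF : HasDerivAt (fun t : ℂ => f (s + t • d j)) (fderiv ℂ f s (d j)) 0 := by
    have hin : HasDerivAt (fun t : ℂ => s + t • d j) (d j) 0 := by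
      simpa using ((hasDerivAt_id (0 : ℂ)).smul_const (d j)).const_add s
    have hf' : HasFDerivAt f (fderiv ℂ f s) (s + (0 : ℂ) • d j) := by
      simpa using h6.differentiableAt.hasFDerivAt
    exact hf'.comp_hasDerivAt (0 : ℂ) hin
  have hU : HasDerivAt (fun t : ℂ => u (s + t • d j)) (fderiv ℂ u s (d j)) 0 := by
    have hin : HasDerivAt (fun t : ℂ => s + t • d j) (d j) 0 := by
      simpa using ((hasDerivAt_id (0 : ℂ)).smul_const (d j)).const_add s
    have hf' : HasFDerivAt u (fderiv ℂ u s) (s + (0 : ℂ) • d j) := by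
      simpa using h5.differentiableAt.hasFDerivAt
    exact hf'.comp_hasDerivAt (0 : ℂ) hin
  have hG : HasDerivAt (fun t : ℂ => (x + t) ^ (a j) * R * u (s + t • d j))
      ((a j : ℂ) * x ^ (a j - 1) * R * u s + x ^ (a j) * R * fderiv ℂ u s (d j)) 0 := by
    have hp : HasDerivAt (fun t : ℂ => (x + t) ^ (a j)) ((a j : ℂ) * x ^ (a j - 1)) 0 := by
      simpa using ((hasDerivAt_id (0 : ℂ)).const_add x).fun_pow (a j)
    simpa using (hp.mul_const R).fun_mul hU
  have heq : (fun t : ℂ => f (s + t • d j)) =ᶠ[𝓝 0]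
      (fun t : ℂ => (x + t) ^ (a j) * R * u (s + t • d j)) := by
    have hcont : Tendsto (fun t : ℂ => s + t • d j) (𝓝 0) (𝓝 s) := by
      have : Continuous (fun t : ℂ => s + t • d j) := by fun_prop
      simpa using this.tendsto 0
    filter_upwards [hcont.eventually h4] with t ht
    rw [ht, hline]
  have hder := hF.unique (hG.congr_of_eventuallyEq heq)
  have hfx : f s = x ^ (a j) * R * u s := by
    have := heq.self_of_nhds
    simpa using this
  have hus0 : u s ≠ 0 := by
    intro h0; rw [h0] at h1; simp at h1; linarith
  have hder2 : fderiv ℂ f s (d j) * x = f s * ((a j : ℂ) + x * fderiv ℂ u s (d j) / u s) := by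
    rw [hder, hfx]
    obtain ⟨m, hm⟩ := Nat.exists_eq_succ_of_ne_zero hj
    rw [hm]
    simp only [Nat.succ_eq_add_one, Nat.add_sub_cancel, pow_succ]
    field_simp
  have hlow : (1 : ℝ) / 2 ≤ ‖(a j : ℂ) + x * fderiv ℂ u s (d j) / u s‖ := by
    have b1 : ‖x * fderiv ℂ u s (d j) / u s‖ ≤ 1 / 2 := by
      rw [norm_div, norm_mul, div_le_iff₀ (norm_pos_iff.mpr hus0)]
      have : ‖fderiv ℂ u s (d j)‖ ≤ M * Dm :=
        (ContinuousLinearMap.le_opNorm _ _).trans (by gcongr; exact hdD j)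
      calc ‖x‖ * ‖fderiv ℂ u s (d j)‖ ≤ (c / (2 * M * Dm)) * (M * Dm) := by
            gcongr
            exact hxδ.trans (min_le_right _ _)
        _ = 1 / 2 * c := by field_simp
        _ ≤ _ := by gcongr
    have b2 : (1 : ℝ) ≤ ‖(a j : ℂ)‖ := by
      rw [Complex.norm_natCast]
      exact_mod_cast Nat.one_le_iff_ne_zero.mpr hj
    have := norm_sub_le_norm_add (a j : ℂ) (x * fderiv ℂ u s (d j) / u s)
    linarith
  have hmain : ‖f s‖ / 2 ≤ ‖fderiv ℂ f s‖ * Dm * ‖x‖ := by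
    have : ‖fderiv ℂ f s (d j)‖ * ‖x‖ = ‖f s‖ * ‖(a j : ℂ) + x * fderiv ℂ u s (d j) / u s‖ := by
      rw [← norm_mul, hder2, norm_mul]
    have t1 : ‖fderiv ℂ f s (d j)‖ ≤ ‖fderiv ℂ f s‖ * Dm :=
      (ContinuousLinearMap.le_opNorm _ _).trans (by gcongr; exact hdD j)
    calc ‖f s‖ / 2 = ‖f s‖ * (1 / 2) := by ring
      _ ≤ ‖f s‖ * ‖(a j : ℂ) + x * fderiv ℂ u s (d j) / u s‖ := by gcongr
      _ = ‖fderiv ℂ f s (d j)‖ * ‖x‖ := this.symm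
      _ ≤ _ := by gcongr
  -- ‖x‖ ^ q * c ≤ ‖f s‖
  have hxq : ‖x‖ ^ q * c ≤ ‖f s‖ := by
    rw [hfs', norm_mul]
    have : ‖x‖ ^ q ≤ ‖mono l z a s‖ := by
      unfold mono
      rw [norm_prod]
      calc ‖x‖ ^ q ≤ ‖x‖ ^ (∑ i, a i) := pow_le_pow_of_le_one hxpos.le hx1 (by omega)
        _ = ∏ i, ‖x‖ ^ (a i) := (Finset.prod_pow_eq_pow_sum _ _ _).symm
        _ ≤ _ := by
          refine Finset.prod_le_prod (fun i _ => by positivity) fun i _ => ?_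
          rw [norm_pow]
          by_cases hi : a i = 0
          · simp [hi]
          · have := hjmin i hi
            gcongr
    gcongr
  have hfpos : 0 < ‖f s‖ := norm_pos_iff.mpr hfz
  have hqpos : (0 : ℝ) < q := by rw [hq]; positivity
  have hxle : ‖x‖ * c ≤ ‖f s‖ ^ (1 / (q : ℝ)) := by
    have h7 : (‖x‖ * c) ^ q ≤ ‖f s‖ := by
      rw [mul_pow]
      refine le_trans ?_ hxq
      gcongr
      exact pow_le_of_le_one hcpos.le (min_le_right _ _) (by omega)
    rw [one_div, Real.le_rpow_inv_iff_of_pos (by positivity) hfpos.le hqpos, Real.rpow_natCast]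
    exact h7
  rw [Real.rpow_sub hfpos, Real.rpow_one]
  have hp : 0 < ‖f s‖ ^ (1 / (q : ℝ)) := by positivity
  rw [div_le_iff₀ hp]
  calc ‖f s‖ = 2 * (‖f s‖ / 2) := by ring
    _ ≤ 2 * (‖fderiv ℂ f s‖ * Dm * ‖x‖) := by gcongr
    _ = 2 * Dm / c * ‖fderiv ℂ f s‖ * (‖x‖ * c) := by field_simp
    _ ≤ _ := by gcongr

theorem Good.loj [CompleteSpace E] {f : E → ℂ} {z : E} (h : Good f z) (hf : AnalyticAt ℂ f z) (hf0 : f z = 0) :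
    ∃ S ∈ 𝓝 z, LojSet f S := by
  induction h with
  | mon f z h => exact h.loj hf hf0
  | cover f z π K hK hπ hz hg hcov ih =>
    have key : ∀ b, ∃ O ∈ 𝓝ˢ (K b), LojSet f (π b '' O) := by
      intro b
      refine (hK b).induction_on (p := fun S => ∃ O ∈ 𝓝ˢ S, LojSet f (π b '' O)) ?_ ?_ ?_ ?_
      · exact ⟨∅, by simp, by simpa using ⟨1/2, by norm_num, by norm_num, 1, by norm_num, by simp⟩⟩
      · rintro S T hST ⟨O, hO, h⟩
        exact ⟨O, nhdsSet_mono hST hO, h⟩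
      · rintro S T ⟨O, hO, h⟩ ⟨O', hO', h'⟩
        refine ⟨O ∪ O', union_mem_nhdsSet hO hO', ?_⟩
        rw [Set.image_union]
        exact h.union h'
      · intro κ hκ
        have hfπ : AnalyticAt ℂ (fun s => f (π b s)) κ :=
          hf.comp_of_eq (hπ b κ hκ) (hz b κ hκ)
        obtain ⟨S, hS, θ, h0, h1, C, hC, hb⟩ := ih b κ hκ hfπ (by simp only [hz b κ hκ, hf0])
        have hcont : Tendsto (π b) (𝓝 κ) (𝓝 z) := by
          have := (hπ b κ hκ).continuousAt.tendsto; rwa [hz b κ hκ] at this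
        have g1 := hcont.eventually hf.eventually_analyticAt
        have g2 := (hπ b κ hκ).eventually_analyticAt
        have g3 : ∀ᶠ s in 𝓝 κ, ‖fderiv ℂ (π b) s‖ < ‖fderiv ℂ (π b) κ‖ + 1 :=
          (hπ b κ hκ).fderiv.continuousAt.norm.eventually
            (gt_mem_nhds (lt_add_one _))
        obtain ⟨V, hV, hVo, hVκ⟩ := mem_nhds_iff.mp
          (Filter.inter_mem hS (g1.and (g2.and g3)))
        refine ⟨V, mem_nhdsWithin_of_mem_nhds (hVo.mem_nhds hVκ), V, hVo.mem_nhdsSet.mpr subset_rfl,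
          θ, h0, h1, C * (‖fderiv ℂ (π b) κ‖ + 1), by positivity, ?_⟩
        rintro _ ⟨s, hs, rfl⟩ hfs
        obtain ⟨hsS, k1, k2, k3⟩ := hV hs
        have hchain : fderiv ℂ (fun s => f (π b s)) s = (fderiv ℂ f (π b s)).comp
            (fderiv ℂ (π b) s) := fderiv_comp s k1.differentiableAt k2.differentiableAt
        refine (hb s hsS hfs).trans ?_
        rw [hchain]
        calc C * ‖(fderiv ℂ f (π b s)).comp (fderiv ℂ (π b) s)‖
            ≤ C * (‖fderiv ℂ f (π b s)‖ * ‖fderiv ℂ (π b) s‖) := by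
              gcongr; exact ContinuousLinearMap.opNorm_comp_le _ _
          _ ≤ C * (‖fderiv ℂ f (π b s)‖ * (‖fderiv ℂ (π b) κ‖ + 1)) := by gcongr
          _ = _ := by ring
    choose O hO hL using key
    refine ⟨_, hcov O hO, ?_⟩
    have : (⋃ b, π b '' O b) = π true '' O true ∪ π false '' O false := by
      ext s; simp [Set.mem_iUnion, or_comm]
    rw [this]
    exact (hL true).union (hL false)

end Loj
end
end

section
open Filter Topology
open Filter Topology

noncomputable section

section GoodLemmas
variable {E : Type*} [NormedAddCommGroup E] [NormedSpace ℂ E]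

lemma Good.congr {f g : E → ℂ} {z : E} (h : Good f z) (hfg : ∀ᶠ s in 𝓝 z, f s = g s) :
    Good g z := by
  induction h generalizing g with
  | mon f z h =>
    obtain ⟨ι, hι, l, d, a, u, D, hu, hu0, h⟩ := h
    refine Good.mon _ _ ⟨ι, hι, l, d, a, u, D, hu, hu0, ?_⟩
    filter_upwards [h, hfg] with s h1 h2
    rw [← h2, h1]
  | cover f z π K hK hπ hz hg hcov ih =>
    refine Good.cover _ _ π K hK hπ hz (fun b κ hκ => ih b κ hκ ?_) hcov
    have hcont : Tendsto (π b) (𝓝 κ) (𝓝 z) := by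
      have := (hπ b κ hκ).continuousAt.tendsto; rwa [hz b κ hκ] at this
    exact hcont.eventually hfg

lemma Good.single {f : E → ℂ} {z : E} (π : E → E) (κ : E) (hπ : AnalyticAt ℂ π κ) (hz : π κ = z)
    (hg : Good (fun s => f (π s)) κ) (hcov : ∀ O ∈ 𝓝 κ, π '' O ∈ 𝓝 z) : Good f z := by
  refine Good.cover f z (fun _ => π) (fun b => if b then {κ} else ∅) ?_ ?_ ?_ ?_ ?_
  · rintro (_ | _) <;> simp
  · rintro (_ | _) <;> simp [hπ]
  · rintro (_ | _) <;> simp [hz]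
  · rintro (_ | _) <;> simp [hg]
  · intro O hO
    have h1 := hO true
    simp only [if_true, nhdsSet_singleton] at h1
    exact Filter.mem_of_superset (hcov _ h1) (Set.subset_iUnion (fun b => π '' O b) true)

lemma Good.lift (Rel : (E → ℂ) → E → (E × ℂ → ℂ) → Prop) (ζ : ℂ)
    (hpull : ∀ h y F π κ, AnalyticAt ℂ π κ → π κ = y → Rel h y F →
      Rel (fun s => h (π s)) κ (fun p => F (π p.1, p.2)))
    (hmon : ∀ h y F, MonAt h y → Rel h y F → Good F (y, ζ))
    {h : E → ℂ} {y : E} (hh : Good h y) {F : E × ℂ → ℂ} (hF : Rel h y F) : Good F (y, ζ) := by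
  induction hh generalizing F with
  | mon h y hm => exact hmon h y F hm hF
  | cover h y π K hK hπ hz hg hcov ih =>
    refine Good.cover _ _ (fun b p => (π b p.1, p.2)) (fun b => K b ×ˢ {ζ})
      (fun b => (hK b).prod isCompact_singleton) ?_ ?_ ?_ ?_
    · rintro b ⟨κ, c⟩ ⟨hκ, hc⟩
      exact ((hπ b κ hκ).comp_of_eq (f := Prod.fst) analyticAt_fst rfl).prod analyticAt_snd
    · rintro b ⟨κ, c⟩ ⟨hκ, hc⟩
      simp only [Set.mem_singleton_iff] at hc hκ ⊢
      rw [hz b κ hκ, hc]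
    · rintro b ⟨κ, c⟩ ⟨hκ, hc⟩
      simp only [Set.mem_singleton_iff] at hc hκ ⊢
      subst hc
      exact ih b κ hκ (hpull h y F (π b) κ (hπ b κ hκ) (hz b κ hκ) hF)
    · intro O hO
      have : ∀ b, ∃ O' ∈ 𝓝ˢ (K b), ∃ V ∈ 𝓝 ζ, O' ×ˢ V ⊆ O b := by
        intro b
        have := hO b
        rw [(hK b).nhdsSet_prod_eq isCompact_singleton, nhdsSet_singleton, mem_prod_iff] at this
        exact this
      choose O' hO' V hV hsub using this
      have h1 := hcov O' hO'
      have h2 : (⋂ b, V b) ∈ 𝓝 ζ := by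
        rw [Filter.iInter_mem]; exact hV
      refine Filter.mem_of_superset (prod_mem_nhds h1 h2) ?_
      rintro ⟨s, c⟩ ⟨hs, hc⟩
      obtain ⟨b, t, ht, rfl⟩ := Set.mem_iUnion.mp hs
      exact Set.mem_iUnion.mpr ⟨b, (t, c), hsub b ⟨ht, Set.mem_iInter.mp hc b⟩, rfl⟩

lemma DualSys.monAt {ι : Type} [Fintype ι] {l : ι → E →L[ℂ] ℂ} {d : ι → E} (D : DualSys l d)
    (z₀ z : E) (a : ι → ℕ) {u F : E → ℂ} (hu : AnalyticAt ℂ u z) (hu0 : u z ≠ 0)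
    (h : ∀ᶠ s in 𝓝 z, F s = mono l z₀ a s * u s) : MonAt F z := by
  classical
  refine ⟨ι, inferInstance, l, d, fun i => if l i (z - z₀) = 0 then a i else 0,
    fun s => (∏ i, if l i (z - z₀) = 0 then 1 else l i (s - z₀) ^ (a i)) * u s, D, ?_, ?_, ?_⟩
  · refine AnalyticAt.fun_mul ?_ hu
    refine Finset.analyticAt_fun_prod _ fun i _ => ?_
    split_ifs
    · exact analyticAt_const
    · exact (((l i).analyticAt _).comp_of_eq (f := fun s => s - z₀) (by fun_prop) rfl).pow _
  · refine mul_ne_zero (Finset.prod_ne_zero_iff.mpr fun i _ => ?_) hu0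
    split_ifs with h0
    · exact one_ne_zero
    · exact pow_ne_zero _ h0
  · filter_upwards [h] with s hs
    rw [hs, ← mul_assoc]
    congr 1
    unfold mono
    rw [← Finset.prod_mul_distrib]
    refine Finset.prod_congr rfl fun i _ => ?_
    beta_reduce
    split_ifs with h0
    · have : l i (s - z₀) = l i (s - z) := by
        have e : s - z₀ = (s - z) + (z - z₀) := by abel
        rw [e, map_add, h0, add_zero]
      rw [this, mul_one]
    · rw [pow_zero, one_mul]

/-- extension of the partial dual basis to `E × ℂ`. -/
def lExt {ι : Type} (l : ι → E →L[ℂ] ℂ) : Option ι → (E × ℂ) →L[ℂ] ℂ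
  | none => ContinuousLinearMap.snd ℂ E ℂ
  | some i => (l i).comp (ContinuousLinearMap.fst ℂ E ℂ)

def dExt {ι : Type} (d : ι → E) : Option ι → E × ℂ
  | none => (0, 1)
  | some i => (d i, 0)

lemma DualSys.ext {ι : Type} {l : ι → E →L[ℂ] ℂ} {d : ι → E} (D : DualSys l d) :
    DualSys (lExt l) (dExt d) where
  one := by rintro (_ | i) <;> simp [lExt, dExt, D.one]
  zero := by
    rintro (_ | i) (_ | j) h
    · exact absurd rfl h
    · simp [lExt, dExt]
    · simp [lExt, dExt]
    · simp [lExt, dExt, D.zero i j (by simpa using h)]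

lemma DualSys.monAt_prod {ι : Type} [Fintype ι] {l : ι → E →L[ℂ] ℂ} {d : ι → E} (D : DualSys l d)
    (y₀ : E) (c : ℂ) (z : E × ℂ) (a : ι → ℕ) (k : ℕ) {u F : E × ℂ → ℂ}
    (hu : AnalyticAt ℂ u z) (hu0 : u z ≠ 0)
    (h : ∀ᶠ p in 𝓝 z, F p = mono l y₀ a p.1 * (p.2 - c) ^ k * u p) : MonAt F z := by
  refine D.ext.monAt (y₀, c) z (fun o => o.elim k a) hu hu0 ?_
  filter_upwards [h] with p hp
  rw [hp]
  congr 1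
  unfold mono
  rw [Fintype.prod_option]
  simp [lExt, mul_comm]

lemma comp_fst_analyticAt {m : E → ℂ} {p : E × ℂ} (hm : AnalyticAt ℂ m p.1) :
    AnalyticAt ℂ (fun p : E × ℂ => m p.1) p :=
  hm.comp_of_eq (f := Prod.fst) analyticAt_fst rfl

lemma ev_fst {P : E → Prop} {p : E × ℂ} (h : ∀ᶠ y in 𝓝 p.1, P y) : ∀ᶠ q in 𝓝 p, P q.1 :=
  continuousAt_fst.eventually h

/-- `m(y) * unit` is good if `m` is good. -/
lemma Good.mul_unit {m : E → ℂ} {y : E} (h : Good m y) {ζ : ℂ} {U F : E × ℂ → ℂ}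
    (hU : AnalyticAt ℂ U (y, ζ)) (hU0 : U (y, ζ) ≠ 0)
    (hF : ∀ᶠ p in 𝓝 (y, ζ), F p = m p.1 * U p) : Good F (y, ζ) := by
  refine Good.lift (fun m y F => ∃ U : E × ℂ → ℂ, AnalyticAt ℂ U (y, ζ) ∧ U (y, ζ) ≠ 0 ∧
    ∀ᶠ p in 𝓝 (y, ζ), F p = m p.1 * U p) ζ ?_ ?_ h ⟨U, hU, hU0, hF⟩
  · rintro h y F π κ hπ rfl ⟨U, hU, hU0, hF⟩
    have ha : AnalyticAt ℂ (fun p : E × ℂ => (π p.1, p.2)) (κ, ζ) :=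
      (hπ.comp_of_eq (f := Prod.fst) analyticAt_fst rfl).prod analyticAt_snd
    refine ⟨fun p => U (π p.1, p.2), hU.comp_of_eq ha rfl, hU0, ?_⟩
    exact ha.continuousAt.eventually hF
  · rintro h y F ⟨ι, hι, l, d, a, u, D, hu, hu0, h⟩ ⟨U, hU, hU0, hF⟩
    refine Good.mon _ _ (D.monAt_prod y 0 (y, ζ) a 0 (u := fun p => u p.1 * U p)
      ((comp_fst_analyticAt hu).fun_mul hU) (mul_ne_zero hu0 hU0) ?_)
    filter_upwards [hF, ev_fst (p := (y, ζ)) h] with p h1 h2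
    rw [h1, h2]; ring

end GoodLemmas
end
end

section
open Filter Topology
open Filter Topology

noncomputable section

section PolyOrder
open Polynomial

lemma iteratedDeriv_polyEval (P : ℂ[X]) (k : ℕ) (a : ℂ) :
    iteratedDeriv k (fun x => P.eval x) a = (Polynomial.derivative^[k] P).eval a := by
  induction k generalizing P with
  | zero => simp
  | succ k ih =>
    rw [iteratedDeriv_succ', Function.iterate_succ_apply]
    have : deriv (fun x => P.eval x) = fun x => (Polynomial.derivative P).eval x := by
      funext x; simp
    rw [this, ih]

lemma poly_order {d : ℕ} (c : ℕ → ℂ) {U a : ℂ} (hU : U ≠ 0) (hc : ∃ j < d - 1, c j ≠ 0) :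
    analyticOrderAt (fun x : ℂ => ∑ j ∈ Finset.range (d - 1), c j * x ^ j + x ^ d * U) a < d := by
  obtain ⟨j₀, hj₀, hcj⟩ := hc
  obtain ⟨e, rfl⟩ : ∃ e, d = e + 2 := ⟨d - 2, by omega⟩
  have hee : e + 2 - 1 = e + 1 := rfl
  rw [hee] at hj₀ ⊢
  set P : ℂ[X] := ∑ j ∈ Finset.range (e + 1), C (c j) * X ^ j + C U * X ^ (e + 2) with hP
  have hfun : (fun x : ℂ => ∑ j ∈ Finset.range (e + 1), c j * x ^ j + x ^ (e + 2) * U) =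
      fun x => P.eval x := by
    funext x
    simp only [hP, Polynomial.eval_add, Polynomial.eval_finsetSum, Polynomial.eval_mul,
      Polynomial.eval_C, Polynomial.eval_pow, Polynomial.eval_X]
    ring
  have hcoeff : ∀ k, P.coeff k = (if k < e + 1 then c k else 0) + if k = e + 2 then U else 0 := by
    intro k
    rw [hP, coeff_add, finsetSum_coeff]
    simp only [coeff_C_mul, coeff_X_pow]
    simp
  rw [hfun]
  by_contra hcon
  rw [not_lt] at hcon
  have hPa : AnalyticAt ℂ (fun x => P.eval x) a := by
    rw [← hfun]
    have : ∀ j ∈ Finset.range (e + 1), AnalyticAt ℂ (fun x : ℂ => c j * x ^ j) a := by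
      intro j _; fun_prop
    exact (Finset.analyticAt_fun_sum _ this).fun_add (by fun_prop)
  have hder := (natCast_le_analyticOrderAt_iff_iteratedDeriv_eq_zero hPa).mp hcon
  have ha : a = 0 := by
    have h1 := hder (e + 1) (by omega)
    rw [iteratedDeriv_polyEval] at h1
    have hdeg : (Polynomial.derivative^[e + 1] P).natDegree < 2 := by
      have : P.natDegree ≤ e + 2 := by
        rw [natDegree_le_iff_coeff_eq_zero]
        intro k hk
        rw [hcoeff, if_neg (by omega), if_neg (by omega), add_zero]
      have := Polynomial.natDegree_iterate_derivative P (e + 1)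
      omega
    rw [eval_eq_sum_range' hdeg, Finset.sum_range_succ, Finset.sum_range_one,
      coeff_iterate_derivative, coeff_iterate_derivative, hcoeff, hcoeff] at h1
    simp only [zero_add, lt_irrefl, if_false, pow_zero, mul_one, pow_one] at h1
    rw [if_neg (by omega), if_neg (by omega), if_pos (by omega)] at h1
    simp only [zero_add, smul_zero, nsmul_eq_mul] at h1
    rcases mul_eq_zero.mp h1 with h2 | h2
    · rcases mul_eq_zero.mp h2 with h3 | h3
      · have : Nat.descFactorial (1 + (e + 1)) (e + 1) = 0 := by exact_mod_cast h3
        rw [Nat.descFactorial_eq_zero_iff_lt] at this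
        omega
      · exact absurd h3 hU
    · exact h2
  subst ha
  have h1 := hder j₀ (by omega)
  rw [iteratedDeriv_polyEval, ← coeff_zero_eq_eval_zero, coeff_iterate_derivative, hcoeff,
    if_pos (by omega), if_neg (by omega)] at h1
  simp only [zero_add, add_zero, nsmul_eq_mul] at h1
  rcases mul_eq_zero.mp h1 with h3 | h3
  · have : Nat.descFactorial j₀ j₀ = 0 := by exact_mod_cast h3
    rw [Nat.descFactorial_eq_zero_iff_lt] at this
    omega
  · exact hcj h3

end PolyOrder

section ZClaim
variable {E : Type*} [NormedAddCommGroup E] [NormedSpace ℂ E]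

variable (E) in
def StepP (d : ℕ) : Prop := ∀ (y : E) (ζ : ℂ) (m : E → ℂ) (g : E × ℂ → ℂ), AnalyticAt ℂ m y →
  (¬ ∀ᶠ s in 𝓝 y, m s = 0) → AnalyticAt ℂ g (y, ζ) →
  analyticOrderAt (fun c => g (y, c)) ζ = d → Good (fun p => m p.1 * g p) (y, ζ)

/-- The two blow-up charts cover a neighbourhood. -/
lemma chart_cover (l : E →L[ℂ] ℂ) (d : E) (hld : l d = 1) (y : E) (C : ℝ) (hC : 0 < C)
    (Oa Ob : Set (E × ℂ)) (ha : Oa ∈ 𝓝ˢ ({y} ×ˢ Metric.closedBall (0 : ℂ) C))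
    (hb : Ob ∈ 𝓝ˢ ((fun t : ℂ => (y + t • d, (0 : ℂ))) '' Metric.closedBall 0 (1 / C))) :
    ((fun p : E × ℂ => (p.1, l (p.1 - y) * p.2)) '' Oa) ∪
      ((fun p : E × ℂ => (p.1 + ((p.2 - 1) * l (p.1 - y)) • d, p.2)) '' Ob) ∈ 𝓝 (y, (0 : ℂ)) := by
  rw [isCompact_singleton.nhdsSet_prod_eq (isCompact_closedBall _ _), nhdsSet_singleton,
    mem_prod_iff] at ha
  obtain ⟨V, hV, B, hB, hVB⟩ := ha
  have hB' : Metric.closedBall (0 : ℂ) C ⊆ B := subset_of_mem_nhdsSet hB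
  have hKc : IsCompact ((fun t : ℂ => (y + t • d, (0 : ℂ))) '' Metric.closedBall 0 (1 / C)) :=
    (isCompact_closedBall _ _).image (by fun_prop)
  obtain ⟨Ob', hOb', hKO, hOO⟩ : ∃ O', IsOpen O' ∧ _ ⊆ O' ∧ O' ⊆ Ob :=
    let ⟨O', h1, h2, h3⟩ := mem_nhdsSet_iff_exists.mp hb; ⟨O', h1, h2, h3⟩
  obtain ⟨δ, hδ, hth⟩ := hKc.exists_thickening_subset_open hOb' hKO
  have e1 : ∀ᶠ p : E × ℂ in 𝓝 (y, (0 : ℂ)), p.1 ∈ V := continuousAt_fst.eventually hV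
  have e2 : ∀ᶠ p : E × ℂ in 𝓝 (y, (0 : ℂ)), ‖((p.1 - y) - l (p.1 - y) • d, p.2)‖ < δ := by
    have hc : Continuous (fun p : E × ℂ => ‖((p.1 - y) - l (p.1 - y) • d, p.2)‖) := by fun_prop
    have := hc.tendsto (y, (0 : ℂ))
    simp only [sub_self, map_zero, zero_smul] at this
    refine this.eventually (gt_mem_nhds ?_)
    simpa using hδ
  filter_upwards [e1, e2] with p hp1 hp2
  obtain ⟨s, ζ⟩ := p
  simp only at hp1 hp2
  set W := l (s - y) with hW
  by_cases hle : ‖ζ‖ ≤ C * ‖W‖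
  · left
    refine ⟨(s, ζ / W), hVB ⟨hp1, hB' ?_⟩, ?_⟩
    · rw [mem_closedBall_zero_iff, norm_div]
      by_cases hW0 : W = 0
      · simp [hW0, hC.le]
      · rw [div_le_iff₀ (norm_pos_iff.mpr hW0)]; exact hle
    · simp only [← hW, Prod.mk.injEq, true_and]
      by_cases hW0 : W = 0
      · rw [hW0, norm_zero, mul_zero] at hle
        have : ζ = 0 := norm_le_zero_iff.mp hle
        simp [this]
      · field_simp
  · right
    rw [not_le] at hle
    have hζ0 : ζ ≠ 0 := by
      rintro rfl
      rw [norm_zero] at hle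
      have : 0 ≤ C * ‖W‖ := by positivity
      linarith
    have hζp : 0 < ‖ζ‖ := norm_pos_iff.mpr hζ0
    refine ⟨(s + (W / ζ - W) • d, ζ), hOO (hth ?_), ?_⟩
    · rw [Metric.mem_thickening_iff]
      refine ⟨_, ⟨W / ζ, ?_, rfl⟩, ?_⟩
      · rw [mem_closedBall_zero_iff, norm_div, div_le_div_iff₀ hζp hC]
        linarith
      · rw [dist_eq_norm]
        have e0 : (s + (W / ζ - W) • d, ζ) - (y + (W / ζ) • d, (0 : ℂ)) =
            ((s - y) - W • d, ζ) := by
          ext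
          · simp only [Prod.fst_sub, sub_smul]; abel
          · simp
        rw [e0]
        exact hp2
    · have e : s + (W / ζ - W) • d - y = (s - y) + (W / ζ - W) • d := by abel
      have e' : l (s + (W / ζ - W) • d - y) = W / ζ := by
        rw [e, map_add, map_smul, hld, ← hW]; simp
      simp only [e', Prod.mk.injEq, and_true]
      rw [add_assoc, ← add_smul]
      have : W / ζ - W + (ζ - 1) * (W / ζ) = 0 := by field_simp; ring
      rw [this, zero_smul, add_zero]

theorem zclaim {d : ℕ} (IH : ∀ d' < d, StepP E d') {ι : Type} [Fintype ι]
    {l : ι → E →L[ℂ] ℂ} {dd : ι → E} (D : DualSys l dd) (y : E) :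
    ∀ (n : ℕ) (β : ι → ℕ), ∑ i, β i = n → β ≠ 0 → ∀ (μ : ι → ℕ) (c : ℕ → E × ℂ → ℂ)
      (U F : E × ℂ → ℂ), (∀ j, AnalyticAt ℂ (c j) (y, 0)) → AnalyticAt ℂ U (y, 0) →
      U (y, 0) ≠ 0 → (∃ j < d - 1, c j (y, 0) ≠ 0) →
      (∀ᶠ p in 𝓝 (y, (0 : ℂ)), F p = mono l y μ p.1 *
        (∑ j ∈ Finset.range (d - 1), c j p * mono l y β p.1 ^ (d - j) * p.2 ^ j + p.2 ^ d * U p)) →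
      Good F (y, 0) := by
  classical
  intro n
  induction n with
  | zero =>
    intro β hβ hβ0
    exact absurd (funext fun i => (Finset.sum_eq_zero_iff.mp hβ) i (Finset.mem_univ i)) hβ0
  | succ n ih =>
    intro β hβ hβ0 μ c U F hc hU hU0 hcj hF
    obtain ⟨i, hi⟩ := Function.ne_iff.mp hβ0
    simp only [Pi.zero_apply] at hi
    have hd2 : 2 ≤ d := by obtain ⟨j, hj, -⟩ := hcj; omega
    set β' : ι → ℕ := β - Pi.single i 1 with hβ'
    have hββ : β = β' + Pi.single i 1 := by
      funext j
      by_cases hj : j = i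
      · subst hj; simp [hβ']; omega
      · simp [hβ', hj]
    have hsum : ∑ j, β' j = n := by
      have : ∑ j, β j = ∑ j, β' j + 1 := by
        conv_lhs => rw [hββ]
        simp [Finset.sum_add_distrib]
      omega
    -- the constant C
    have hUp : 0 < ‖U (y, 0)‖ := norm_pos_iff.mpr hU0
    set S : ℝ := ∑ j ∈ Finset.range (d - 1), ‖c j (y, 0)‖ with hS
    have hS0 : 0 ≤ S := Finset.sum_nonneg fun _ _ => norm_nonneg _
    set C : ℝ := S / ‖U (y, 0)‖ + 1 with hC
    have hC1 : 1 ≤ C := by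
      have : 0 ≤ S / ‖U (y, 0)‖ := by positivity
      linarith
    have hC0 : 0 < C := by linarith
    have hSC : S * (1 / C) < ‖U (y, 0)‖ := by
      rw [mul_one_div, div_lt_iff₀ hC0, hC, mul_add, mul_div_cancel₀ _ hUp.ne']
      linarith
    have hWan : ∀ s : E, AnalyticAt ℂ (fun s => l i (s - y)) s := fun s =>
      ((l i).analyticAt _).comp_of_eq (f := fun s => s - y) (by fun_prop) rfl
    set πa : E × ℂ → E × ℂ := fun p => (p.1, l i (p.1 - y) * p.2) with hπa
    set πb : E × ℂ → E × ℂ := fun p => (p.1 + ((p.2 - 1) * l i (p.1 - y)) • dd i, p.2) with hπb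
    have hπaA : ∀ p, AnalyticAt ℂ πa p := fun p =>
      analyticAt_fst.prod ((comp_fst_analyticAt (hWan p.1)).fun_mul analyticAt_snd)
    have hπbA : ∀ p, AnalyticAt ℂ πb p := fun p =>
      (analyticAt_fst.fun_add (((analyticAt_snd.fun_sub analyticAt_const).fun_mul
        (comp_fst_analyticAt (hWan p.1))).fun_smul analyticAt_const)).prod analyticAt_snd
    have hmonoA : ∀ (γ : ι → ℕ) (p : E × ℂ), AnalyticAt ℂ (fun p : E × ℂ => mono l y γ p.1) p :=
      fun γ p => comp_fst_analyticAt (mono_analyticAt l y γ p.1)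
    have GA : ∀ ζ : ℂ, Good (fun s => F (πa s)) (y, ζ) := by
      intro ζ
      have hπκ : πa (y, ζ) = (y, 0) := by simp [hπa]
      have hcont : Tendsto πa (𝓝 (y, ζ)) (𝓝 (y, 0)) := by
        have := (hπaA (y, ζ)).continuousAt.tendsto; rwa [hπκ] at this
      have hc' : ∀ j, AnalyticAt ℂ (fun p => c j (πa p)) (y, ζ) := fun j =>
        (hc j).comp_of_eq (hπaA _) hπκ
      have hU' : AnalyticAt ℂ (fun p => U (πa p)) (y, ζ) := hU.comp_of_eq (hπaA _) hπκ
      set g : E × ℂ → ℂ := fun p => ∑ j ∈ Finset.range (d - 1),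
        c j (πa p) * mono l y β' p.1 ^ (d - j) * p.2 ^ j + p.2 ^ d * U (πa p) with hg
      have hgA : AnalyticAt ℂ g (y, ζ) := by
        refine AnalyticAt.fun_add (Finset.analyticAt_fun_sum _ fun j _ => ?_) ?_
        · exact ((hc' j).fun_mul ((hmonoA β' _).fun_pow _)).fun_mul (analyticAt_snd.fun_pow _)
        · exact (analyticAt_snd.fun_pow _).fun_mul hU'
      have hFg : ∀ᶠ p in 𝓝 (y, ζ), F (πa p) =
          mono l y (μ + d • Pi.single i 1) p.1 * g p := by
        filter_upwards [hcont.eventually hF] with p hp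
        rw [hp, mono_add, mono_nsmul, mono_single, hg]
        simp only [hπa]
        rw [mul_assoc]
        congr 1
        rw [mul_add, Finset.mul_sum]
        congr 1
        · refine Finset.sum_congr rfl fun j hj => ?_
          have hjd : d = (d - j) + j := by have := Finset.mem_range.mp hj; omega
          have hm : mono l y β p.1 = mono l y β' p.1 * l i (p.1 - y) := by
            conv_lhs => rw [hββ, mono_add, mono_single]
          rw [hm, mul_pow, mul_pow]
          conv_rhs => rw [show (l i (p.1 - y)) ^ d = (l i (p.1 - y)) ^ (d - j) *
            (l i (p.1 - y)) ^ j by rw [← pow_add, ← hjd]]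
          ring
        · rw [mul_pow]; ring
      by_cases hβ'0 : β' = 0
      · -- descend in d
        have hgy : (fun c' => g (y, c')) = fun x => ∑ j ∈ Finset.range (d - 1),
            c j (y, 0) * x ^ j + x ^ d * U (y, 0) := by
          funext x
          have : πa (y, x) = (y, 0) := by simp [hπa]
          simp only [hg, this, hβ'0, mono_zero, one_pow, mul_one]
        have hlt := poly_order (d := d) (fun j => c j (y, 0)) (a := ζ) hU0 hcj
        rw [← hgy] at hlt
        obtain ⟨d', hd'⟩ := ENat.ne_top_iff_exists.mp (ne_top_of_lt hlt)
        rw [← hd'] at hlt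
        have hd'lt : d' < d := by exact_mod_cast hlt
        refine (IH d' hd'lt y ζ (mono l y (μ + d • Pi.single i 1)) g (mono_analyticAt _ _ _ _)
          (D.mono_not_ev _) hgA hd'.symm).congr ?_
        filter_upwards [hFg] with p hp using hp.symm
      · by_cases hζ : ζ = 0
        · subst hζ
          refine ih β' hsum hβ'0 (μ + d • Pi.single i 1) (fun j p => c j (πa p))
            (fun p => U (πa p)) _ hc' hU' (by rw [hπκ]; exact hU0) ?_ hFg
          obtain ⟨j, hj, hj'⟩ := hcj
          exact ⟨j, hj, by rw [hπκ]; exact hj'⟩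
        · refine Good.mon _ _ (D.monAt_prod y 0 (y, ζ) (μ + d • Pi.single i 1) 0 (u := g) hgA ?_ ?_)
          · have : g (y, ζ) = ζ ^ d * U (y, 0) := by
              simp only [hg, hπκ, mono_self hβ'0]
              rw [Finset.sum_eq_zero, zero_add]
              intro j hj
              have := Finset.mem_range.mp hj
              rw [zero_pow (by omega)]; ring
            rw [this]
            exact mul_ne_zero (pow_ne_zero _ hζ) hU0
          · filter_upwards [hFg] with p hp
            rw [hp, pow_zero, mul_one]
    have GB : ∀ t : ℂ, ‖t‖ ≤ 1 / C → Good (fun s => F (πb s)) (y + t • dd i, 0) := by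
      intro t ht
      have hlt : l i (y + t • dd i - y) = t := by simp [D.one]
      have hπκ : πb (y + t • dd i, 0) = (y, 0) := by
        simp only [hπb, hlt, Prod.mk.injEq, and_true]
        rw [add_assoc, ← add_smul]; simp
      set κ : E × ℂ := (y + t • dd i, 0) with hκ
      have hcont : Tendsto πb (𝓝 κ) (𝓝 (y, 0)) := by
        have := (hπbA κ).continuousAt.tendsto; rwa [hπκ] at this
      have hc' : ∀ j, AnalyticAt ℂ (fun p => c j (πb p)) κ := fun j =>
        (hc j).comp_of_eq (hπbA _) hπκ
      have hU' : AnalyticAt ℂ (fun p => U (πb p)) κ := hU.comp_of_eq (hπbA _) hπκ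
      set g : E × ℂ → ℂ := fun p => ∑ j ∈ Finset.range (d - 1),
        c j (πb p) * (p.2 ^ (β i - 1) * mono l y β p.1) ^ (d - j) + U (πb p) with hg
      have hgA : AnalyticAt ℂ g κ := by
        refine AnalyticAt.fun_add (Finset.analyticAt_fun_sum _ fun j _ => ?_) hU'
        exact (hc' j).fun_mul (((analyticAt_snd.fun_pow _).fun_mul (hmonoA β _)).fun_pow _)
      have hmb : ∀ (γ : ι → ℕ) (p : E × ℂ),
          mono l y γ (πb p).1 = p.2 ^ (γ i) * mono l y γ p.1 := by
        intro γ p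
        unfold mono
        rw [← Finset.mul_prod_erase _ _ (Finset.mem_univ i),
          ← Finset.mul_prod_erase Finset.univ (fun k => (l k (p.1 - y)) ^ (γ k))
            (Finset.mem_univ i), ← mul_assoc]
        have e : (πb p).1 - y = (p.1 - y) + ((p.2 - 1) * l i (p.1 - y)) • dd i := by
          simp only [hπb]; abel
        rw [e]
        congr 1
        · rw [map_add, map_smul, D.one, smul_eq_mul, mul_one, ← mul_pow]
          congr 1; ring
        · refine Finset.prod_congr rfl fun k hk => ?_
          rw [map_add, map_smul, D.zero k i (Finset.mem_erase.mp hk).1]; simp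
      refine Good.mon _ _ (D.monAt_prod y 0 κ μ (μ i + d) (u := g) hgA ?_ ?_)
      · intro h0
        have hb : ‖∑ j ∈ Finset.range (d - 1),
          c j (πb κ) * (κ.2 ^ (β i - 1) * mono l y β κ.1) ^ (d - j)‖ ≤ S * (1 / C) := by
          refine (norm_sum_le _ _).trans ?_
          rw [hS, Finset.sum_mul]
          refine Finset.sum_le_sum fun j hj => ?_
          rw [norm_mul, norm_pow, hπκ]
          have hm : ‖κ.2 ^ (β i - 1) * mono l y β κ.1‖ ≤ 1 / C := by
            rw [norm_mul]
            have h1 : ‖κ.2 ^ (β i - 1)‖ ≤ 1 := by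
              rw [norm_pow]; exact pow_le_one₀ (norm_nonneg _) (by simp [hκ])
            have h2 : ‖mono l y β κ.1‖ ≤ 1 / C := by
              unfold mono
              rw [← Finset.mul_prod_erase _ _ (Finset.mem_univ i), norm_mul, norm_prod]
              have hC' : 1 / C ≤ 1 := by rw [div_le_one hC0]; exact hC1
              have h3 : ‖l i (κ.1 - y) ^ β i‖ ≤ 1 / C := by
                rw [hκ]; simp only [hlt]
                rw [norm_pow]
                exact (pow_le_of_le_one (norm_nonneg _) (ht.trans hC') hi).trans ht
              have h4 : ∏ k ∈ Finset.univ.erase i, ‖l k (κ.1 - y) ^ β k‖ ≤ 1 := by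
                refine Finset.prod_le_one (fun _ _ => norm_nonneg _) fun k hk => ?_
                have : l k (κ.1 - y) = 0 := by
                  simp [hκ, D.zero k i (Finset.mem_erase.mp hk).1]
                rw [this, norm_pow]
                exact pow_le_one₀ (norm_nonneg _) (by simp)
              calc _ ≤ 1 / C * 1 := by gcongr
                _ = _ := mul_one _
            calc _ ≤ 1 * (1 / C) := by gcongr
              _ = _ := one_mul _
          gcongr
          have hC' : 1 / C ≤ 1 := by rw [div_le_one hC0]; exact hC1
          refine (pow_le_of_le_one (norm_nonneg _) (hm.trans hC') ?_).trans hm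
          have := Finset.mem_range.mp hj; omega
        have h1 : U (y, 0) = -∑ j ∈ Finset.range (d - 1),
          c j (πb κ) * (κ.2 ^ (β i - 1) * mono l y β κ.1) ^ (d - j) := by
          have : g κ = _ + U (πb κ) := rfl
          rw [h0, hπκ] at this
          rw [eq_neg_iff_add_eq_zero, add_comm]
          rw [hπκ]
          exact this.symm
        have h2 : ‖U (y, 0)‖ ≤ S * (1 / C) := by rw [h1, norm_neg]; exact hb
        linarith
      · filter_upwards [hcont.eventually hF] with p hp
        rw [hp, hmb, hmb, hg]
        have e2 : (πb p).2 = p.2 := rfl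
        rw [e2, sub_zero, pow_add, mul_add, mul_add, Finset.mul_sum, Finset.mul_sum]
        congr 1
        · refine Finset.sum_congr rfl fun j hj => ?_
          have hjd : d = (d - j) + j := by have := Finset.mem_range.mp hj; omega
          have hb1 : β i = (β i - 1) + 1 := by omega
          have e3 : p.2 ^ β i = p.2 ^ (β i - 1) * p.2 := by
            rw [← pow_succ, ← hb1]
          have e4 : p.2 ^ d = p.2 ^ (d - j) * p.2 ^ j := by rw [← pow_add, ← hjd]
          rw [e3, e4]
          simp only [mul_pow]
          ring
        · ring
    refine Good.cover F (y, 0) (fun b => if b then πa else πb)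
      (fun b => if b then {y} ×ˢ Metric.closedBall (0 : ℂ) C else
        (fun t : ℂ => (y + t • dd i, (0 : ℂ))) '' Metric.closedBall 0 (1 / C)) ?_ ?_ ?_ ?_ ?_
    · rintro (_ | _)
      · exact (isCompact_closedBall _ _).image (by fun_prop)
      · exact isCompact_singleton.prod (isCompact_closedBall _ _)
    · rintro (_ | _) κ _
      · exact hπbA κ
      · exact hπaA κ
    · rintro (_ | _) κ hκ
      · obtain ⟨t, -, rfl⟩ := hκ
        simp only [Bool.false_eq_true, if_false, hπb, Prod.mk.injEq, and_true]
        rw [add_assoc, ← add_smul]; simp [D.one]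
      · obtain ⟨k1, k2⟩ := κ
        obtain ⟨rfl, -⟩ := hκ
        simp [hπa]
    · rintro (_ | _) κ hκ
      · obtain ⟨t, ht, rfl⟩ := hκ
        exact GB t (by simpa using ht)
      · obtain ⟨k1, k2⟩ := κ
        obtain ⟨rfl, -⟩ := hκ
        exact GA k2
    · intro O hO
      have := chart_cover (l i) (dd i) (D.one i) y C hC0 (O true) (O false)
        (by simpa using hO true) (by simpa using hO false)
      refine Filter.mem_of_superset this ?_
      rintro s (hs | hs)
      · exact Set.mem_iUnion.mpr ⟨true, hs⟩
      · exact Set.mem_iUnion.mpr ⟨false, hs⟩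

end ZClaim
end
end

section
open Filter Topology
open Filter Topology

noncomputable section

section Tsch
variable {E : Type*} [NormedAddCommGroup E] [NormedSpace ℂ E]

lemma expand {g : E × ℂ → ℂ} {y : E} (hg : AnalyticAt ℂ g (y, 0)) (d : ℕ) :
    ∃ c : ℕ → E → ℂ, (∀ j, AnalyticAt ℂ (c j) y) ∧ ∃ U : E × ℂ → ℂ, AnalyticAt ℂ U (y, 0) ∧
      ∀ᶠ p in 𝓝 (y, (0 : ℂ)), g p =
        ∑ j ∈ Finset.range d, c j p.1 * p.2 ^ j + p.2 ^ d * U p := by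
  induction d with
  | zero => exact ⟨fun _ _ => 0, fun _ => analyticAt_const, g, hg, by simp⟩
  | succ d ih =>
    obtain ⟨c, hc, U, hU, h⟩ := ih
    obtain ⟨q, hq, h'⟩ := hadamard hU (ContinuousLinearMap.snd ℂ E ℂ) (0, 1)
    refine ⟨fun j => if j = d then fun y => U (y, 0) else c j, ?_, q, hq, ?_⟩
    · intro j
      dsimp only
      split_ifs
      · exact hU.comp_of_eq (f := fun y : E => (y, (0 : ℂ))) (analyticAt_id.prod analyticAt_const) rfl
      · exact hc j
    · filter_upwards [h, h'] with p h1 h2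
      rw [h1, h2, Finset.sum_range_succ]
      have e : p - (ContinuousLinearMap.snd ℂ E ℂ) (p - (y, 0)) • ((0 : E), (1 : ℂ)) = (p.1, 0) := by
        ext <;> simp
      rw [e]
      have e2 : ∑ x ∈ Finset.range d, (if x = d then fun y => U (y, 0) else c x) p.1 * p.2 ^ x =
          ∑ x ∈ Finset.range d, c x p.1 * p.2 ^ x := by
        refine Finset.sum_congr rfl fun x hx => ?_
        rw [if_neg (Finset.mem_range.mp hx).ne]
      rw [e2]
      simp
      ring

lemma coef_eq {d : ℕ} {c : ℕ → ℂ} {f V : ℂ → ℂ} (hV : AnalyticAt ℂ V 0)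
    (h : ∀ᶠ x in 𝓝 (0 : ℂ), f x = ∑ j ∈ Finset.range d, c j * x ^ j + x ^ d * V x) {j : ℕ}
    (hj : j < d) : iteratedDeriv j f 0 = j.factorial * c j := by
  set P : Polynomial ℂ := ∑ j ∈ Finset.range d, Polynomial.C (c j) * Polynomial.X ^ j with hP
  have hPe : ∀ x, P.eval x = ∑ j ∈ Finset.range d, c j * x ^ j := by
    intro x
    simp only [hP, Polynomial.eval_finsetSum, Polynomial.eval_mul,
      Polynomial.eval_C, Polynomial.eval_pow, Polynomial.eval_X]
  have hPA : AnalyticAt ℂ (fun x => P.eval x) 0 := by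
    simp only [hPe]
    exact Finset.analyticAt_fun_sum _ fun j _ => by fun_prop
  have hW : AnalyticAt ℂ (fun x => x ^ d * V x) 0 := (analyticAt_id.fun_pow d).fun_mul hV
  have h1 : iteratedDeriv j f 0 = iteratedDeriv j (fun x => P.eval x + x ^ d * V x) 0 := by
    apply Filter.EventuallyEq.iteratedDeriv_eq
    filter_upwards [h] with x hx
    rw [hx, hPe]
  have h2 : iteratedDeriv j (fun x => x ^ d * V x) 0 = 0 := by
    refine (natCast_le_analyticOrderAt_iff_iteratedDeriv_eq_zero hW (n := d)).mp ?_ j hj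
    rw [natCast_le_analyticOrderAt hW]
    exact ⟨V, hV, by simp⟩
  rw [h1, iteratedDeriv_fun_add hPA.contDiffAt hW.contDiffAt, h2, iteratedDeriv_polyEval,
    ← Polynomial.coeff_zero_eq_eval_zero, Polynomial.coeff_iterate_derivative, hP,
    Polynomial.finsetSum_coeff]
  simp [hj, Nat.descFactorial_self]

def dz (g : E × ℂ → ℂ) : E × ℂ → ℂ := fun p => fderiv ℂ g p (0, 1)

lemma dz_analyticAt {g : E × ℂ → ℂ} {p} (hg : AnalyticAt ℂ g p) : AnalyticAt ℂ (dz g) p :=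
  ((ContinuousLinearMap.apply ℂ ℂ ((0 : E), (1 : ℂ))).analyticAt _).comp_of_eq
    (f := fun p => fderiv ℂ g p) hg.fderiv rfl

lemma dz_eq {g : E × ℂ → ℂ} {p : E × ℂ} (hg : AnalyticAt ℂ g p) :
    dz g p = deriv (fun x => g (p.1, x)) p.2 := by
  have h := hg.differentiableAt.hasFDerivAt
  have h2 : HasDerivAt (fun x : ℂ => (p.1, x)) ((0 : E), (1 : ℂ)) p.2 :=
    (hasDerivAt_const _ _).prodMk (hasDerivAt_id _)
  have := h.comp_hasDerivAt_of_eq p.2 h2 rfl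
  exact this.deriv.symm

lemma slice_analyticAt {g : E × ℂ → ℂ} {p : E × ℂ} (hg : AnalyticAt ℂ g p) :
    AnalyticAt ℂ (fun x => g (p.1, x)) p.2 :=
  hg.comp_of_eq (f := fun x => (p.1, x)) (analyticAt_const.prod analyticAt_id) rfl

lemma dz_iterate (k : ℕ) {g : E × ℂ → ℂ} {p : E × ℂ} (hg : AnalyticAt ℂ g p) :
    AnalyticAt ℂ (dz^[k] g) p ∧ dz^[k] g p = iteratedDeriv k (fun x => g (p.1, x)) p.2 := by
  induction k generalizing g with
  | zero => simpa using hg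
  | succ k ih =>
    obtain ⟨h1, h2⟩ := ih (dz_analyticAt hg)
    refine ⟨h1, ?_⟩
    rw [Function.iterate_succ_apply, h2, iteratedDeriv_succ']
    apply Filter.EventuallyEq.iteratedDeriv_eq
    have hc : Tendsto (fun x : ℂ => (p.1, x)) (𝓝 p.2) (𝓝 p) := by
      have : Continuous (fun x : ℂ => (p.1, x)) := by fun_prop
      exact this.tendsto p.2
    filter_upwards [hc.eventually hg.eventually_analyticAt] with x hx
    exact dz_eq hx

theorem tschirn [CompleteSpace E] {g : E × ℂ → ℂ} {y : E} {ζ : ℂ} (hg : AnalyticAt ℂ g (y, ζ))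
    {d : ℕ} (hd : 1 ≤ d) (ho : analyticOrderAt (fun x => g (y, x)) ζ = d) :
    ∃ φ : E → ℂ, AnalyticAt ℂ φ y ∧ φ y = ζ ∧ ∃ c : ℕ → E → ℂ, (∀ j, AnalyticAt ℂ (c j) y) ∧
      (∀ j < d - 1, c j y = 0) ∧ ∃ U : E × ℂ → ℂ, AnalyticAt ℂ U (y, 0) ∧ U (y, 0) ≠ 0 ∧
      ∀ᶠ p in 𝓝 (y, (0 : ℂ)), g (p.1, p.2 + φ p.1) =
        ∑ j ∈ Finset.range (d - 1), c j p.1 * p.2 ^ j + p.2 ^ d * U p := by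
  have hsl := slice_analyticAt hg
  have hlow : ∀ j < d, iteratedDeriv j (fun x => g (y, x)) ζ = 0 :=
    (natCast_le_analyticOrderAt_iff_iteratedDeriv_eq_zero hsl).mp ho.ge
  have hhigh : iteratedDeriv d (fun x => g (y, x)) ζ ≠ 0 := by
    intro h0
    have : ((d + 1 : ℕ) : ℕ∞) ≤ analyticOrderAt (fun x => g (y, x)) ζ := by
      rw [natCast_le_analyticOrderAt_iff_iteratedDeriv_eq_zero hsl]
      intro i hi
      rcases Nat.lt_succ_iff_lt_or_eq.mp hi with h | rfl
      · exact hlow i h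
      · exact h0
    rw [ho] at this
    have : d + 1 ≤ d := by exact_mod_cast this
    omega
  obtain ⟨e, rfl⟩ : ∃ e, d = e + 1 := ⟨d - 1, by omega⟩
  have hee : e + 1 - 1 = e := rfl
  rw [hee]
  set G := dz^[e] g with hG
  obtain ⟨hGA, hGv⟩ := dz_iterate e hg
  have hG0 : G (y, ζ) = 0 := by rw [hG, hGv]; exact hlow e (by omega)
  have hG1 : fderiv ℂ G (y, ζ) (0, 1) ≠ 0 := by
    have := (dz_iterate (e + 1) hg).2
    rw [Function.iterate_succ_apply'] at this
    change dz G (y, ζ) ≠ 0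
    rw [hG, this]
    exact hhigh
  have cdf : ContDiffAt ℂ ⊤ G (y, ζ) := hGA.contDiffAt
  have hinv : (fderiv ℂ G (y, ζ) ∘L .inr ℂ E ℂ).IsInvertible := by
    refine ⟨ContinuousLinearEquiv.unitsEquivAut ℂ (Units.mk0 _ hG1), ?_⟩
    ext
    simp
  set φ := cdf.implicitFunction (by simp) hinv with hφ
  have hφA : AnalyticAt ℂ φ y := by
    have := cdf.contDiffAt_implicitFunction (by simp) hinv
    exact this.analyticAt
  have hφ0 : φ y = ζ := cdf.implicitFunction_apply_self (by simp) hinv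
  have hφG : ∀ᶠ x in 𝓝 y, G (x, φ x) = 0 := by
    have := cdf.eventually_apply_implicitFunction (by simp) hinv
    rwa [hG0] at this
  set g2 : E × ℂ → ℂ := fun p => g (p.1, p.2 + φ p.1) with hg2
  have hchA : AnalyticAt ℂ (fun p : E × ℂ => (p.1, p.2 + φ p.1)) (y, 0) :=
    analyticAt_fst.prod (analyticAt_snd.fun_add (comp_fst_analyticAt hφA))
  have hch0 : (fun p : E × ℂ => (p.1, p.2 + φ p.1)) (y, 0) = (y, ζ) := by simp [hφ0]
  have hg2A : AnalyticAt ℂ g2 (y, 0) := hg.comp_of_eq hchA hch0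
  obtain ⟨c, hc, V, hV, hexp⟩ := expand hg2A (e + 2)
  have key : ∀ᶠ x in 𝓝 y, ∀ j < e + 2,
      iteratedDeriv j (fun t => g (x, t)) (φ x) = j.factorial * c j x := by
    have hVev : ∀ᶠ x in 𝓝 y, AnalyticAt ℂ V (x, 0) :=
      ((by fun_prop : Continuous (fun x : E => (x, (0 : ℂ)))).tendsto y).eventually
        hV.eventually_analyticAt
    filter_upwards [hexp.curry_nhds, hVev] with x hx hVx j hj
    have h1 := coef_eq (slice_analyticAt hVx) hx hj
    rw [← h1, hg2]
    simp only [iteratedDeriv_comp_add_const j (fun t => g (x, t)) (φ x), zero_add]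
  have hy := key.self_of_nhds
  rw [hφ0] at hy
  have hcz : ∀ j ≤ e, c j y = 0 := by
    intro j hj
    have := hy j (by omega)
    rw [hlow j (by omega)] at this
    rcases mul_eq_zero.mp this.symm with h | h
    · exact absurd h (by exact_mod_cast j.factorial_ne_zero)
    · exact h
  have hcd : c (e + 1) y ≠ 0 := by
    intro h
    have := hy (e + 1) (by omega)
    rw [h, mul_zero] at this
    exact hhigh this
  have hce : ∀ᶠ x in 𝓝 y, c e x = 0 := by
    have hgev : ∀ᶠ x in 𝓝 y, AnalyticAt ℂ g (x, φ x) := by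
      have : Tendsto (fun x => (x, φ x)) (𝓝 y) (𝓝 (y, ζ)) := by
        have := (continuousAt_id.prodMk hφA.continuousAt).tendsto
        simpa [hφ0] using this
      exact this.eventually hg.eventually_analyticAt
    filter_upwards [key, hφG, hgev] with x hx hGx hgx
    have h1 := hx e (by omega)
    have h2 := (dz_iterate e hgx).2
    rw [← hG, hGx] at h2
    rw [← h2] at h1
    rcases mul_eq_zero.mp h1.symm with h | h
    · exact absurd h (by exact_mod_cast e.factorial_ne_zero)
    · exact h
  refine ⟨φ, hφA, hφ0, c, hc, fun j hj => hcz j hj.le, fun p => c (e + 1) p.1 + p.2 * V p,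
    (comp_fst_analyticAt (hc _)).fun_add (analyticAt_snd.fun_mul hV), by simpa using hcd, ?_⟩
  have hce' : ∀ᶠ p in 𝓝 (y, (0 : ℂ)), c e p.1 = 0 := ev_fst (P := fun x => c e x = 0) (p := (y, 0)) hce
  filter_upwards [hexp, hce'] with p h1 h2
  change g2 p = _
  rw [h1, Finset.sum_range_succ, Finset.sum_range_succ, h2]
  ring

end Tsch
end
end

section
open Filter Topology
open Filter Topology

noncomputable section

section Ram
variable {E : Type*} [NormedAddCommGroup E] [NormedSpace ℂ E]

def Dv (p h : E → ℂ) (y : E) : Prop := ∃ q : E → ℂ, AnalyticAt ℂ q y ∧ ∀ᶠ s in 𝓝 y, h s = p s * q s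

def ram {ι : Type} [Fintype ι] (l : ι → E →L[ℂ] ℂ) (dd : ι → E) (y : E) (q : ℕ) (s : E) : E :=
  s + ∑ i, (l i (s - y) ^ q - l i (s - y)) • dd i

variable {ι : Type} [Fintype ι] {l : ι → E →L[ℂ] ℂ} {dd : ι → E}

lemma ram_analyticAt (l : ι → E →L[ℂ] ℂ) (dd : ι → E) (y : E) (q : ℕ) (s : E) :
    AnalyticAt ℂ (ram l dd y q) s := by
  unfold ram
  refine analyticAt_id.fun_add (Finset.analyticAt_fun_sum _ fun i _ => ?_)
  have hW : AnalyticAt ℂ (fun s => l i (s - y)) s :=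
      ((l i).analyticAt _).comp_of_eq (f := fun s => s - y) (by fun_prop) rfl
  exact ((hW.fun_pow q).fun_sub hW).fun_smul analyticAt_const

lemma DualSys.apply_sum (D : DualSys l dd) (w : ι → ℂ) (i : ι) : l i (∑ j, w j • dd j) = w i := by
  classical
  rw [map_sum, Finset.sum_eq_single i]
  · simp [D.one]
  · intro j _ hj
    simp [D.zero i j hj.symm]
  · simp

lemma ram_self (y : E) {q : ℕ} (hq : q ≠ 0) : ram l dd y q y = y := by
  simp [ram, hq]

lemma ram_apply (D : DualSys l dd) (y : E) (q : ℕ) (s : E) (i : ι) :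
    l i (ram l dd y q s - y) = l i (s - y) ^ q := by
  have : ram l dd y q s - y = (s - y) + ∑ i, (l i (s - y) ^ q - l i (s - y)) • dd i := by
    unfold ram; abel
  rw [this, map_add, D.apply_sum]; ring

lemma mono_ram (D : DualSys l dd) (y : E) (q : ℕ) (a : ι → ℕ) (s : E) :
    mono l y a (ram l dd y q s) = mono l y (q • a) s := by
  unfold mono
  refine Finset.prod_congr rfl fun i _ => ?_
  rw [ram_apply D, ← pow_mul]; rfl

lemma root_tendsto {q : ℕ} (hq : q ≠ 0) :
    Tendsto (fun x : ℂ => x ^ ((q : ℂ)⁻¹)) (𝓝 0) (𝓝 0) := by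
  rw [tendsto_zero_iff_norm_tendsto_zero]
  simp only [Complex.norm_cpow_inv_nat]
  have h1 : Tendsto (fun x : ℝ => x ^ ((q : ℝ)⁻¹)) (𝓝 0) (𝓝 0) := by
    have := (Real.continuousAt_rpow_const (0 : ℝ) ((q : ℝ)⁻¹) (Or.inr (by positivity))).tendsto
    rwa [Real.zero_rpow (by positivity)] at this
  exact h1.comp tendsto_norm_zero

lemma ram_cover (D : DualSys l dd) (y : E) {q : ℕ} (hq : q ≠ 0) :
    ∃ sg : E → E, Tendsto sg (𝓝 y) (𝓝 y) ∧ ∀ s, ram l dd y q (sg s) = s := by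
  refine ⟨fun s => s + ∑ i, ((l i (s - y)) ^ ((q : ℂ)⁻¹) - l i (s - y)) • dd i, ?_, ?_⟩
  · have h1 : ∀ i, Tendsto (fun s => l i (s - y)) (𝓝 y) (𝓝 0) := by
      intro i
      have : Continuous (fun s => l i (s - y)) := by fun_prop
      simpa using this.tendsto y
    have h2 : Tendsto (fun s => s + ∑ i, ((l i (s - y)) ^ ((q : ℂ)⁻¹) - l i (s - y)) • dd i)
        (𝓝 y) (𝓝 (y + ∑ i, ((0 : ℂ) - 0) • dd i)) := by
      refine tendsto_id.add (tendsto_finsetSum _ fun i _ => ?_)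
      exact ((((root_tendsto hq).comp (h1 i)).sub (h1 i))).smul tendsto_const_nhds
    simpa using h2
  · intro s
    have hl : ∀ i, l i ((s + ∑ i, ((l i (s - y)) ^ ((q : ℂ)⁻¹) - l i (s - y)) • dd i) - y) =
        (l i (s - y)) ^ ((q : ℂ)⁻¹) := by
      intro i
      have : (s + ∑ i, ((l i (s - y)) ^ ((q : ℂ)⁻¹) - l i (s - y)) • dd i) - y =
        (s - y) + ∑ i, ((l i (s - y)) ^ ((q : ℂ)⁻¹) - l i (s - y)) • dd i := by abel
      rw [this, map_add, D.apply_sum]; ring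
    unfold ram
    simp only [hl, Complex.cpow_nat_inv_pow _ hq]
    rw [add_assoc, ← Finset.sum_add_distrib]
    simp only [← add_smul]
    simp

def expo (d j : ℕ) : ℕ := d.factorial / (d - j)

lemma expo_mul {d j : ℕ} (hj : j < d) : (d - j) * expo d j = d.factorial :=
  Nat.mul_div_cancel' (Nat.dvd_factorial (by omega) (by omega))

lemma expo_pos {d j : ℕ} (hj : j < d) : expo d j ≠ 0 := by
  intro h
  have := expo_mul hj
  rw [h, mul_zero] at this
  exact d.factorial_ne_zero this.symm

def RelS (d : ℕ) (h : E → ℂ) (y : E) (F : E × ℂ → ℂ) : Prop :=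
  ∃ (m : E → ℂ) (c : ℕ → E → ℂ) (U : E × ℂ → ℂ), AnalyticAt ℂ m y ∧ (∀ j, AnalyticAt ℂ (c j) y) ∧
    AnalyticAt ℂ U (y, 0) ∧ U (y, 0) ≠ 0 ∧
    (∀ᶠ p in 𝓝 (y, (0 : ℂ)), F p = m p.1 *
      (∑ j ∈ Finset.range (d - 1), c j p.1 * p.2 ^ j + p.2 ^ d * U p)) ∧
    Dv m h y ∧ (∀ j < d - 1, c j y = 0) ∧
    (∀ j < d - 1, (∀ᶠ s in 𝓝 y, c j s = 0) ∨ Dv (c j) h y) ∧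
    ∀ i < d - 1, ∀ j < d - 1, (∀ᶠ s in 𝓝 y, c i s ^ expo d i - c j s ^ expo d j = 0) ∨
      Dv (fun s => c i s ^ expo d i - c j s ^ expo d j) h y

lemma Dv.pull {p h : E → ℂ} {π : E → E} {κ : E} (hπ : AnalyticAt ℂ π κ) (H : Dv p h (π κ)) :
    Dv (fun s => p (π s)) (fun s => h (π s)) κ := by
  obtain ⟨q, hq, hh⟩ := H
  exact ⟨fun s => q (π s), hq.comp_of_eq hπ rfl, hπ.continuousAt.eventually hh⟩

lemma RelS.pull {d : ℕ} {h : E → ℂ} {F : E × ℂ → ℂ} {π : E → E} {κ : E} (hπ : AnalyticAt ℂ π κ)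
    (H : RelS d h (π κ) F) : RelS d (fun s => h (π s)) κ (fun p => F (π p.1, p.2)) := by
  obtain ⟨m, c, U, hm, hc, hU, hU0, hF, hmh, hc0, hch, hdh⟩ := H
  have ha : AnalyticAt ℂ (fun p : E × ℂ => (π p.1, p.2)) (κ, 0) :=
      (hπ.comp_of_eq (f := Prod.fst) analyticAt_fst rfl).prod analyticAt_snd
  refine ⟨fun s => m (π s), fun j s => c j (π s), fun p => U (π p.1, p.2), hm.comp_of_eq hπ rfl,
    fun j => (hc j).comp_of_eq hπ rfl, hU.comp_of_eq ha rfl, hU0,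
    ha.continuousAt.eventually hF, hmh.pull hπ, hc0, fun j hj => ?_, fun i hi j hj => ?_⟩
  · exact (hch j hj).imp (fun h => hπ.continuousAt.eventually h) (fun h => h.pull hπ)
  · exact (hdh i hi j hj).imp (fun h => hπ.continuousAt.eventually h) (fun h => h.pull hπ)

theorem RelS.mon {d : ℕ} (hd : 1 ≤ d) (IH : ∀ d' < d, StepP E d') {h : E → ℂ} {y : E}
    {F : E × ℂ → ℂ} (hM : MonAt h y) (H : RelS d h y F) : Good F (y, 0) := by
  classical
  obtain ⟨ι, hι, l, dd, a, u, D, hu, hu0, hh⟩ := hM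
  obtain ⟨m, c, U, hm, hc, hU, hU0, hF, hmh, hc0, hch, hdh⟩ := H
  have fac : ∀ p : E → ℂ, AnalyticAt ℂ p y → Dv p h y → ∃ (b : ι → ℕ) (v : E → ℂ),
      AnalyticAt ℂ v y ∧ v y ≠ 0 ∧ ∀ᶠ s in 𝓝 y, p s = mono l y b s * v s := by
    rintro p hp ⟨q, hq, hpq⟩
    refine D.factor _ a rfl p q u hp hq hu hu0 ?_
    filter_upwards [hpq, hh] with s h1 h2
    rw [← h1, h2]
  obtain ⟨b, v, hv, hv0, hmv⟩ := fac m hm hmh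
  set J := (Finset.range (d - 1)).filter (fun j => ¬ ∀ᶠ s in 𝓝 y, c j s = 0) with hJ
  have memJ : ∀ j, j ∈ J ↔ j < d - 1 ∧ ¬ ∀ᶠ s in 𝓝 y, c j s = 0 := by
    intro j; rw [hJ, Finset.mem_filter, Finset.mem_range]
  have hz : ∀ j < d - 1, j ∉ J → ∀ᶠ s in 𝓝 y, c j s = 0 := by
    intro j hj hjJ
    by_contra hcon
    exact hjJ ((memJ j).mpr ⟨hj, hcon⟩)
  have hfc : ∀ j, ∃ (γ : ι → ℕ) (w : E → ℂ), j ∈ J → AnalyticAt ℂ w y ∧ w y ≠ 0 ∧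
      ∀ᶠ s in 𝓝 y, c j s = mono l y γ s * w s := by
    intro j
    by_cases hj : j ∈ J
    · obtain ⟨γ, w, h⟩ := fac (c j) (hc j) ((hch j ((memJ j).mp hj).1).resolve_left
        ((memJ j).mp hj).2)
      exact ⟨γ, w, fun _ => h⟩
    · exact ⟨0, 0, fun h => absurd h hj⟩
  choose γ w hγ using hfc
  by_cases hJe : J = ∅
  · refine Good.mon _ _ (D.monAt_prod y 0 (y, 0) b d (u := fun p => v p.1 * U p)
      ((comp_fst_analyticAt hv).fun_mul hU) (mul_ne_zero hv0 hU0) ?_)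
    have hall : ∀ᶠ s in 𝓝 y, ∀ j ∈ Finset.range (d - 1), c j s = 0 := by
      rw [Filter.eventually_all_finset]
      intro j hj
      exact hz j (Finset.mem_range.mp hj) (by simp [hJe])
    have hall' := ev_fst (p := (y, (0 : ℂ))) hall
    have hmv' := ev_fst (p := (y, (0 : ℂ))) hmv
    filter_upwards [hF, hall', hmv'] with p h1 h2 h3
    rw [h1, h3, Finset.sum_eq_zero (fun j hj => by rw [h2 j hj, zero_mul])]
    rw [sub_zero]; ring
  · obtain ⟨j₀, hj₀, hmin⟩ : ∃ j₀ ∈ J, ∀ j ∈ J, expo d j₀ • γ j₀ ≤ expo d j • γ j := by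
      obtain ⟨j₀, hj₀, hmin⟩ := Finset.exists_minimalFor (fun j => expo d j • γ j) J
        (Finset.nonempty_iff_ne_empty.mpr hJe)
      refine ⟨j₀, hj₀, fun j hj => ?_⟩
      have hjd := ((memJ j).mp hj).1
      have hj₀d := ((memJ j₀).mp hj₀).1
      obtain ⟨w1, w2, w3⟩ := hγ j hj
      obtain ⟨v1, v2, v3⟩ := hγ j₀ hj₀
      have hev : ∀ᶠ s in 𝓝 y, c j₀ s ^ expo d j₀ - c j s ^ expo d j =
          mono l y (expo d j₀ • γ j₀) s * w j₀ s ^ expo d j₀ -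
          mono l y (expo d j • γ j) s * w j s ^ expo d j := by
        filter_upwards [w3, v3] with s h1 h2
        rw [h1, h2, mono_nsmul, mono_nsmul, mul_pow, mul_pow]
      have := D.ord (a := expo d j₀ • γ j₀) (b := expo d j • γ j) (v1.fun_pow (expo d j₀))
        (w1.fun_pow (expo d j)) (pow_ne_zero _ v2) (pow_ne_zero _ w2) (by
          rcases hdh j₀ hj₀d j hjd with h | h
          · left
            filter_upwards [h, hev] with s h1 h2
            rw [← h2, h1]
          · right
            obtain ⟨c', w', hw', hw0', he⟩ := fac _ (((hc j₀).fun_pow _).fun_sub ((hc j).fun_pow _)) h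
            refine ⟨c', w', hw', hw0', ?_⟩
            filter_upwards [he, hev] with s h1 h2
            rw [← h2, h1])
      rcases this with h | h
      · exact h
      · exact hmin hj h
    have hj₀d := ((memJ j₀).mp hj₀).1
    set β := expo d j₀ • γ j₀ with hβ
    have hβ0 : β ≠ 0 := by
      intro h
      have h1 : γ j₀ = 0 := by
        funext i
        have := congrFun h i
        simp only [hβ, Pi.smul_apply, smul_eq_mul, Pi.zero_apply] at this
        exact (mul_eq_zero.mp this).resolve_left (expo_pos (by omega))
      obtain ⟨v1, v2, v3⟩ := hγ j₀ hj₀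
      have := v3.self_of_nhds
      rw [hc0 j₀ hj₀d, h1, mono_zero, one_mul] at this
      exact v2 this.symm
    set q := d.factorial with hq
    have hq0 : q ≠ 0 := d.factorial_ne_zero
    set ρ := ram l dd y q with hρ
    have hρA : AnalyticAt ℂ ρ y := ram_analyticAt _ _ _ _ _
    have hρy : ρ y = y := ram_self y hq0
    have hρT : Tendsto ρ (𝓝 y) (𝓝 y) := by
      have := hρA.continuousAt.tendsto; rwa [hρy] at this
    have hπA : AnalyticAt ℂ (fun p : E × ℂ => (ρ p.1, p.2)) (y, 0) :=
      (hρA.comp_of_eq (f := Prod.fst) analyticAt_fst rfl).prod analyticAt_snd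
    have hπT : Tendsto (fun p : E × ℂ => (ρ p.1, p.2)) (𝓝 (y, 0)) (𝓝 (y, 0)) := by
      have := hπA.continuousAt.tendsto; rwa [hρy] at this
    refine Good.single (fun p : E × ℂ => (ρ p.1, p.2)) (y, 0) hπA (by simp [hρy]) ?_ ?_
    · have hvρ : AnalyticAt ℂ (fun s => v (ρ s)) y := hv.comp_of_eq hρA hρy
      refine zclaim IH D y _ β rfl hβ0 (q • b)
        (fun j p => if j ∈ J then v (ρ p.1) * (mono l y ((d - j) • (expo d j • γ j - β)) p.1 *
          w j (ρ p.1)) else 0) (fun p => v (ρ p.1) * U (ρ p.1, p.2)) _ ?_ ?_ ?_ ?_ ?_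
      · intro j
        by_cases hj : j ∈ J
        · simp only [hj, if_true]
          have : AnalyticAt ℂ (fun s => v (ρ s) * (mono l y ((d - j) • (expo d j • γ j - β)) s *
              w j (ρ s))) y :=
            hvρ.fun_mul ((mono_analyticAt _ _ _ _).fun_mul ((hγ j hj).1.comp_of_eq hρA hρy))
          exact comp_fst_analyticAt (p := (y, 0)) this
        · simp only [hj, if_false]; exact analyticAt_const
      · exact (comp_fst_analyticAt (p := (y, 0)) hvρ).fun_mul (hU.comp_of_eq hπA (by simp [hρy]))
      · simp only [hρy]; exact mul_ne_zero hv0 hU0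
      · refine ⟨j₀, hj₀d, ?_⟩
        simp only [hj₀, if_true, hρy, ← hβ, tsub_self, smul_zero, mono_zero, one_mul]
        exact mul_ne_zero hv0 (hγ j₀ hj₀).2.1
      · have hall : ∀ᶠ s in 𝓝 y, ∀ j ∈ Finset.range (d - 1), c j s =
            if j ∈ J then mono l y (γ j) s * w j s else 0 := by
          rw [Filter.eventually_all_finset]
          intro j hj
          by_cases hjJ : j ∈ J
          · simp only [hjJ, if_true]; exact (hγ j hjJ).2.2
          · simp only [hjJ, if_false]; exact hz j (Finset.mem_range.mp hj) hjJ
        have hall' := ev_fst (p := (y, (0 : ℂ))) (hρT.eventually hall)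
        have hmv' := ev_fst (p := (y, (0 : ℂ))) (hρT.eventually hmv)
        filter_upwards [hπT.eventually hF, hall', hmv'] with p h1 h2 h3
        rw [h1]
        rw [h3, mono_ram D, mul_assoc]
        congr 1
        rw [mul_add, Finset.mul_sum]
        congr 1
        · refine Finset.sum_congr rfl fun j hj => ?_
          rw [h2 j hj]
          by_cases hjJ : j ∈ J
          · have hjd : j < d := by have := Finset.mem_range.mp hj; omega
            simp only [hjJ, if_true]
            rw [mono_ram D, ← mono_nsmul]
            have e : q • γ j = (d - j) • (expo d j • γ j - β) + (d - j) • β := by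
              rw [← smul_add, tsub_add_cancel_of_le (hmin j hjJ), smul_smul, expo_mul hjd]
            rw [e, mono_add]
            ring
          · simp only [hjJ, if_false]; ring
        · ring
    · intro O hO
      obtain ⟨sg, hsg, hsgρ⟩ := ram_cover D y hq0
      have hT : Tendsto (fun p : E × ℂ => (sg p.1, p.2)) (𝓝 (y, 0)) (𝓝 (y, 0)) := by
        rw [nhds_prod_eq]
        exact (hsg.comp tendsto_fst).prodMk tendsto_snd
      filter_upwards [hT hO] with p hp
      exact ⟨_, hp, by simp [hρ, hsgρ]⟩

end Ram
end
end

section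
open Filter Topology
open Filter Topology

noncomputable section

section Unif
variable {E : Type*} [NormedAddCommGroup E] [NormedSpace ℂ E]

variable (E) in
def Unif : Prop := ∀ (h : E → ℂ) (y : E), AnalyticAt ℂ h y → (¬ ∀ᶠ s in 𝓝 y, h s = 0) → Good h y

/-- analytic and not eventually zero -/
def NZ (h : E → ℂ) (y : E) : Prop := AnalyticAt ℂ h y ∧ ¬ ∀ᶠ s in 𝓝 y, h s = 0

lemma NZ.mul {p q : E → ℂ} {y : E} (hp : NZ p y) (hq : NZ q y) : NZ (fun s => p s * q s) y :=
  ⟨hp.1.fun_mul hq.1, fun h => (germ_domain hp.1 hq.1 h).elim hp.2 hq.2⟩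

lemma NZ.one {y : E} : NZ (fun _ : E => (1 : ℂ)) y := ⟨analyticAt_const, fun h => one_ne_zero h.self_of_nhds⟩

lemma exists_common {y : E} {α : Type*} (S : Finset α) (p : α → E → ℂ)
    (hp : ∀ i ∈ S, NZ (p i) y) : ∃ h, NZ h y ∧ ∀ i ∈ S, Dv (p i) h y := by
  classical
  induction S using Finset.induction_on with
  | empty => exact ⟨_, NZ.one, by simp⟩
  | insert a S ha ih =>
    obtain ⟨h, hh, H⟩ := ih (fun i hi => hp i (Finset.mem_insert_of_mem hi))
    have hpa := hp a (Finset.mem_insert_self a S)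
    refine ⟨fun s => p a s * h s, hpa.mul hh, fun i hi => ?_⟩
    rcases Finset.mem_insert.mp hi with rfl | hi
    · exact ⟨h, hh.1, by simp⟩
    · obtain ⟨q, hq, hq'⟩ := H i hi
      refine ⟨fun s => p a s * q s, hpa.1.fun_mul hq, ?_⟩
      filter_upwards [hq'] with s hs
      rw [hs]; ring

theorem stepP [CompleteSpace E] (hE : Unif E) : ∀ d, StepP E d := by
  classical
  intro d
  induction d using Nat.strong_induction_on with
  | _ d IH =>
    intro y ζ m g hm hm0 hg ho
    rcases Nat.eq_zero_or_pos d with rfl | hd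
    · refine (hE m y hm hm0).mul_unit hg ?_ (by simp)
      intro h0
      have h1 := slice_analyticAt hg
      have : analyticOrderAt (fun x => g (y, x)) ζ ≠ 0 := h1.analyticOrderAt_ne_zero.mpr h0
      exact this (by simpa using ho)
    · obtain ⟨φ, hφ, hφ0, c, hc, hc0, U, hU, hU0, hexp⟩ := tschirn hg hd ho
      have hchA : AnalyticAt ℂ (fun p : E × ℂ => (p.1, p.2 + φ p.1)) (y, 0) :=
        analyticAt_fst.prod (analyticAt_snd.fun_add (comp_fst_analyticAt hφ))
      have hch0 : (fun p : E × ℂ => (p.1, p.2 + φ p.1)) (y, 0) = (y, ζ) := by simp [hφ0]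
      refine Good.single (fun p : E × ℂ => (p.1, p.2 + φ p.1)) (y, 0) hchA hch0 ?_ ?_
      · -- family of functions
        let fam : Unit ⊕ (ℕ ⊕ ℕ × ℕ) → E → ℂ
          | .inl _ => m
          | .inr (.inl j) => c j
          | .inr (.inr ij) => fun s => c ij.1 s ^ expo d ij.1 - c ij.2 s ^ expo d ij.2
        have famA : ∀ i, AnalyticAt ℂ (fam i) y := by
          rintro (_ | j | ⟨i, j⟩)
          · exact hm
          · exact hc j
          · exact ((hc i).fun_pow _).fun_sub ((hc j).fun_pow _)
        let S : Finset (Unit ⊕ (ℕ ⊕ ℕ × ℕ)) :=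
          (Finset.univ.disjSum ((Finset.range (d - 1)).disjSum
            (Finset.range (d - 1) ×ˢ Finset.range (d - 1)))).filter
              (fun i => ¬ ∀ᶠ s in 𝓝 y, fam i s = 0)
        obtain ⟨h, hh, H⟩ := exists_common S fam (fun i hi =>
          ⟨famA i, (Finset.mem_filter.mp hi).2⟩)
        have H' : ∀ i ∈ (Finset.univ.disjSum ((Finset.range (d - 1)).disjSum
            (Finset.range (d - 1) ×ˢ Finset.range (d - 1)))),
            (∀ᶠ s in 𝓝 y, fam i s = 0) ∨ Dv (fam i) h y := by
          intro i hi
          by_cases h0 : ∀ᶠ s in 𝓝 y, fam i s = 0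
          · exact Or.inl h0
          · exact Or.inr (H i (Finset.mem_filter.mpr ⟨hi, h0⟩))
        refine Good.lift (RelS d) 0 ?_ ?_ (hE h y hh.1 hh.2) ?_
        · rintro h y F π κ hπ rfl H
          exact H.pull hπ
        · intro h y F hM H
          exact H.mon hd IH hM
        · refine ⟨m, c, U, hm, hc, hU, hU0, ?_, ?_, hc0, ?_, ?_⟩
          · filter_upwards [hexp] with p hp
            rw [← hp]
          · exact (H' (.inl ()) (by simp)).resolve_left hm0
          · intro j hj
            exact H' (.inr (.inl j)) (by simpa using hj)
          · intro i hi j hj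
            exact H' (.inr (.inr (i, j))) (by simpa using ⟨hi, hj⟩)
      · intro O hO
        have hT : Tendsto (fun p : E × ℂ => (p.1, p.2 - φ p.1)) (𝓝 (y, ζ)) (𝓝 (y, 0)) := by
          have hA : AnalyticAt ℂ (fun p : E × ℂ => (p.1, p.2 - φ p.1)) (y, ζ) :=
            analyticAt_fst.prod (analyticAt_snd.fun_sub (comp_fst_analyticAt hφ))
          have := hA.continuousAt.tendsto
          simpa [hφ0] using this
        filter_upwards [hT hO] with p hp
        exact ⟨_, hp, by simp⟩

theorem Unif.prod [CompleteSpace E] (hE : Unif E) : Unif (E × ℂ) := by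
  intro f z hf hf0
  obtain ⟨r, hr, hfr⟩ := hf.exists_ball_analyticOnNhd
  -- a point with f ≠ 0 and second coordinate different
  obtain ⟨s, hsr, hs0, hs2⟩ : ∃ s ∈ Metric.ball z r, f s ≠ 0 ∧ s.2 ≠ z.2 := by
    rw [Filter.not_eventually] at hf0
    obtain ⟨s, h1, h2⟩ := (hf0.and_eventually (Metric.ball_mem_nhds z hr)).exists
    have hfs : ∀ᶠ s' in 𝓝 s, f s' ≠ 0 := (hfr s h2).continuousAt.eventually_ne h1
    have hb : ∀ᶠ s' in 𝓝 s, s' ∈ Metric.ball z r := Metric.isOpen_ball.mem_nhds h2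
    have hT : Tendsto (fun t : ℂ => (s.1, t)) (𝓝[≠] s.2) (𝓝 s) :=
      ((by fun_prop : Continuous (fun t : ℂ => (s.1, t))).tendsto s.2).mono_left nhdsWithin_le_nhds
    have hne : ∀ᶠ t in 𝓝[≠] s.2, t ≠ z.2 := by
      by_cases h : s.2 = z.2
      · rw [← h]; exact self_mem_nhdsWithin
      · exact nhdsWithin_le_nhds (isOpen_ne.mem_nhds h)
    obtain ⟨t, ⟨h3, h4⟩, h5⟩ := ((hT.eventually (hfs.and hb)).and hne).exists
    exact ⟨(s.1, t), h4, h3, h5⟩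
  set w := s - z with hw
  have hw2 : w.2 ≠ 0 := by rw [hw]; exact sub_ne_zero.mpr hs2
  set π : E × ℂ → E × ℂ := fun p => (z.1 + p.1 + p.2 • w.1, z.2 + p.2 * w.2) with hπ
  have hπA : AnalyticAt ℂ π (0, 0) :=
    ((analyticAt_const.fun_add analyticAt_fst).fun_add
      (analyticAt_snd.fun_smul analyticAt_const)).prod
      (analyticAt_const.fun_add (analyticAt_snd.fun_mul analyticAt_const))
  have hπ0 : π (0, 0) = z := by simp [hπ]
  refine Good.single π (0, 0) hπA hπ0 ?_ ?_
  · have hg : AnalyticAt ℂ (fun p => f (π p)) (0, 0) := hf.comp_of_eq hπA hπ0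
    have hord : analyticOrderAt (fun x => f (π (0, x))) 0 ≠ ⊤ := by
      intro htop
      rw [analyticOrderAt_eq_top] at htop
      -- line from z to s
      have hline : ∀ x : ℂ, π (0, x) = z + x • w := by
        intro x; ext <;> simp [hπ]
      set T : Set ℂ := (fun x : ℂ => z + x • w) ⁻¹' Metric.ball z r with hTdef
      have hTA : AnalyticOnNhd ℂ (fun x => f (z + x • w)) T := by
        intro x hx
        exact (hfr _ hx).comp_of_eq (f := fun x : ℂ => z + x • w)
          (analyticAt_const.fun_add (analyticAt_id.fun_smul analyticAt_const)) rfl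
      have hTc : Convex ℝ T := by
        intro x hx x' hx' α β hα hβ hαβ
        have hx1 : z + x • w ∈ Metric.ball z r := hx
        have hx2 : z + x' • w ∈ Metric.ball z r := hx'
        have := convex_ball z r hx1 hx2 hα hβ hαβ
        change z + (α • x + β • x') • w ∈ Metric.ball z r
        convert this using 1
        rw [smul_add, smul_add, add_smul, smul_assoc, smul_assoc]
        have : z = α • z + β • z := by rw [← add_smul, hαβ, one_smul]
        nth_rewrite 1 [this]
        abel
      have h0T : (0 : ℂ) ∈ T := by simp [hTdef, hr]
      have h1T : (1 : ℂ) ∈ T := by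
        simp only [hTdef, Set.mem_preimage, one_smul, hw]
        simpa using hsr
      have := hTA.eqOn_zero_of_preconnected_of_eventuallyEq_zero hTc.isPreconnected h0T (by
        filter_upwards [htop] with x hx
        rw [hline] at hx
        exact hx) h1T
      simp [hw] at this
      exact hs0 this
    obtain ⟨d, hd⟩ := ENat.ne_top_iff_exists.mp hord
    have := stepP hE d 0 0 (fun _ => 1) (fun p => f (π p)) analyticAt_const
      (fun h => one_ne_zero h.self_of_nhds) hg hd.symm
    simpa using this
  · intro O hO
    have hT : Tendsto (fun p : E × ℂ => (p.1 - z.1 - ((p.2 - z.2) / w.2) • w.1, (p.2 - z.2) / w.2))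
        (𝓝 z) (𝓝 (0, 0)) := by
      have hc : Continuous (fun p : E × ℂ =>
        (p.1 - z.1 - ((p.2 - z.2) / w.2) • w.1, (p.2 - z.2) / w.2)) := by fun_prop
      have := hc.tendsto z
      simpa using this
    filter_upwards [hT hO] with p hp
    refine ⟨_, hp, ?_⟩
    ext
    · simp only [hπ]; abel
    · simp [hπ, hw2]

lemma Unif.of_subsingleton [Subsingleton E] : Unif E := by
  intro h y hh h0
  refine Good.mon _ _ ⟨Empty, inferInstance, fun e => e.elim, fun e => e.elim, fun e => e.elim, h,
    ⟨fun e => e.elim, fun e => e.elim⟩, hh, ?_, by simp [mono]⟩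
  intro h1
  apply h0
  filter_upwards with s
  rw [Subsingleton.elim s y, h1]

end Unif

theorem exists_unif (M : ℕ) : ∃ (E : Type) (_ : NormedAddCommGroup E) (_ : NormedSpace ℂ E)
    (_ : FiniteDimensional ℂ E), Module.finrank ℂ E = M ∧ Unif E := by
  induction M with
  | zero => exact ⟨PUnit, inferInstance, inferInstance, inferInstance,
      Module.finrank_zero_of_subsingleton, Unif.of_subsingleton⟩
  | succ M ih =>
    obtain ⟨E, i1, i2, i3, h1, h2⟩ := ih
    have : CompleteSpace E := FiniteDimensional.complete ℂ E
    exact ⟨E × ℂ, inferInstance, inferInstance, inferInstance, by simp [h1], h2.prod⟩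

/-- Łojasiewicz gradient inequality for holomorphic functions. -/
theorem lojasiewicz {V : Type*} [NormedAddCommGroup V] [NormedSpace ℂ V] [FiniteDimensional ℂ V]
    {f : V → ℂ} {z : V} (hf : AnalyticAt ℂ f z) (hf0 : f z = 0) : ∃ S ∈ 𝓝 z, LojSet f S := by
  by_cases hev : ∀ᶠ s in 𝓝 z, f s = 0
  · refine ⟨_, hev, 1 / 2, by norm_num, by norm_num, 1, one_pos, ?_⟩
    intro s hs _
    have hs' : f s = 0 := hs
    rw [hs', norm_zero, Real.zero_rpow (by norm_num)]
    positivity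
  obtain ⟨E, i1, i2, i3, h1, h2⟩ := exists_unif (Module.finrank ℂ V)
  have : CompleteSpace E := FiniteDimensional.complete ℂ E
  let e : E ≃L[ℂ] V := ContinuousLinearEquiv.ofFinrankEq h1
  set g : E → ℂ := fun x => f (e x) with hg
  have hgA : AnalyticAt ℂ g (e.symm z) :=
    hf.comp_of_eq (f := fun x => e x) ((e : E →L[ℂ] V).analyticAt _) (by simp)
  have hgev : ¬ ∀ᶠ x in 𝓝 (e.symm z), g x = 0 := by
    intro h
    apply hev
    have := (e.symm.continuous.tendsto z).eventually h
    filter_upwards [this] with s hs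
    simpa [hg] using hs
  obtain ⟨S, hS, θ, hθ0, hθ1, C, hC, H⟩ := (h2 g _ hgA hgev).loj hgA (by simp [hg, hf0])
  refine ⟨e.symm ⁻¹' S ∩ {s | DifferentiableAt ℂ f s}, ?_, θ, hθ0, hθ1,
    C * (‖(e : E →L[ℂ] V)‖ + 1), by positivity, ?_⟩
  · refine Filter.inter_mem (e.symm.continuous.tendsto z hS) ?_
    filter_upwards [hf.eventually_analyticAt] with s hs using hs.differentiableAt
  · rintro s ⟨hs, hd⟩ hle
    have h1 := H (e.symm s) hs (by simpa [hg] using hle)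
    have h3 : fderiv ℂ g (e.symm s) = (fderiv ℂ f s).comp (e : E →L[ℂ] V) := by
      have hd' : HasFDerivAt f (fderiv ℂ f s) (e (e.symm s)) := by simpa using hd.hasFDerivAt
      exact (hd'.comp (e.symm s) e.hasFDerivAt).fderiv
    simp only [hg, ContinuousLinearEquiv.apply_symm_apply] at h1
    refine h1.trans ?_
    rw [mul_assoc]
    gcongr
    change ‖fderiv ℂ g (e.symm s)‖ ≤ _
    rw [h3]
    refine (ContinuousLinearMap.opNorm_comp_le _ _).trans ?_
    rw [mul_comm]
    gcongr
    linarith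
end
end

section
open Filter Topology
open Filter Topology

noncomputable section

section Metric
variable {X : Type*} [MetricSpace X] [CompleteSpace X]

/-- The limit of the iteration. -/
def limIter (T : X → X) (z : X) : X :=
  @limUnder _ _ _ ⟨z⟩ atTop (fun n : ℕ => T^[n] z)

theorem descent {T : X → X} {ψ : X → ℝ} {z₁ : X} {r : ℝ} (hr : 0 < r) (hψ : ∀ z, 0 ≤ ψ z)
    (hψ1 : ψ z₁ = 0) (hT : ∀ z ∈ Metric.ball z₁ r, ContinuousAt T z)
    (hψc : ∀ z ∈ Metric.ball z₁ r, ContinuousAt ψ z)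
    (hd : ∀ z ∈ Metric.ball z₁ r, dist z (T z) ≤ ψ z - ψ (T z))
    (hfix : ∀ z ∈ Metric.ball z₁ r, T z = z → ψ z = 0) :
    ∃ δ > 0, ∀ z ∈ Metric.ball z₁ δ, ContinuousAt (limIter T) z ∧ ψ (limIter T z) = 0 ∧
      limIter T z ∈ Metric.ball z₁ r := by
  have h0 : ∀ᶠ z in 𝓝 z₁, z ∈ Metric.ball z₁ (r / 2) ∧ ψ z < r / 4 := by
    refine Filter.Eventually.and (Metric.ball_mem_nhds _ (by positivity)) ?_
    have := (hψc z₁ (Metric.mem_ball_self hr)).tendsto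
    rw [hψ1] at this
    exact this.eventually (gt_mem_nhds (by positivity))
  -- orbits
  have orb : ∀ z, z ∈ Metric.ball z₁ (r / 2) → ψ z < r / 4 → ∀ n,
      T^[n] z ∈ Metric.ball z₁ (3 / 4 * r) ∧ dist z (T^[n] z) ≤ ψ z - ψ (T^[n] z) := by
    intro z hz hz' n
    induction n with
    | zero =>
      refine ⟨Metric.ball_subset_ball (by linarith) hz, by simp⟩
    | succ n ih =>
      rw [Function.iterate_succ_apply']
      have h1 := hd _ (Metric.ball_subset_ball (by linarith) ih.1)
      have h2 : dist z (T (T^[n] z)) ≤ ψ z - ψ (T (T^[n] z)) := by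
        have := dist_triangle z (T^[n] z) (T (T^[n] z))
        linarith [ih.2]
      refine ⟨?_, h2⟩
      rw [Metric.mem_ball] at hz ⊢
      have h3 := dist_triangle (T (T^[n] z)) z z₁
      rw [dist_comm _ z] at h3
      linarith [hψ (T (T^[n] z))]
  have orb2 : ∀ z, z ∈ Metric.ball z₁ (r / 2) → ψ z < r / 4 → ∀ n k,
      dist (T^[n] z) (T^[n + k] z) ≤ ψ (T^[n] z) - ψ (T^[n + k] z) := by
    intro z hz hz' n k
    induction k with
    | zero => simp
    | succ k ih =>
      rw [← add_assoc, Function.iterate_succ_apply']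
      have h1 := hd _ (Metric.ball_subset_ball (by linarith) (orb z hz hz' (n + k)).1)
      have := dist_triangle (T^[n] z) (T^[n + k] z) (T (T^[n + k] z))
      linarith
  have conv : ∀ z, z ∈ Metric.ball z₁ (r / 2) → ψ z < r / 4 →
      Tendsto (fun n => T^[n] z) atTop (𝓝 (limIter T z)) := by
    intro z hz hz'
    have hanti : Antitone (fun n => ψ (T^[n] z)) := by
      apply antitone_nat_of_succ_le
      intro n
      have := orb2 z hz hz' n 1
      linarith [dist_nonneg (x := T^[n] z) (y := T^[n + 1] z)]
    obtain ⟨L, hL⟩ : ∃ L, Tendsto (fun n => ψ (T^[n] z)) atTop (𝓝 L) :=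
      ⟨_, tendsto_atTop_ciInf hanti ⟨0, by rintro _ ⟨n, rfl⟩; exact hψ _⟩⟩
    have hc : CauchySeq (fun n => T^[n] z) := by
      rw [Metric.cauchySeq_iff']
      intro ε hε
      have hcs := hL.cauchySeq
      rw [Metric.cauchySeq_iff'] at hcs
      obtain ⟨M, hM⟩ := hcs ε hε
      refine ⟨M, fun n hn => ?_⟩
      obtain ⟨k, rfl⟩ := Nat.exists_eq_add_of_le hn
      have h1 := orb2 z hz hz' M k
      have h2 := hM (M + k) (by omega)
      rw [Real.dist_eq] at h2
      rw [dist_comm]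
      have := neg_abs_le (ψ (T^[M + k] z) - ψ (T^[M] z))
      linarith
    exact @tendsto_nhds_limUnder _ _ _ _ _ (cauchySeq_tendsto_of_complete hc)
  have lim : ∀ z, z ∈ Metric.ball z₁ (r / 2) → ψ z < r / 4 →
      limIter T z ∈ Metric.ball z₁ r ∧ ψ (limIter T z) = 0 ∧
      Tendsto (fun n => ψ (T^[n] z)) atTop (𝓝 0) ∧
      ∀ n, dist (T^[n] z) (limIter T z) ≤ ψ (T^[n] z) := by
    intro z hz hz'
    have hc := conv z hz hz'
    have hb : limIter T z ∈ Metric.ball z₁ r := by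
      have : limIter T z ∈ Metric.closedBall z₁ (3 / 4 * r) :=
        Metric.isClosed_closedBall.mem_of_tendsto hc
          (Eventually.of_forall fun n => Metric.ball_subset_closedBall (orb z hz hz' n).1)
      exact Metric.closedBall_subset_ball (by linarith) this
    have hTl : T (limIter T z) = limIter T z := by
      have h1 : Tendsto (fun n => T (T^[n] z)) atTop (𝓝 (T (limIter T z))) :=
        (hT _ hb).tendsto.comp hc
      have h2 : Tendsto (fun n => T (T^[n] z)) atTop (𝓝 (limIter T z)) := by
        have := (tendsto_add_atTop_iff_nat 1).mpr hc
        simpa only [Function.iterate_succ_apply'] using this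
      exact tendsto_nhds_unique h1 h2
    have h0 := hfix _ hb hTl
    have hψl : Tendsto (fun n => ψ (T^[n] z)) atTop (𝓝 0) := by
      have := (hψc _ hb).tendsto.comp hc
      rwa [h0] at this
    refine ⟨hb, h0, hψl, fun n => ?_⟩
    have h1 : Tendsto (fun k => dist (T^[n] z) (T^[n + k] z)) atTop
        (𝓝 (dist (T^[n] z) (limIter T z))) := by
      have : Tendsto (fun k => T^[n + k] z) atTop (𝓝 (limIter T z)) := by
        have := (tendsto_add_atTop_iff_nat n).mpr hc
        simpa only [add_comm] using this
      exact tendsto_const_nhds.dist this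
    refine le_of_tendsto h1 (Eventually.of_forall fun k => ?_)
    have := orb2 z hz hz' n k
    linarith [hψ (T^[n + k] z)]
  obtain ⟨δ, hδ, hδb⟩ := Metric.mem_nhds_iff.mp h0
  refine ⟨δ, hδ, fun z hz => ?_⟩
  have hz1 := hδb hz
  obtain ⟨l1, l2, l3, l4⟩ := lim z hz1.1 hz1.2
  refine ⟨?_, l2, l1⟩
  rw [Metric.continuousAt_iff']
  intro ε hε
  obtain ⟨n, hn⟩ := (l3.eventually (gt_mem_nhds (show (0 : ℝ) < ε / 3 by positivity))).exists
  have itc : ∀ n, ContinuousAt (T^[n]) z := by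
    intro n
    induction n with
    | zero => exact continuousAt_id
    | succ n ih =>
      rw [Function.iterate_succ']
      exact ContinuousAt.comp (hT _ (Metric.ball_subset_ball (by linarith)
        (orb z hz1.1 hz1.2 n).1)) ih
  have hψn : ContinuousAt (fun z' => ψ (T^[n] z')) z :=
    ContinuousAt.comp (f := T^[n]) (hψc _ (Metric.ball_subset_ball (by linarith)
        (orb z hz1.1 hz1.2 n).1)) (itc n)
  have e1 := hψn.tendsto.eventually (gt_mem_nhds hn)
  have e2 := Metric.continuousAt_iff'.mp (itc n) (ε / 3) (by positivity)
  have e3 : ∀ᶠ z' in 𝓝 z, z' ∈ Metric.ball z₁ δ := Metric.isOpen_ball.mem_nhds hz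
  filter_upwards [e1, e2, e3] with z' h1 h2 h3
  have hz2 := hδb h3
  obtain ⟨m1, m2, m3, m4⟩ := lim z' hz2.1 hz2.2
  calc dist (limIter T z') (limIter T z)
      ≤ dist (limIter T z') (T^[n] z') + dist (T^[n] z') (T^[n] z)
        + dist (T^[n] z) (limIter T z) := dist_triangle4 _ _ _ _
    _ < ε / 3 + ε / 3 + ε / 3 := by
        have := m4 n
        have := l4 n
        rw [dist_comm (limIter T z')]
        gcongr <;> linarith
    _ = ε := by ring

lemma limIter_fix {T : X → X} {z : X} (h : T z = z) : limIter T z = z := by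
  have : (fun n : ℕ => T^[n] z) = fun _ => z := by
    funext n; exact Function.iterate_fixed h n
  unfold limIter
  rw [this]
  exact @Filter.Tendsto.limUnder_eq _ _ _ _ _ _ _ _ tendsto_const_nhds

end Metric
end
end

section
open Filter Topology
open Filter Topology

noncomputable section

section Grad
variable {V W : Type*} [NormedAddCommGroup V] [InnerProductSpace ℂ V] [FiniteDimensional ℂ V]
  [NormedAddCommGroup W] [InnerProductSpace ℂ W] [FiniteDimensional ℂ W]
  [CompleteSpace V] [CompleteSpace W]

/-- the gradient `DΦ(z)^* Φ(z)` -/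
def grd (Φ : V → W) (z : V) : V := ContinuousLinearMap.adjoint (fderiv ℂ Φ z) (Φ z)

lemma grd_inner (Φ : V → W) (z x : V) : inner ℂ (grd Φ z) x = inner ℂ (Φ z) (fderiv ℂ Φ z x) :=
  ContinuousLinearMap.adjoint_inner_left _ _ _

theorem grad_ineq {Φ : V → W} {z₀ : V} (hΦ : AnalyticAt ℂ Φ z₀) (h0 : Φ z₀ = 0) :
    ∃ S ∈ 𝓝 z₀, ∃ θ : ℝ, 0 < θ ∧ θ < 1 ∧ ∃ c : ℝ, 0 < c ∧ ∀ z ∈ S,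
      c * ‖Φ z‖ ^ (1 + θ) ≤ ‖grd Φ z‖ := by
  set F : V × (W →L[ℂ] ℂ) → ℂ := fun p => p.2 (Φ p.1) with hF
  have hFA : ∀ lam, AnalyticAt ℂ F (z₀, lam) := by
    intro lam
    have h1 : AnalyticAt ℂ (fun p : V × (W →L[ℂ] ℂ) => Φ p.1) (z₀, lam) :=
      hΦ.comp_of_eq (f := Prod.fst) analyticAt_fst rfl
    have h2 : AnalyticAt ℂ (fun p : V × (W →L[ℂ] ℂ) => p.2) (z₀, lam) := analyticAt_snd
    exact (h2.contDiffAt.clm_apply h1.contDiffAt : ContDiffAt ℂ ⊤ F (z₀, lam)).analyticAt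
  have hloc : ∃ N ∈ 𝓝 z₀, LojSet F (N ×ˢ Metric.sphere (0 : W →L[ℂ] ℂ) 1) := by
    refine (isCompact_sphere (0 : W →L[ℂ] ℂ) 1).induction_on
      (p := fun T => ∃ N ∈ 𝓝 z₀, LojSet F (N ×ˢ T)) ?_ ?_ ?_ ?_
    · exact ⟨Set.univ, univ_mem, 1 / 2, by norm_num, by norm_num, 1, one_pos, by simp⟩
    · rintro s t hst ⟨N, hN, h⟩
      exact ⟨N, hN, h.mono_set (Set.prod_mono le_rfl hst)⟩
    · rintro s t ⟨N, hN, h⟩ ⟨N', hN', h'⟩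
      refine ⟨N ∩ N', Filter.inter_mem hN hN', (h.union h').mono_set ?_⟩
      rintro ⟨x, y⟩ ⟨hx, hy⟩
      rcases hy with hy | hy
      · exact Or.inl ⟨hx.1, hy⟩
      · exact Or.inr ⟨hx.2, hy⟩
    · intro lam _
      obtain ⟨S, hS, h⟩ := lojasiewicz (hFA lam) (by simp [hF, h0])
      obtain ⟨N, hN, T, hT, hNT⟩ := mem_nhds_prod_iff.mp hS
      exact ⟨T, nhdsWithin_le_nhds hT, N, hN, h.mono_set hNT⟩
  obtain ⟨N, hN, θ, hθ0, hθ1, C, hC, H⟩ := hloc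
  -- smallness of Φ
  have hsm : ∀ᶠ z in 𝓝 z₀, ‖Φ z‖ ≤ 1 ∧ C * ‖Φ z‖ ^ (1 - θ) ≤ 1 / 2 := by
    have hc : Tendsto (fun z => ‖Φ z‖) (𝓝 z₀) (𝓝 0) := by
      have := hΦ.continuousAt.norm.tendsto
      rwa [h0, norm_zero] at this
    have hc2 : Tendsto (fun z => C * ‖Φ z‖ ^ (1 - θ)) (𝓝 z₀) (𝓝 0) := by
      have := (hc.rpow_const (p := 1 - θ) (Or.inr (by linarith))).const_mul C
      rwa [Real.zero_rpow (by linarith), mul_zero] at this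
    exact (hc.eventually (ge_mem_nhds one_pos)).and
      (hc2.eventually (ge_mem_nhds (by norm_num)))
  refine ⟨_, Filter.inter_mem hN (Filter.inter_mem hsm
    (hΦ.eventually_analyticAt)), θ, hθ0, hθ1, 1 / (2 * C), by positivity, ?_⟩
  rintro z ⟨hzN, ⟨hz1, hz2⟩, hzA⟩
  have hzA' : AnalyticAt ℂ Φ z := hzA
  by_cases hz : Φ z = 0
  · rw [hz, norm_zero, Real.zero_rpow (by linarith), mul_zero]; positivity
  have hpos : 0 < ‖Φ z‖ := norm_pos_iff.mpr hz
  set lam : W →L[ℂ] ℂ := ((‖Φ z‖ : ℂ)⁻¹) • innerSL ℂ (Φ z) with hlam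
  have hnorm : ‖((‖Φ z‖ : ℂ)⁻¹)‖ = ‖Φ z‖⁻¹ := by rw [norm_inv, Complex.norm_real, norm_norm]
  have hlam1 : lam ∈ Metric.sphere (0 : W →L[ℂ] ℂ) 1 := by
    rw [mem_sphere_zero_iff_norm, hlam, norm_smul, hnorm, innerSL_apply_norm]
    exact inv_mul_cancel₀ hpos.ne'
  have hFv : F (z, lam) = (‖Φ z‖ : ℂ) := by
    simp only [hF, hlam, ContinuousLinearMap.smul_apply, innerSL_apply_apply, smul_eq_mul]
    rw [inner_self_eq_norm_sq_to_K]
    have : (‖Φ z‖ : ℂ) ≠ 0 := by exact_mod_cast hpos.ne'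
    push_cast
    field_simp
    rfl
  have hFn : ‖F (z, lam)‖ = ‖Φ z‖ := by rw [hFv, Complex.norm_real, norm_norm]
  have h1 := H (z, lam) ⟨hzN, hlam1⟩ (by rw [hFn]; exact hz1)
  rw [hFn] at h1
  -- derivative bound
  have hD : ‖fderiv ℂ F (z, lam)‖ ≤ ‖Φ z‖⁻¹ * ‖grd Φ z‖ + ‖Φ z‖ := by
    have hd1 : HasFDerivAt (fun p : V × (W →L[ℂ] ℂ) => Φ p.1)
        ((fderiv ℂ Φ z).comp (ContinuousLinearMap.fst ℂ V (W →L[ℂ] ℂ))) (z, lam) :=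
      HasFDerivAt.comp (z, lam) (f := Prod.fst) hzA'.differentiableAt.hasFDerivAt hasFDerivAt_fst
    have hd2 : HasFDerivAt (fun p : V × (W →L[ℂ] ℂ) => p.2)
        (ContinuousLinearMap.snd ℂ V (W →L[ℂ] ℂ)) (z, lam) := hasFDerivAt_snd
    have hd := hd2.clm_apply hd1
    rw [HasFDerivAt.fderiv hd]
    refine ContinuousLinearMap.opNorm_le_bound _ (by positivity) ?_
    rintro ⟨x, mu⟩
    have e : ∀ x, lam (fderiv ℂ Φ z x) = (‖Φ z‖ : ℂ)⁻¹ * inner ℂ (grd Φ z) x := by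
      intro x
      rw [grd_inner, hlam]; simp
    simp only [ContinuousLinearMap.add_apply, ContinuousLinearMap.comp_apply,
      ContinuousLinearMap.flip_apply, ContinuousLinearMap.coe_fst', ContinuousLinearMap.coe_snd', e]
    have hx : ‖x‖ ≤ ‖(x, mu)‖ := le_max_left _ _
    have hmu : ‖mu‖ ≤ ‖(x, mu)‖ := le_max_right _ _
    calc _ ≤ ‖(‖Φ z‖ : ℂ)⁻¹ * inner ℂ (grd Φ z) x‖ + ‖mu (Φ z)‖ := norm_add_le _ _
      _ ≤ ‖Φ z‖⁻¹ * (‖grd Φ z‖ * ‖(x, mu)‖) + ‖(x, mu)‖ * ‖Φ z‖ := by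
          rw [norm_mul, hnorm]
          have i1 := norm_inner_le_norm (𝕜 := ℂ) (grd Φ z) x
          have i2 := mu.le_opNorm (Φ z)
          gcongr
          · exact i1.trans (by gcongr)
          · exact i2.trans (by gcongr)
      _ = _ := by ring
  have h2 : ‖Φ z‖ ^ θ ≤ C * (‖Φ z‖⁻¹ * ‖grd Φ z‖ + ‖Φ z‖) := h1.trans (by gcongr)
  have h3 : C * ‖Φ z‖ ≤ 1 / 2 * ‖Φ z‖ ^ θ := by
    have : ‖Φ z‖ = ‖Φ z‖ ^ (1 - θ) * ‖Φ z‖ ^ θ := by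
      rw [← Real.rpow_add hpos]; simp
    calc C * ‖Φ z‖ = (C * ‖Φ z‖ ^ (1 - θ)) * ‖Φ z‖ ^ θ := by
          conv_lhs => rw [this]
          ring
      _ ≤ _ := by gcongr
  have h4 : ‖Φ z‖ ^ θ ≤ 2 * C * (‖Φ z‖⁻¹ * ‖grd Φ z‖) := by linarith
  rw [Real.rpow_add hpos, Real.rpow_one, one_div, inv_mul_le_iff₀ (by positivity)]
  calc ‖Φ z‖ * ‖Φ z‖ ^ θ ≤ ‖Φ z‖ * (2 * C * (‖Φ z‖⁻¹ * ‖grd Φ z‖)) := by gcongr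
    _ = 2 * C * ‖grd Φ z‖ := by field_simp

/-- sufficient decrease for small steps -/
theorem decrease {Φ : V → W} {z₀ : V} (hΦ : AnalyticAt ℂ Φ z₀) (h0 : Φ z₀ = 0) :
    ∃ S ∈ 𝓝 z₀, ∃ l₀ : ℝ, 0 < l₀ ∧ ∀ lam : ℝ, 0 < lam → lam ≤ l₀ → ∀ z ∈ S,
      ‖Φ (z - lam • grd Φ z)‖ ^ 2 ≤ ‖Φ z‖ ^ 2 - lam * ‖grd Φ z‖ ^ 2 := by
  obtain ⟨K, t, ht, hK⟩ := (hΦ.fderiv.contDiffAt (n := 1)).exists_lipschitzOnWith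
  obtain ⟨r, hr, hrt⟩ := Metric.mem_nhds_iff.mp (Filter.inter_mem ht hΦ.eventually_analyticAt)
  have hgc : ContinuousAt (grd Φ) z₀ := by
    unfold grd
    have h1 : ContinuousAt (fun z => ContinuousLinearMap.adjoint (fderiv ℂ Φ z)) z₀ :=
      (ContinuousLinearMap.adjoint (𝕜 := ℂ) (E := V) (F := W)).continuous.continuousAt.comp
        hΦ.fderiv.continuousAt
    exact h1.clm_apply hΦ.continuousAt
  have hg0 : grd Φ z₀ = 0 := by simp [grd, h0]
  set L := ‖fderiv ℂ Φ z₀‖ + 1 with hL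
  have hev : ∀ᶠ z in 𝓝 z₀, ‖Φ z‖ ≤ 1 ∧ ‖fderiv ℂ Φ z‖ ≤ L ∧ ‖grd Φ z‖ ≤ min 1 (r / 2) ∧
      z ∈ Metric.ball z₀ (r / 2) := by
    have c1 : Tendsto (fun z => ‖Φ z‖) (𝓝 z₀) (𝓝 0) := by
      have := hΦ.continuousAt.norm.tendsto
      rwa [h0, norm_zero] at this
    have c2 := hΦ.fderiv.continuousAt.norm.tendsto
    have c3 : Tendsto (fun z => ‖grd Φ z‖) (𝓝 z₀) (𝓝 0) := by
      have := hgc.norm.tendsto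
      rwa [hg0, norm_zero] at this
    exact (c1.eventually (ge_mem_nhds one_pos)).and ((c2.eventually (ge_mem_nhds (by simp [hL]))).and
      ((c3.eventually (ge_mem_nhds (by positivity))).and (Metric.ball_mem_nhds _ (by positivity))))
  have hL0 : 0 < L := by positivity
  set Q : ℝ := 2 * K + (L + K) ^ 2 with hQ
  have hQ0 : 0 < Q := by positivity
  refine ⟨_, hev, min 1 (1 / Q), by positivity, ?_⟩
  rintro lam hl hl0 z ⟨hz1, hz2, hz3, hz4⟩
  have hl1 : lam ≤ 1 := hl0.trans (min_le_left _ _)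
  have hlQ : lam * Q ≤ 1 := by
    rw [← le_div_iff₀ hQ0]; exact hl0.trans (min_le_right _ _)
  set g := grd Φ z with hg
  have hg1 : ‖g‖ ≤ 1 := hz3.trans (min_le_left _ _)
  have hgr : ‖g‖ ≤ r / 2 := hz3.trans (min_le_right _ _)
  have hns : ‖lam • g‖ = lam * ‖g‖ := by rw [norm_smul, Real.norm_eq_abs, abs_of_pos hl]
  have hlg : lam * ‖g‖ ≤ ‖g‖ := by
    have := mul_le_mul_of_nonneg_right hl1 (norm_nonneg g)
    linarith
  have hz' : z - lam • g ∈ Metric.ball z₀ r := by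
    rw [Metric.mem_ball] at hz4 ⊢
    have : dist (z - lam • g) z ≤ r / 2 := by
      rw [dist_eq_norm, sub_sub_cancel_left, norm_neg, hns]; linarith
    have := dist_triangle (z - lam • g) z z₀
    linarith
  have hzr : z ∈ Metric.ball z₀ r := Metric.ball_subset_ball (by linarith) hz4
  have hseg : segment ℝ z (z - lam • g) ⊆ Metric.ball z₀ r := (convex_ball z₀ r).segment_subset hzr hz'
  -- Taylor
  have hT : ‖Φ (z - lam • g) - Φ z - fderiv ℂ Φ z (z - lam • g - z)‖ ≤
      (K * (lam * ‖g‖)) * ‖z - lam • g - z‖ := by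
    refine (convex_segment z (z - lam • g)).norm_image_sub_le_of_norm_hasFDerivWithin_le'
      (𝕜 := ℂ) (f' := fun x => fderiv ℂ Φ x) (fun x hx => ?_) (fun x hx => ?_)
      (left_mem_segment ℝ _ _) (right_mem_segment ℝ _ _)
    · have : AnalyticAt ℂ Φ x := (hrt (hseg hx)).2
      exact this.differentiableAt.hasFDerivAt.hasFDerivWithinAt
    · have h1 := hK.dist_le_mul x (hrt (hseg hx)).1 z (hrt hzr).1
      rw [dist_eq_norm] at h1
      refine h1.trans ?_
      gcongr
      obtain ⟨a, ha, rfl⟩ := (segment_eq_image' ℝ z (z - lam • g)).subset hx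
      rw [dist_eq_norm, add_sub_cancel_left, norm_smul, sub_sub_cancel_left, norm_neg, hns,
        Real.norm_eq_abs, abs_of_nonneg ha.1]
      have : 0 ≤ lam * ‖g‖ := by positivity
      nlinarith [ha.2]
  rw [sub_sub_cancel_left, norm_neg, hns] at hT
  set rem := Φ (z - lam • g) - Φ z - fderiv ℂ Φ z (-(lam • g)) with hrem
  have hlamC : lam • g = (lam : ℂ) • g := (RCLike.real_smul_eq_coe_smul (K := ℂ) lam g)
  have hmain : Φ (z - lam • g) = Φ z + (rem - (lam : ℂ) • fderiv ℂ Φ z g) := by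
    rw [hrem, hlamC, map_neg, map_smul]; abel
  have hin : inner ℂ (Φ z) (fderiv ℂ Φ z g) = ((‖g‖ ^ 2 : ℝ) : ℂ) := by
    rw [← grd_inner, ← hg, inner_self_eq_norm_sq_to_K]; norm_cast
  have hre : RCLike.re (inner ℂ (Φ z) (rem - (lam : ℂ) • fderiv ℂ Φ z g)) ≤
      K * (lam * ‖g‖) * (lam * ‖g‖) - lam * ‖g‖ ^ 2 := by
    rw [inner_sub_right, inner_smul_right, hin, map_sub]
    have e1 : RCLike.re ((lam : ℂ) * ((‖g‖ ^ 2 : ℝ) : ℂ)) = lam * ‖g‖ ^ 2 := by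
      rw [← Complex.ofReal_mul]; exact Complex.ofReal_re _
    rw [e1]
    have e2 : RCLike.re (inner ℂ (Φ z) rem) ≤ ‖Φ z‖ * ‖rem‖ := re_inner_le_norm _ _
    have e3 : ‖Φ z‖ * ‖rem‖ ≤ 1 * (K * (lam * ‖g‖) * (lam * ‖g‖)) := by gcongr
    linarith
  have hn : ‖rem - (lam : ℂ) • fderiv ℂ Φ z g‖ ≤ (L + K) * (lam * ‖g‖) := by
    have e1 : ‖(lam : ℂ) • fderiv ℂ Φ z g‖ ≤ L * (lam * ‖g‖) := by
      rw [norm_smul, Complex.norm_real, Real.norm_eq_abs, abs_of_pos hl]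
      have := (fderiv ℂ Φ z).le_opNorm g
      calc lam * ‖fderiv ℂ Φ z g‖ ≤ lam * (L * ‖g‖) := by
            gcongr; exact this.trans (by gcongr)
        _ = _ := by ring
    have e2 : ‖rem‖ ≤ K * (lam * ‖g‖) := by
      refine hT.trans ?_
      have : (K : ℝ) * (lam * ‖g‖) * (lam * ‖g‖) ≤ K * (lam * ‖g‖) * 1 := by
        gcongr; linarith
      linarith
    calc _ ≤ ‖rem‖ + ‖(lam : ℂ) • fderiv ℂ Φ z g‖ := norm_sub_le _ _
      _ ≤ _ := by linarith
  rw [hmain, @norm_add_sq ℂ]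
  have hn2 : ‖rem - (lam : ℂ) • fderiv ℂ Φ z g‖ ^ 2 ≤ ((L + K) * (lam * ‖g‖)) ^ 2 := by gcongr
  have hfin : lam * (lam * Q * ‖g‖ ^ 2) ≤ lam * (1 * ‖g‖ ^ 2) := by gcongr
  rw [hQ] at hfin
  nlinarith

end Grad
end
end

section
open Filter Topology
open Filter Topology

noncomputable section

section Retr
variable {V W : Type*} [NormedAddCommGroup V] [InnerProductSpace ℂ V] [FiniteDimensional ℂ V]
  [NormedAddCommGroup W] [InnerProductSpace ℂ W] [FiniteDimensional ℂ W]
  [CompleteSpace V] [CompleteSpace W]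

lemma descent_scalar {a b c d lam θ : ℝ} (ha : 0 ≤ a) (hb : 0 ≤ b) (hc : 0 < c) (hθ0 : 0 < θ)
    (hθ1 : θ < 1) (hlam : 0 < lam) (hd : c * a ^ (1 + θ) ≤ d)
    (hdec : b ^ 2 ≤ a ^ 2 - lam * d ^ 2) (hd0 : a = 0 → d = 0) :
    lam * d ≤ 2 / (c * (1 - θ)) * a ^ (1 - θ) - 2 / (c * (1 - θ)) * b ^ (1 - θ) := by
  rcases ha.eq_or_lt with h | h
  · have := hd0 h.symm
    subst this
    have hb0 : b = 0 := by
      rw [← h] at hdec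
      nlinarith
    rw [hb0, ← h]; simp
  · have h1 : (b / a) ^ (1 - θ) ≤ 1 + (1 - θ) * (b / a - 1) := by
      have := rpow_one_add_le_one_add_mul_self (s := b / a - 1) (p := 1 - θ)
        (by have : 0 ≤ b / a := by positivity
            linarith) (by linarith) (by linarith)
      simpa using this
    have hda : 0 < d := lt_of_lt_of_le (by positivity) hd
    rw [Real.div_rpow hb ha] at h1
    have hap : 0 < a ^ (1 - θ) := by positivity
    have h2 : b ^ (1 - θ) ≤ a ^ (1 - θ) + (1 - θ) * (a ^ (1 - θ)) * (b / a - 1) := by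
      rw [div_le_iff₀ hap] at h1
      linarith
    have h3 : a ^ (1 - θ) * a ^ (1 + θ) = a * a := by
      rw [← Real.rpow_add h]
      have : (1 - θ) + (1 + θ) = 2 := by ring
      rw [this]
      norm_num
      ring
    have h4 : lam * d * d ≤ 2 * a * (a - b) := by nlinarith [sq_nonneg (a - b)]
    have h5 : lam * d * (c * a ^ (1 + θ)) ≤ 2 * a * (a - b) :=
      le_trans (mul_le_mul_of_nonneg_left hd (by positivity)) h4
    -- multiply by a^(1-θ)
    have h6 : lam * d * c * a ≤ 2 * a ^ (1 - θ) * (a - b) := by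
      have : a ^ (1 - θ) * (lam * d * (c * a ^ (1 + θ))) ≤ a ^ (1 - θ) * (2 * a * (a - b)) :=
        mul_le_mul_of_nonneg_left h5 hap.le
      have e : a ^ (1 - θ) * (lam * d * (c * a ^ (1 + θ))) = a * (lam * d * c * a) := by
        rw [show a ^ (1 - θ) * (lam * d * (c * a ^ (1 + θ))) =
          (a ^ (1 - θ) * a ^ (1 + θ)) * (lam * d * c) by ring, h3]; ring
      rw [e] at this
      have e2 : a ^ (1 - θ) * (2 * a * (a - b)) = a * (2 * a ^ (1 - θ) * (a - b)) := by ring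
      rw [e2] at this
      exact le_of_mul_le_mul_left this h
    have h7 : (1 - θ) * (a ^ (1 - θ) * (1 - b / a)) ≤ a ^ (1 - θ) - b ^ (1 - θ) := by
      linarith
    have h8 : lam * d * c ≤ 2 * (a ^ (1 - θ) * (1 - b / a)) := by
      have : a ^ (1 - θ) * (1 - b / a) = a ^ (1 - θ) * (a - b) / a := by
        field_simp
      rw [this, ← mul_div_assoc, le_div_iff₀ h]
      linarith
    have hθ' : 0 < 1 - θ := by linarith
    rw [← mul_sub, div_mul_eq_mul_div, le_div_iff₀ (by positivity)]
    nlinarith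

theorem retraction {Φ : V → W} {Ω : Set V} (hΩ : IsOpen Ω) (hΦ : ∀ z ∈ Ω, AnalyticAt ℂ Φ z)
    {Z : Set V} (hZ : IsCompact Z) (hZΩ : Z ⊆ Ω) (hZ0 : ∀ z ∈ Z, Φ z = 0) {ε : ℝ} (hε : 0 < ε) :
    ∃ O : Set V, IsOpen O ∧ Z ⊆ O ∧ O ⊆ Ω ∧ ∃ R : V → V, ∀ z ∈ O, ContinuousAt R z ∧ R z ∈ Ω ∧
      Φ (R z) = 0 ∧ dist (R z) z < ε ∧ (Φ z = 0 → R z = z) := by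
  obtain ⟨l₀, hl₀, hl⟩ : ∃ l₀ : ℝ, 0 < l₀ ∧ ∀ z₀ ∈ Z, ∀ᶠ z in 𝓝 z₀,
      ‖Φ (z - l₀ • grd Φ z)‖ ^ 2 ≤ ‖Φ z‖ ^ 2 - l₀ * ‖grd Φ z‖ ^ 2 := by
    have := hZ.induction_on (p := fun T => ∃ l₀ : ℝ, 0 < l₀ ∧ ∀ lam, 0 < lam → lam ≤ l₀ →
      ∀ z₀ ∈ T, ∀ᶠ z in 𝓝 z₀,
      ‖Φ (z - lam • grd Φ z)‖ ^ 2 ≤ ‖Φ z‖ ^ 2 - lam * ‖grd Φ z‖ ^ 2) ?_ ?_ ?_ ?_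
    · obtain ⟨l₀, h, H⟩ := this
      exact ⟨l₀, h, H l₀ h le_rfl⟩
    · exact ⟨1, one_pos, by simp⟩
    · rintro s t hst ⟨l, hl, H⟩
      exact ⟨l, hl, fun lam h1 h2 z hz => H lam h1 h2 z (hst hz)⟩
    · rintro s t ⟨l, hl, H⟩ ⟨l', hl', H'⟩
      refine ⟨min l l', lt_min hl hl', fun lam h1 h2 z hz => ?_⟩
      rcases hz with hz | hz
      · exact H lam h1 (h2.trans (min_le_left _ _)) z hz
      · exact H' lam h1 (h2.trans (min_le_right _ _)) z hz
    · intro z₀ hz₀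
      obtain ⟨S, hS, l, hl, H⟩ := decrease (hΦ z₀ (hZΩ hz₀)) (hZ0 z₀ hz₀)
      refine ⟨interior S, nhdsWithin_le_nhds (interior_mem_nhds.mpr hS), l, hl,
        fun lam h1 h2 z hz => ?_⟩
      filter_upwards [mem_interior_iff_mem_nhds.mp hz] with w hw
      exact H lam h1 h2 w hw
  set T : V → V := fun z => z - l₀ • grd Φ z with hT
  have hfixT : ∀ z, Φ z = 0 → T z = z := by
    intro z hz; simp [hT, grd, hz]
  have key : ∀ z₁ ∈ Z, ∃ δ > 0, ∀ z ∈ Metric.ball z₁ δ, ContinuousAt (limIter T) z ∧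
      limIter T z ∈ Ω ∧ Φ (limIter T z) = 0 ∧ dist (limIter T z) z < ε ∧
      (Φ z = 0 → limIter T z = z) ∧ z ∈ Ω := by
    intro z₁ hz₁
    obtain ⟨S, hS, θ, hθ0, hθ1, c, hc, H⟩ := grad_ineq (hΦ z₁ (hZΩ hz₁)) (hZ0 z₁ hz₁)
    obtain ⟨r, hr, hball⟩ := Metric.mem_nhds_iff.mp
      (Filter.inter_mem hS (Filter.inter_mem (hl z₁ hz₁) (hΩ.mem_nhds (hZΩ hz₁))))
    set r' := min r (ε / 2) with hr'
    have hr'0 : 0 < r' := lt_min hr (by positivity)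
    have hsub : Metric.ball z₁ r' ⊆ Metric.ball z₁ r := Metric.ball_subset_ball (min_le_left _ _)
    have hcoef : 0 < 2 / (c * (1 - θ)) := by
      have : 0 < 1 - θ := by linarith
      positivity
    have hψz : ∀ z, 2 / (c * (1 - θ)) * ‖Φ z‖ ^ (1 - θ) = 0 → Φ z = 0 := by
      intro z hz
      rcases mul_eq_zero.mp hz with h | h
      · exact absurd h hcoef.ne'
      · rw [Real.rpow_eq_zero (norm_nonneg _) (by linarith)] at h
        exact norm_eq_zero.mp h
    have hθne : 1 - θ ≠ 0 := by
      have : 0 < 1 - θ := by linarith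
      exact this.ne'
    obtain ⟨δ, hδ, hD⟩ : ∃ δ > 0, ∀ z ∈ Metric.ball z₁ δ, ContinuousAt (limIter T) z ∧
        2 / (c * (1 - θ)) * ‖Φ (limIter T z)‖ ^ (1 - θ) = 0 ∧ limIter T z ∈ Metric.ball z₁ r' := by
      refine descent (T := T) (ψ := fun z => 2 / (c * (1 - θ)) * ‖Φ z‖ ^ (1 - θ))
        (z₁ := z₁) (r := r') hr'0 (fun z => by positivity)
        (by simp [hZ0 z₁ hz₁, Real.zero_rpow hθne]) ?_ ?_ ?_ ?_
      · intro z hz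
        have hA := hΦ z (hball (hsub hz)).2.2
        have h1 : ContinuousAt (fun z => ContinuousLinearMap.adjoint (fderiv ℂ Φ z)) z :=
          (ContinuousLinearMap.adjoint (𝕜 := ℂ) (E := V) (F := W)).continuous.continuousAt.comp
            hA.fderiv.continuousAt
        exact continuousAt_id.sub ((h1.clm_apply hA.continuousAt).const_smul l₀)
      · intro z hz
        have hA := hΦ z (hball (hsub hz)).2.2
        exact (hA.continuousAt.norm.rpow_const (Or.inr (by linarith))).const_mul _
      · intro z hz
        obtain ⟨g1, g2, g3⟩ := hball (hsub hz)
        have e : dist z (T z) = l₀ * ‖grd Φ z‖ := by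
          rw [dist_eq_norm, hT]
          simp [norm_smul, abs_of_pos hl₀]
        rw [e]
        refine descent_scalar (norm_nonneg _) (norm_nonneg _) hc hθ0 hθ1 hl₀ (H z g1) g2 ?_
        intro h
        simp [grd, norm_eq_zero.mp h]
      · intro z hz hTz
        obtain ⟨g1, g2, g3⟩ := hball (hsub hz)
        have e : grd Φ z = 0 := by
          have : l₀ • grd Φ z = 0 := by simpa [hT] using hTz
          rcases smul_eq_zero.mp this with h | h
          · exact absurd h hl₀.ne'
          · exact h
        have := H z g1
        rw [e, norm_zero] at this
        have h2 : ‖Φ z‖ ^ (1 + θ) ≤ 0 := by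
          by_contra hh
          push Not at hh
          nlinarith
        have h3 : ‖Φ z‖ ^ (1 + θ) = 0 := le_antisymm h2 (by positivity)
        rw [Real.rpow_eq_zero (norm_nonneg _) (by linarith)] at h3
        simp [h3, Real.zero_rpow hθne]
    · refine ⟨min δ (min r' (ε / 2)), lt_min hδ (lt_min hr'0 (by positivity)), fun z hz => ?_⟩
      have hz1 : z ∈ Metric.ball z₁ δ := Metric.ball_subset_ball (min_le_left _ _) hz
      have hz2 : z ∈ Metric.ball z₁ r' :=
        Metric.ball_subset_ball ((min_le_right _ _).trans (min_le_left _ _)) hz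
      have hz3 : dist z z₁ < ε / 2 := lt_of_lt_of_le (Metric.mem_ball.mp hz)
        ((min_le_right _ _).trans (min_le_right _ _))
      obtain ⟨h1, h2, h3⟩ := hD z hz1
      refine ⟨h1, (hball (hsub h3)).2.2, hψz _ h2, ?_, fun h => limIter_fix (hfixT z h),
        (hball (hsub hz2)).2.2⟩
      have h4 : dist (limIter T z) z₁ < ε / 2 := lt_of_lt_of_le (Metric.mem_ball.mp h3)
        (min_le_right _ _)
      have := dist_triangle_right (limIter T z) z z₁
      linarith
  choose! δ hδ hK using key
  refine ⟨⋃ z₁ ∈ Z, Metric.ball z₁ (δ z₁), isOpen_biUnion fun _ _ => Metric.isOpen_ball, ?_, ?_,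
    limIter T, ?_⟩
  · intro z hz
    exact Set.mem_biUnion hz (Metric.mem_ball_self (hδ z hz))
  · intro z hz
    obtain ⟨z₁, h1, h2⟩ := Set.mem_iUnion₂.mp hz
    exact (hK z₁ h1 z h2).2.2.2.2.2
  · intro z hz
    obtain ⟨z₁, h1, h2⟩ := Set.mem_iUnion₂.mp hz
    obtain ⟨a1, a2, a3, a4, a5, -⟩ := hK z₁ h1 z h2
    exact ⟨a1, a2, a3, a4, a5⟩

end Retr
end
end

section
open Filter Topology
open Filter Topology

noncomputable section

section Op
variable {E F : Type*} [NormedAddCommGroup E] [InnerProductSpace ℂ E]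
  [NormedAddCommGroup F] [InnerProductSpace ℂ F] [CompleteSpace E] [CompleteSpace F]

open ContinuousLinearMap in
/-- `B^* B` -/
def tOp (B : E →L[ℂ] F) : E →L[ℂ] E := (adjoint B).comp B

/-- `1 - sg B^* B` -/
def cOp (sg : ℝ) (B : E →L[ℂ] F) : E →L[ℂ] E := ContinuousLinearMap.id ℂ E - (sg : ℂ) • tOp B

lemma tOp_apply (B : E →L[ℂ] F) (x : E) : tOp B x = ContinuousLinearMap.adjoint B (B x) := by
  rw [tOp, ContinuousLinearMap.comp_apply]

lemma tOp_inner (B : E →L[ℂ] F) (x y : E) : inner ℂ (tOp B x) y = inner ℂ (B x) (B y) := by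
  rw [tOp_apply, ContinuousLinearMap.adjoint_inner_left]

lemma tOp_inner' (B : E →L[ℂ] F) (x y : E) : inner ℂ x (tOp B y) = inner ℂ (B x) (B y) := by
  rw [tOp_apply, ContinuousLinearMap.adjoint_inner_right]

lemma cOp_apply (sg : ℝ) (B : E →L[ℂ] F) (x : E) : cOp sg B x = x - (sg : ℂ) • tOp B x := by
  simp [cOp]

lemma norm_tOp_apply_sq (B : E →L[ℂ] F) (x : E) : ‖tOp B x‖ ^ 2 ≤ ‖B‖ ^ 2 * ‖B x‖ ^ 2 := by
  rw [← mul_pow]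
  gcongr
  rw [tOp_apply]
  calc _ ≤ ‖ContinuousLinearMap.adjoint B‖ * ‖B x‖ := ContinuousLinearMap.le_opNorm _ _
    _ = _ := by rw [LinearIsometryEquiv.norm_map]

lemma norm_sub_smul_sq (sg : ℝ) (x y : E) :
    ‖x - (sg : ℂ) • y‖ ^ 2 = ‖x‖ ^ 2 - 2 * sg * (inner ℂ x y).re + sg ^ 2 * ‖y‖ ^ 2 := by
  rw [@norm_sub_sq ℂ, inner_smul_right, norm_smul]
  simp
  rw [mul_pow, sq_abs]
  ring

lemma norm_cOp_sq (sg : ℝ) (B : E →L[ℂ] F) (x : E) :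
    ‖cOp sg B x‖ ^ 2 = ‖x‖ ^ 2 - 2 * sg * ‖B x‖ ^ 2 + sg ^ 2 * ‖tOp B x‖ ^ 2 := by
  rw [cOp_apply, norm_sub_smul_sq, tOp_inner', inner_self_eq_norm_sq_to_K]
  congr 3
  norm_cast

lemma norm_cOp_sq_le {sg : ℝ} {B : E →L[ℂ] F} (hsg : 0 ≤ sg) (h : sg * ‖B‖ ^ 2 ≤ 1) (x : E) :
    ‖cOp sg B x‖ ^ 2 ≤ ‖x‖ ^ 2 - sg * ‖B x‖ ^ 2 := by
  rw [norm_cOp_sq]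
  have h1 := norm_tOp_apply_sq B x
  have h2 : sg ^ 2 * ‖tOp B x‖ ^ 2 ≤ sg * ((sg * ‖B‖ ^ 2) * ‖B x‖ ^ 2) := by
    have := mul_le_mul_of_nonneg_left h1 (sq_nonneg sg)
    linarith
  have h3 : sg * ((sg * ‖B‖ ^ 2) * ‖B x‖ ^ 2) ≤ sg * (1 * ‖B x‖ ^ 2) := by gcongr
  linarith

lemma cOp_ne_zero {sg : ℝ} {B : E →L[ℂ] F} (hsg : 0 ≤ sg) (h : sg * ‖B‖ ^ 2 ≤ 1 / 4) {x : E}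
    (hx : x ≠ 0) : cOp sg B x ≠ 0 := by
  intro h0
  have h1 := norm_cOp_sq sg B x
  rw [h0, norm_zero] at h1
  have h2 : ‖B x‖ ^ 2 ≤ ‖B‖ ^ 2 * ‖x‖ ^ 2 := by
    rw [← mul_pow]; gcongr; exact B.le_opNorm x
  have h3 : 0 < ‖x‖ ^ 2 := by
    have := norm_pos_iff.mpr hx
    positivity
  have h4 : sg * ‖B x‖ ^ 2 ≤ 1 / 4 * ‖x‖ ^ 2 := by
    calc sg * ‖B x‖ ^ 2 ≤ sg * (‖B‖ ^ 2 * ‖x‖ ^ 2) := by gcongr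
      _ = (sg * ‖B‖ ^ 2) * ‖x‖ ^ 2 := by ring
      _ ≤ _ := by gcongr
  have h5 : 0 ≤ sg ^ 2 * ‖tOp B x‖ ^ 2 := by positivity
  nlinarith

/-- monotonicity of the Rayleigh quotient -/
lemma cOp_mono {sg : ℝ} {B : E →L[ℂ] F} (hsg : 0 ≤ sg) (h : sg * ‖B‖ ^ 2 ≤ 1) (u : E) :
    ‖B (cOp sg B u)‖ ^ 2 * ‖u‖ ^ 2 ≤ ‖B u‖ ^ 2 * ‖cOp sg B u‖ ^ 2 := by
  by_cases hu : u = 0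
  · simp [hu]
  have hm0 : 0 < ‖u‖ ^ 2 := by
    have := norm_pos_iff.mpr hu
    positivity
  set l : ℝ := ‖B u‖ ^ 2 / ‖u‖ ^ 2 with hl
  set y : E := tOp B u - (l : ℂ) • u with hy
  have hl0 : 0 ≤ l := by positivity
  have hm1 : ‖B u‖ ^ 2 = l * ‖u‖ ^ 2 := by rw [hl]; field_simp
  have hiu : (inner ℂ (tOp B u) u).re = ‖B u‖ ^ 2 := by
    rw [tOp_inner, inner_self_eq_norm_sq_to_K]
    norm_cast
  have hm2 : ‖y‖ ^ 2 = ‖tOp B u‖ ^ 2 - l ^ 2 * ‖u‖ ^ 2 := by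
    rw [hy, norm_sub_smul_sq, hiu, hm1]; ring
  have hBt : B (tOp B u) = B y + (l : ℂ) • B u := by
    rw [hy]; simp
  -- re inner (B u) (B (tOp B u)) = ‖tOp B u‖ ^2
  have hi2 : (inner ℂ (B u) (B (tOp B u))).re = ‖tOp B u‖ ^ 2 := by
    rw [← tOp_inner, inner_self_eq_norm_sq_to_K]; norm_cast
  have hiy : (inner ℂ (B u) (B y)).re = ‖y‖ ^ 2 := by
    have : (inner ℂ (B u) (B (tOp B u))).re = (inner ℂ (B u) (B y)).re + l * ‖B u‖ ^ 2 := by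
      rw [hBt, inner_add_right, inner_smul_right, inner_self_eq_norm_sq_to_K, Complex.add_re]
      congr 1
      change ((l : ℂ) * ((‖B u‖ : ℝ) : ℂ) ^ 2).re = _
      rw [← Complex.ofReal_pow, ← Complex.ofReal_mul, Complex.ofReal_re]
    rw [hi2] at this
    rw [hm2, hm1] at *
    linarith
  have hm3 : ‖B (tOp B u)‖ ^ 2 = ‖B y‖ ^ 2 + 2 * l * ‖y‖ ^ 2 + l ^ 2 * ‖B u‖ ^ 2 := by
    rw [hBt, @norm_add_sq ℂ, inner_smul_right, norm_smul]
    have : (RCLike.re ((l : ℂ) * inner ℂ (B y) (B u)) : ℝ) = l * (inner ℂ (B u) (B y)).re := by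
      have e : (inner ℂ (B y) (B u)).re = (inner ℂ (B u) (B y)).re := by
        rw [← inner_conj_symm, Complex.conj_re]
      rw [← e]
      exact Complex.re_ofReal_mul _ _
    rw [this, hiy, mul_pow]
    simp
    ring
  have hBc : ‖B (cOp sg B u)‖ ^ 2 =
      ‖B u‖ ^ 2 - 2 * sg * ‖tOp B u‖ ^ 2 + sg ^ 2 * ‖B (tOp B u)‖ ^ 2 := by
    rw [cOp_apply, map_sub, map_smul, norm_sub_smul_sq, hi2]
  rw [hBc, norm_cOp_sq, hm3, hm1]
  have ht : ‖tOp B u‖ ^ 2 = ‖y‖ ^ 2 + l ^ 2 * ‖u‖ ^ 2 := by linarith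
  rw [ht]
  have hBy : sg * ‖B y‖ ^ 2 ≤ ‖y‖ ^ 2 := by
    calc sg * ‖B y‖ ^ 2 ≤ sg * (‖B‖ * ‖y‖) ^ 2 := by gcongr; exact B.le_opNorm y
      _ = (sg * ‖B‖ ^ 2) * ‖y‖ ^ 2 := by ring
      _ ≤ 1 * ‖y‖ ^ 2 := by gcongr
      _ = _ := one_mul _
  have hll : sg * l ≤ 1 := by
    have : l ≤ ‖B‖ ^ 2 := by
      rw [hl, div_le_iff₀ hm0, ← mul_pow]
      gcongr
      exact B.le_opNorm u
    exact le_trans (mul_le_mul_of_nonneg_left this hsg) h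
  have key : sg * (‖B y‖ ^ 2 + l * ‖y‖ ^ 2) ≤ 2 * ‖y‖ ^ 2 := by
    nlinarith [sq_nonneg ‖y‖]
  nlinarith [mul_le_mul_of_nonneg_left key (mul_nonneg hsg hm0.le)]

lemma cOp_lt {sg η : ℝ} {B : E →L[ℂ] F} (hsg : 0 ≤ sg) (h : sg * ‖B‖ ^ 2 ≤ 1 / 4) {u : E}
    (hu : ‖B u‖ < η * ‖u‖) : ‖B (cOp sg B u)‖ < η * ‖cOp sg B u‖ := by
  have hu0 : u ≠ 0 := by
    rintro rfl
    simp at hu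
  have hup := norm_pos_iff.mpr hu0
  have hcp := norm_pos_iff.mpr (cOp_ne_zero hsg h hu0)
  have hm := cOp_mono hsg (by linarith) u
  rw [← mul_pow, ← mul_pow] at hm
  have hm' := le_of_sq_le_sq hm (by positivity)
  have : ‖B (cOp sg B u)‖ * ‖u‖ < (η * ‖cOp sg B u‖) * ‖u‖ := by
    calc _ ≤ _ := hm'
      _ < (η * ‖u‖) * ‖cOp sg B u‖ := by gcongr
      _ = _ := by ring
  exact lt_of_mul_lt_mul_right this hup.le

lemma cOp_iter_lt {sg η : ℝ} {B : E →L[ℂ] F} (hsg : 0 ≤ sg) (h : sg * ‖B‖ ^ 2 ≤ 1 / 4) {u : E}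
    (hu : ‖B u‖ < η * ‖u‖) (M : ℕ) :
    ‖B ((cOp sg B)^[M] u)‖ < η * ‖(cOp sg B)^[M] u‖ := by
  induction M with
  | zero => simpa using hu
  | succ M ih => rw [Function.iterate_succ_apply']; exact cOp_lt hsg h ih

lemma cOp_iter_inner (sg : ℝ) (B : E →L[ℂ] F) {u p : E} (hp : B p = 0) (M : ℕ) :
    inner ℂ ((cOp sg B)^[M] u) p = inner ℂ u p := by
  induction M with
  | zero => rfl
  | succ M ih =>
    rw [Function.iterate_succ_apply', cOp_apply, inner_sub_left, inner_smul_left, tOp_inner, hp]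
    simpa using ih

lemma cOp_limit {sg ε : ℝ} {B : E →L[ℂ] F} (hsg : 0 < sg) (h : sg * ‖B‖ ^ 2 ≤ 1 / 4) {u p : E}
    (hp : B p = 0) (hup : inner ℂ u p ≠ 0) (hε : 0 < ε) :
    ∃ M : ℕ, ‖B ((cOp sg B)^[M] u)‖ < ε * ‖(cOp sg B)^[M] u‖ := by
  by_contra hcon
  push Not at hcon
  have hp0 : p ≠ 0 := by rintro rfl; simp at hup
  have hpp := norm_pos_iff.mpr hp0
  have hc := norm_pos_iff.mpr hup
  set c := ‖inner ℂ u p‖ / ‖p‖ with hcdef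
  have hc0 : 0 < c := by positivity
  have hlow : ∀ M, c ≤ ‖(cOp sg B)^[M] u‖ := by
    intro M
    rw [hcdef, div_le_iff₀ hpp, ← cOp_iter_inner sg B hp M]
    exact norm_inner_le_norm _ _
  have hdec : ∀ M : ℕ, ‖(cOp sg B)^[M] u‖ ^ 2 ≤ ‖u‖ ^ 2 - M * (sg * (ε * c) ^ 2) := by
    intro M
    induction M with
    | zero => simp
    | succ M ih =>
      rw [Function.iterate_succ_apply']
      have h1 := norm_cOp_sq_le hsg.le (by linarith : sg * ‖B‖ ^ 2 ≤ 1) ((cOp sg B)^[M] u)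
      have h2 : sg * (ε * c) ^ 2 ≤ sg * ‖B ((cOp sg B)^[M] u)‖ ^ 2 := by
        gcongr
        exact le_trans (by gcongr; exact hlow M) (hcon M)
      push_cast
      linarith
  have hpos : 0 < sg * (ε * c) ^ 2 := by positivity
  obtain ⟨M, hM⟩ := exists_nat_gt (‖u‖ ^ 2 / (sg * (ε * c) ^ 2))
  rw [div_lt_iff₀ hpos] at hM
  have := hdec M
  have := sq_nonneg ‖(cOp sg B)^[M] u‖
  linarith

lemma continuous_cOp_apply {X : Type*} [TopologicalSpace X] {sg : X → ℝ} {B : X → E →L[ℂ] F}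
    {u : X → E} (hsg : Continuous sg) (hB : Continuous B) (hu : Continuous u) :
    Continuous fun x => cOp (sg x) (B x) (u x) := by
  have h1 : Continuous fun x => ContinuousLinearMap.adjoint (B x) :=
    (ContinuousLinearMap.adjoint (𝕜 := ℂ) (E := E) (F := F)).continuous.comp hB
  have h2 : Continuous fun x => tOp (B x) (u x) := by
    simp only [tOp, ContinuousLinearMap.comp_apply]
    exact h1.clm_apply (hB.clm_apply hu)
  simp only [cOp_apply]
  exact hu.sub ((Complex.continuous_ofReal.comp hsg).smul h2)

lemma continuous_cOp_iter {X : Type*} [TopologicalSpace X] {sg : X → ℝ} {B : X → E →L[ℂ] F}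
    {u : X → E} (hsg : Continuous sg) (hB : Continuous B) (hu : Continuous u) (M : ℕ) :
    Continuous fun x => (cOp (sg x) (B x))^[M] (u x) := by
  induction M with
  | zero => simpa using hu
  | succ M ih =>
    simp only [Function.iterate_succ_apply']
    exact continuous_cOp_apply hsg hB ih

end Op
end
end

section
open Filter Topology
open Filter Topology

noncomputable section

section Pert
open Module

lemma smooth_approx_cube {j : ℕ} {Y : Type*} [NormedAddCommGroup Y] [NormedSpace ℝ Y]
    [CompleteSpace Y] {f : (Fin j → unitInterval) → Y} (hf : Continuous f) {ε : ℝ} (hε : 0 < ε) :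
    ∃ g : (Fin j → ℝ) → Y, ContDiff ℝ 1 g ∧
      ∀ s : Fin j → unitInterval, dist (g fun i => (s i : ℝ)) (f s) < ε := by
  set pr : (Fin j → ℝ) → (Fin j → unitInterval) :=
    fun y i => Set.projIcc (0 : ℝ) 1 zero_le_one (y i) with hpr
  have h1 : UniformContinuous pr := by
    rw [uniformContinuous_pi]
    intro i
    exact (LipschitzWith.projIcc (zero_le_one' ℝ)).uniformContinuous.comp
      (Pi.uniformContinuous_proj _ i)
  have h2 : UniformContinuous (f ∘ pr) :=
    (CompactSpace.uniformContinuous_of_continuous hf).comp h1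
  obtain ⟨g, hg, hgd⟩ := h2.exists_contDiff_dist_le hε
  refine ⟨g, hg.of_le (by exact_mod_cast le_top), fun s => ?_⟩
  have := hgd (fun i => (s i : ℝ))
  have e : pr (fun i => (s i : ℝ)) = s := by
    funext i
    simp [hpr]
  simpa [e] using this

variable {E F X : Type*} [NormedAddCommGroup E] [InnerProductSpace ℂ E] [FiniteDimensional ℂ E]
  [NormedAddCommGroup F] [InnerProductSpace ℂ F] [FiniteDimensional ℂ F]
  [CompleteSpace E] [CompleteSpace F]
  [NormedAddCommGroup X] [NormedSpace ℝ X] [CompleteSpace X]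

lemma mem_ker_orth_param {ι : Type*} [Fintype ι] (e : Basis ι ℂ F) (B : E →L[ℂ] F) {r : ℕ}
    (hr : finrank ℂ E ≤ r + finrank ℂ (LinearMap.ker B.toLinearMap)) {v : E}
    (hv : ∀ p, B p = 0 → inner ℂ v p = 0) :
    ∃ d : Fin (r + 1), ∃ J : Fin d → ι, ∃ c : Fin d → ℂ,
      v = ∑ a, c a • ContinuousLinearMap.adjoint B (e (J a)) := by
  classical
  set w : ι → E := fun i => ContinuousLinearMap.adjoint B (e i) with hw
  have hspan : (LinearMap.ker B.toLinearMap)ᗮ ≤ Submodule.span ℂ (Set.range w) := by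
    have h1 : (Submodule.span ℂ (Set.range w))ᗮ ≤ LinearMap.ker B.toLinearMap := by
      intro p hp
      have h2 : ∀ i, inner ℂ (e i) (B p) = 0 := by
        intro i
        rw [← ContinuousLinearMap.adjoint_inner_left]
        exact (Submodule.mem_orthogonal _ _).mp hp _ (Submodule.subset_span ⟨i, rfl⟩)
      have h3 : B p = 0 := by
        apply InnerProductSpace.ext_inner_left_basis e
        intro i
        rw [h2, inner_zero_right]
      exact h3
    have := Submodule.orthogonal_le h1
    rwa [Submodule.orthogonal_orthogonal] at this
  have hvm : v ∈ (LinearMap.ker B.toLinearMap)ᗮ := by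
    rw [Submodule.mem_orthogonal']
    intro p hp
    exact hv p hp
  have hspan2 : Submodule.span ℂ (Set.range w) ≤ (LinearMap.ker B.toLinearMap)ᗮ := by
    rw [Submodule.span_le]
    rintro _ ⟨i, rfl⟩
    rw [SetLike.mem_coe, Submodule.mem_orthogonal']
    intro p hp
    rw [hw, ContinuousLinearMap.adjoint_inner_left]
    have : B p = 0 := hp
    rw [this, inner_zero_right]
  have hdim : finrank ℂ (Submodule.span ℂ (Set.range w)) ≤ r := by
    have h1 := Submodule.finrank_mono hspan2
    have h2 := Submodule.finrank_add_finrank_orthogonal (LinearMap.ker B.toLinearMap)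
    omega
  obtain ⟨κ, a, ha, hs, hli⟩ := exists_linearIndependent' ℂ w
  have hfin : Finite κ := Finite.of_injective a ha
  have := Fintype.ofFinite κ
  have hcard : Fintype.card κ ≤ r := by
    rw [← finrank_span_eq_card hli, hs]; exact hdim
  have hv2 : v ∈ Submodule.span ℂ (Set.range (w ∘ a)) := by
    rw [hs]; exact hspan hvm
  rw [Submodule.mem_span_range_iff_exists_fun] at hv2
  obtain ⟨c, hc⟩ := hv2
  refine ⟨⟨Fintype.card κ, by omega⟩, fun i => a ((Fintype.equivFin κ).symm i),
    fun i => c ((Fintype.equivFin κ).symm i), ?_⟩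
  rw [← hc]
  exact (Equiv.sum_comp (Fintype.equivFin κ).symm (fun x => c x • (w ∘ a) x)).symm

/-- the perturbation property -/
def Pert {S : Type*} [TopologicalSpace S] (B : S → E →L[ℂ] F) : Prop :=
  ∀ v : S → E, Continuous v → ∀ ε > 0, ∃ (B' : S → E →L[ℂ] F) (v' : S → E), Continuous B' ∧
    Continuous v' ∧ ∀ s, dist (B' s) (B s) < ε ∧ dist (v' s) (v s) < ε ∧
      ∃ p, B' s p = 0 ∧ inner ℂ (v' s) p ≠ 0

theorem pert_of {j k : ℕ} (L : X → E →L[ℂ] F) {U : Set X} (hU : IsOpen U)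
    (hL : ∀ y : F, ContDiffOn ℝ 1 (fun x => ContinuousLinearMap.adjoint (L x) y) U)
    (hLc : ContinuousOn L U)
    (hk : ∀ x ∈ U, k ≤ finrank ℂ (LinearMap.ker (L x).toLinearMap)) (hkn : k ≤ finrank ℂ E)
    (hj : j < 2 * k) {G : (Fin j → unitInterval) → X} (hG : Continuous G) (hGU : ∀ s, G s ∈ U) :
    Pert fun s => L (G s) := by
  intro v hv ε hε
  -- control
  obtain ⟨δ, hδ, hctl⟩ : ∃ δ > 0, ∀ s x, dist x (G s) < δ → x ∈ U ∧ dist (L x) (L (G s)) < ε := by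
    have hLG : Continuous fun s => L (G s) := hLc.comp_continuous hG hGU
    have hO : IsOpen {q : (Fin j → unitInterval) × X | q.2 ∈ U ∧ dist (L q.2) (L (G q.1)) < ε} := by
      have h1 : ContinuousOn (fun q : (Fin j → unitInterval) × X => dist (L q.2) (L (G q.1)))
          (Prod.snd ⁻¹' U) := by
        have ha : ContinuousOn (fun q : (Fin j → unitInterval) × X => L q.2) (Prod.snd ⁻¹' U) :=
          hLc.comp continuousOn_snd (fun q hq => hq)
        have hb : ContinuousOn (fun q : (Fin j → unitInterval) × X => L (G q.1)) (Prod.snd ⁻¹' U) :=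
          (hLG.comp continuous_fst).continuousOn
        exact continuous_dist.comp_continuousOn (ha.prodMk hb)
      exact h1.isOpen_inter_preimage (hU.preimage continuous_snd) isOpen_Iio
    have hK : IsCompact (Set.range fun s : Fin j → unitInterval => (s, G s)) :=
      isCompact_range (continuous_id.prodMk hG)
    obtain ⟨δ, hδ, h⟩ := hK.exists_thickening_subset_open hO (by
      rintro _ ⟨s, rfl⟩
      exact ⟨hGU s, by simpa using hε⟩)
    refine ⟨δ, hδ, fun s x hx => ?_⟩
    have : (s, x) ∈ Metric.thickening δ (Set.range fun s : Fin j → unitInterval => (s, G s)) := by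
      rw [Metric.mem_thickening_iff]
      exact ⟨(s, G s), ⟨s, rfl⟩, by simpa [Prod.dist_eq] using hx⟩
    exact h this
  obtain ⟨G', hG', hGd⟩ := smooth_approx_cube hG hδ
  obtain ⟨v', hv', hvd⟩ := smooth_approx_cube hv (half_pos hε)
  set Q : Set (Fin j → ℝ) := Set.range (fun (s : Fin j → unitInterval) i => (s i : ℝ)) with hQ
  have hQ' : Q = Set.Icc 0 1 := by
    ext y
    constructor
    · rintro ⟨s, rfl⟩
      exact ⟨fun i => (s i).2.1, fun i => (s i).2.2⟩
    · rintro ⟨h1, h2⟩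
      exact ⟨fun i => ⟨y i, h1 i, h2 i⟩, rfl⟩
  have hQc : Convex ℝ Q := by rw [hQ']; exact convex_Icc _ _
  have hG'U : ∀ y ∈ Q, G' y ∈ U := by
    rintro _ ⟨s, rfl⟩
    exact (hctl s _ (hGd s)).1
  set r := finrank ℂ E - k with hr
  let e : Basis (Fin (finrank ℂ F)) ℂ F := finBasis ℂ F
  set f : (d : Fin (r + 1)) → (Fin d → Fin (finrank ℂ F)) → (Fin j → ℝ) × (Fin d → ℂ) → E :=
    fun d J q => (∑ a, q.2 a • ContinuousLinearMap.adjoint (L (G' q.1)) (e (J a))) - v' q.1 with hf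
  set T : Set E := ⋃ d : Fin (r + 1), ⋃ J : Fin d → Fin (finrank ℂ F),
    f d J '' (Q ×ˢ Set.univ) with hT
  have hTd : dimH T < finrank ℝ E := by
    have hle : dimH T ≤ ((j + 2 * r : ℕ) : ENNReal) := by
      rw [hT, dimH_iUnion]
      refine iSup_le fun d => ?_
      rw [dimH_iUnion]
      refine iSup_le fun J => ?_
      have hcd : ContDiffOn ℝ 1 (f d J) (Q ×ˢ Set.univ) := by
        refine ContDiffOn.sub ?_ (hv'.comp contDiff_fst).contDiffOn
        refine ContDiffOn.sum fun a _ => ?_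
        refine ContDiffOn.smul ?_ ?_
        · have : ContDiff ℝ 1 (fun q : (Fin j → ℝ) × (Fin d → ℂ) => q.2 a) :=
            (contDiff_apply ℝ ℂ a).comp contDiff_snd
          exact this.contDiffOn
        · exact (hL (e (J a))).comp (hG'.comp contDiff_fst).contDiffOn
            (fun q hq => hG'U _ hq.1)
      refine (hcd.dimH_image_le (hQc.prod convex_univ) le_rfl).trans ?_
      refine (dimH_mono (Set.subset_univ _)).trans ?_
      rw [Real.dimH_univ_eq_finrank]
      have : finrank ℝ ((Fin j → ℝ) × (Fin d → ℂ)) = j + 2 * d := by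
        rw [finrank_prod, finrank_fintype_fun_eq_card, Fintype.card_fin, finrank_pi_fintype]
        simp [Complex.finrank_real_complex]
        ring
      rw [this]
      exact_mod_cast (by have := d.2; omega)
    refine hle.trans_lt ?_
    rw [finrank_real_of_complex]
    exact_mod_cast (by omega)
  have : FiniteDimensional ℝ E := FiniteDimensional.complexToReal E
  obtain ⟨w, hwT, hw⟩ := (dense_compl_of_dimH_lt_finrank hTd).exists_mem_open
    (Metric.isOpen_ball (x := (0 : E)) (ε := ε / 2)) ⟨0, Metric.mem_ball_self (half_pos hε)⟩
  have hcoe : Continuous fun (s : Fin j → unitInterval) i => (s i : ℝ) := by fun_prop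
  refine ⟨fun s => L (G' fun i => (s i : ℝ)), fun s => v' (fun i => (s i : ℝ)) + w,
    hLc.comp_continuous (hG'.continuous.comp hcoe) (fun s => hG'U _ ⟨s, rfl⟩),
    (hv'.continuous.comp hcoe).add continuous_const, fun s => ⟨(hctl s _ (hGd s)).2, ?_, ?_⟩⟩
  · calc dist (v' (fun i => (s i : ℝ)) + w) (v s)
        ≤ dist (v' (fun i => (s i : ℝ)) + w) (v' (fun i => (s i : ℝ))) +
          dist (v' (fun i => (s i : ℝ))) (v s) := dist_triangle _ _ _
      _ < ε / 2 + ε / 2 := by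
        refine add_lt_add ?_ (hvd s)
        simpa using hw
      _ = ε := by ring
  · by_contra hcon
    push Not at hcon
    obtain ⟨d, J, c, hc⟩ := mem_ker_orth_param e (L (G' fun i => (s i : ℝ))) (r := r)
      (by have := hk (G' fun i => (s i : ℝ)) (hG'U _ ⟨s, rfl⟩)
          omega) hcon
    apply hwT
    refine Set.mem_iUnion.mpr ⟨d, Set.mem_iUnion.mpr ⟨J, ?_⟩⟩
    refine ⟨(fun i => (s i : ℝ), c), ⟨⟨s, rfl⟩, trivial⟩, ?_⟩
    simp only [hf]
    rw [← hc]
    abel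

end Pert
end
end

section
open Filter Topology
open Filter Topology

noncomputable section

section Improve
variable {E F : Type*} [NormedAddCommGroup E] [InnerProductSpace ℂ E]
  [NormedAddCommGroup F] [InnerProductSpace ℂ F]
  [CompleteSpace E] [CompleteSpace F]

lemma isOpen_quality (c : ℝ) : IsOpen {q : (E →L[ℂ] F) × E | ‖q.1 q.2‖ < c * ‖q.2‖} := by
  refine isOpen_lt ?_ (by fun_prop)
  exact (continuous_fst.clm_apply continuous_snd).norm

lemma quality_change {B B' : E →L[ℂ] F} {w : E} {a c : ℝ} (h : dist B' B ≤ a)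
    (h2 : ‖B' w‖ < c * ‖w‖) : ‖B w‖ < (c + a) * ‖w‖ := by
  have h1 : ‖(B' - B) w‖ ≤ a * ‖w‖ := by
    refine ((B' - B).le_opNorm w).trans ?_
    gcongr
    rwa [← dist_eq_norm]
  have : B w = B' w - (B' - B) w := by simp
  rw [this]
  calc _ ≤ ‖B' w‖ + ‖(B' - B) w‖ := norm_sub_le _ _
    _ < _ := by linarith

theorem improve {S : Type*} [MetricSpace S] [CompactSpace S] {B : S → E →L[ℂ] F}
    (hB : Continuous B) (hP : Pert B) {D : Set S} (hD : IsClosed D) {v : S → E}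
    (hv : Continuous v) (hvD : ∀ s ∈ D, B s (v s) = 0) {η : ℝ}
    (hη : ∀ s, ‖B s (v s)‖ < η * ‖v s‖) {ε₁ : ℝ} (hε₁ : 0 < ε₁) :
    ∃ W : S × ℝ → E, Continuous W ∧ (∀ s, W (s, 0) = v s) ∧ (∀ s ∈ D, ∀ t, W (s, t) = v s) ∧
      (∀ s, ∀ t ∈ Set.Icc (0 : ℝ) 1, ‖B s (W (s, t))‖ < η * ‖W (s, t)‖) ∧
      ∀ s, ‖B s (W (s, 1))‖ < ε₁ * ‖W (s, 1)‖ := by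
  have hv0 : ∀ s, 0 < ‖v s‖ := by
    intro s
    by_contra h
    have h0 : ‖v s‖ = 0 := le_antisymm (not_lt.mp h) (norm_nonneg _)
    have := hη s
    rw [h0, mul_zero] at this
    exact absurd this (not_lt.mpr (norm_nonneg _))
  have hBv : Continuous fun s => ‖B s (v s)‖ := (hB.clm_apply hv).norm
  obtain ⟨μ', hμ', hμ⟩ := (isCompact_univ (X := S)).exists_forall_le'
    (f := fun s => (η * ‖v s‖ - ‖B s (v s)‖) / ‖v s‖)
    (((continuous_const.mul hv.norm).sub hBv).div hv.norm (fun s => (hv0 s).ne')).continuousOn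
    (a := 0) (fun s _ => div_pos (by linarith [hη s]) (hv0 s))
  set μ := μ' / 2 with hμd
  have hμ0 : 0 < μ := by positivity
  have hμ2 : ∀ s, ‖B s (v s)‖ < (η - μ) * ‖v s‖ := by
    intro s
    have := hμ s trivial
    rw [le_div_iff₀ (hv0 s)] at this
    have h2 : μ * ‖v s‖ < μ' * ‖v s‖ := by
      have := hv0 s
      gcongr
      linarith
    linarith
  obtain ⟨δ₁, hδ₁, H₁⟩ := (isCompact_range (hB.prodMk hv)).exists_thickening_subset_open
    (isOpen_quality (E := E) (F := F) (η - μ)) (by rintro _ ⟨s, rfl⟩; exact hμ2 s)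
  have hcl : IsClosed {s | ‖B s (v s)‖ ≤ ε₁ / 4 * ‖v s‖} :=
    isClosed_le hBv (continuous_const.mul hv.norm)
  obtain ⟨δ₂, hδ₂, H₂⟩ := (hcl.isCompact.image (hB.prodMk hv)).exists_thickening_subset_open
    (isOpen_quality (E := E) (F := F) (ε₁ / 2)) (by
      rintro _ ⟨s, hs, rfl⟩
      have h1 : ‖B s (v s)‖ ≤ ε₁ / 4 * ‖v s‖ := hs
      have h2 : 0 < ε₁ * ‖v s‖ := mul_pos hε₁ (hv0 s)
      change ‖B s (v s)‖ < ε₁ / 2 * ‖v s‖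
      linarith)
  obtain ⟨χ, hχD, hχF, hχ⟩ := exists_continuous_zero_one_of_isClosed hD
    (isClosed_le (continuous_const.mul hv.norm) hBv :
      IsClosed {s | ε₁ / 4 * ‖v s‖ ≤ ‖B s (v s)‖}) (by
      rw [Set.disjoint_left]
      intro s hs hs'
      have : ε₁ / 4 * ‖v s‖ ≤ ‖B s (v s)‖ := hs'
      rw [hvD s hs, norm_zero] at this
      have h2 : 0 < ε₁ * ‖v s‖ := mul_pos hε₁ (hv0 s)
      linarith)
  obtain ⟨B', v', hB', hv', hBv'⟩ := hP v hv (min (min δ₁ δ₂) (min μ (ε₁ / 2)))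
    (lt_min (lt_min hδ₁ hδ₂) (lt_min hμ0 (by positivity)))
  obtain ⟨Λ₀, hΛ₀⟩ := (isCompact_univ (X := S)).exists_bound_of_continuousOn
    (f := fun s => 4 * ‖B' s‖ ^ 2) (by fun_prop)
  set Λ := max Λ₀ 1 with hΛ
  have hΛ1 : 0 < Λ := lt_of_lt_of_le one_pos (le_max_right _ _)
  have hΛB : ∀ s, ∀ x : ℝ, 0 ≤ x → x ≤ 1 → (x / Λ) * ‖B' s‖ ^ 2 ≤ 1 / 4 := by
    intro s x hx0 hx1
    have h1 : 4 * ‖B' s‖ ^ 2 ≤ Λ := by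
      have := hΛ₀ s trivial
      rw [Real.norm_eq_abs, abs_of_nonneg (by positivity)] at this
      exact this.trans (le_max_left _ _)
    rw [div_mul_eq_mul_div, div_le_iff₀ hΛ1]
    have : x * ‖B' s‖ ^ 2 ≤ 1 * ‖B' s‖ ^ 2 := by gcongr
    linarith
  -- uniform number of iterations
  obtain ⟨M, hM⟩ : ∃ M : ℕ, ∀ s, ‖B' s ((cOp (1 / Λ) (B' s))^[M] (v' s))‖ <
      ε₁ / 2 * ‖(cOp (1 / Λ) (B' s))^[M] (v' s)‖ := by
    set O : ℕ → Set S := fun M => {s | ‖B' s ((cOp (1 / Λ) (B' s))^[M] (v' s))‖ <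
      ε₁ / 2 * ‖(cOp (1 / Λ) (B' s))^[M] (v' s)‖} with hO
    have hOo : ∀ M, IsOpen (O M) := by
      intro M
      have hc := continuous_cOp_iter (sg := fun _ : S => 1 / Λ) continuous_const hB' hv' M
      exact isOpen_lt (hB'.clm_apply hc).norm (continuous_const.mul hc.norm)
    have hOm : Monotone O := by
      refine monotone_nat_of_le_succ fun M s hs => ?_
      have hs' : ‖B' s ((cOp (1 / Λ) (B' s))^[M] (v' s))‖ <
        ε₁ / 2 * ‖(cOp (1 / Λ) (B' s))^[M] (v' s)‖ := hs
      have := cOp_lt (by positivity) (hΛB s 1 zero_le_one le_rfl) hs'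
      simp only [hO, Set.mem_setOf_eq, Function.iterate_succ_apply']
      exact this
    obtain ⟨M, hM⟩ := (isCompact_univ (X := S)).elim_directed_cover O hOo (by
      intro s _
      obtain ⟨p, hp, hp2⟩ := (hBv' s).2.2
      obtain ⟨M, hM⟩ := cOp_limit (sg := 1 / Λ) (by positivity) (hΛB s 1 zero_le_one le_rfl) hp hp2
        (half_pos hε₁)
      exact Set.mem_iUnion.mpr ⟨M, hM⟩) hOm.directed_le
    exact ⟨M, fun s => hM trivial⟩
  set u : S × ℝ → E := fun q => v q.1 + (q.2 * χ q.1) • (v' q.1 - v q.1) with hu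
  have huc : Continuous u := by fun_prop
  have hdist : ∀ s, ∀ t ∈ Set.Icc (0 : ℝ) 1, dist (u (s, t)) (v s) ≤ dist (v' s) (v s) := by
    intro s t ht
    have hc := hχ s
    have h1 : 0 ≤ t * χ s := mul_nonneg ht.1 hc.1
    have h2 : t * χ s ≤ 1 := mul_le_one₀ ht.2 hc.1 hc.2
    simp only [hu, dist_eq_norm, add_sub_cancel_left]
    rw [norm_smul, Real.norm_eq_abs, abs_of_nonneg h1]
    exact mul_le_of_le_one_left (norm_nonneg _) h2
  have hpair : ∀ s, ∀ t ∈ Set.Icc (0 : ℝ) 1,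
      dist (B' s, u (s, t)) (B s, v s) < min (min δ₁ δ₂) (min μ (ε₁ / 2)) := by
    intro s t ht
    rw [Prod.dist_eq]
    exact max_lt (hBv' s).1 ((hdist s t ht).trans_lt (hBv' s).2.1)
  have hsg : ∀ s, ∀ t ∈ Set.Icc (0 : ℝ) 1, 0 ≤ t * χ s / Λ ∧ t * χ s / Λ * ‖B' s‖ ^ 2 ≤ 1 / 4 := by
    intro s t ht
    have hc := hχ s
    have h1 : 0 ≤ t * χ s := mul_nonneg ht.1 hc.1
    exact ⟨div_nonneg h1 hΛ1.le, hΛB s _ h1 (mul_le_one₀ ht.2 hc.1 hc.2)⟩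
  have hdB : ∀ s, dist (B' s) (B s) ≤ μ ∧ dist (B' s) (B s) ≤ ε₁ / 2 := fun s =>
    ⟨(hBv' s).1.le.trans ((min_le_right _ _).trans (min_le_left _ _)),
      (hBv' s).1.le.trans ((min_le_right _ _).trans (min_le_right _ _))⟩
  refine ⟨fun q => (cOp (q.2 * χ q.1 / Λ) (B' q.1))^[M] (u q), ?_, ?_, ?_, ?_, ?_⟩
  · exact continuous_cOp_iter (by fun_prop) (by fun_prop) huc M
  · intro s
    have : cOp 0 (B' s) = ContinuousLinearMap.id ℂ E := by simp [cOp]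
    simp [this, hu]
  · intro s hs t
    have h0 : χ s = 0 := hχD hs
    have : cOp 0 (B' s) = ContinuousLinearMap.id ℂ E := by simp [cOp]
    simp [this, hu, h0]
  · intro s t ht
    have h1 : ‖B' s (u (s, t))‖ < (η - μ) * ‖u (s, t)‖ := by
      refine @H₁ (B' s, u (s, t)) (Metric.mem_thickening_iff.mpr ⟨(B s, v s), ⟨s, rfl⟩, ?_⟩)
      exact (hpair s t ht).trans_le ((min_le_left _ _).trans (min_le_left _ _))
    have h2 := cOp_iter_lt (hsg s t ht).1 (hsg s t ht).2 h1 M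
    have := quality_change (hdB s).1 h2
    rwa [sub_add_cancel] at this
  · intro s
    have h1m : (1 : ℝ) ∈ Set.Icc (0 : ℝ) 1 := ⟨zero_le_one, le_rfl⟩
    have h2 : ‖B' s ((cOp (1 * χ s / Λ) (B' s))^[M] (u (s, 1)))‖ <
        ε₁ / 2 * ‖(cOp (1 * χ s / Λ) (B' s))^[M] (u (s, 1))‖ := by
      by_cases hs : ε₁ / 4 * ‖v s‖ ≤ ‖B s (v s)‖
      · have hχ1 : χ s = 1 := hχF hs
        have := hM s
        simpa [hu, hχ1] using this
      · have hs' : ‖B s (v s)‖ ≤ ε₁ / 4 * ‖v s‖ := (not_le.mp hs).le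
        refine cOp_iter_lt (hsg s 1 h1m).1 (hsg s 1 h1m).2 ?_ M
        refine @H₂ (B' s, u (s, 1)) (Metric.mem_thickening_iff.mpr ⟨(B s, v s), ⟨s, hs', rfl⟩, ?_⟩)
        exact (hpair s 1 h1m).trans_le ((min_le_left _ _).trans (min_le_right _ _))
    have := quality_change (hdB s).2 h2
    rwa [add_halves] at this

theorem approx_lift {S : Type*} [MetricSpace S] [CompactSpace S] {B : S × ℝ → E →L[ℂ] F}
    (hB : Continuous B) (hP : ∀ t ∈ Set.Icc (0 : ℝ) 1, Pert fun s => B (s, t)) {D : Set S}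
    (hD : IsClosed D) {v₀ : S → E} (hv : Continuous v₀) (hv0 : ∀ s, v₀ s ≠ 0)
    (hv1 : ∀ s, B (s, 1) (v₀ s) = 0)
    (hvD : ∀ s ∈ D, ∀ t ∈ Set.Icc (0 : ℝ) 1, B (s, t) (v₀ s) = 0) {η : ℝ} (hη : 0 < η) :
    ∃ v : S × ℝ → E, Continuous v ∧ (∀ s, v (s, 1) = v₀ s) ∧ (∀ s ∈ D, ∀ t, v (s, t) = v₀ s) ∧
      ∀ s, ∀ t ∈ Set.Icc (0 : ℝ) 1, ‖B (s, t) (v (s, t))‖ < η * ‖v (s, t)‖ := by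
  have huc := ((isCompact_univ (X := S)).prod (isCompact_Icc (a := (0 : ℝ))
    (b := 1))).uniformContinuousOn_of_continuous hB.continuousOn
  rw [Metric.uniformContinuousOn_iff] at huc
  obtain ⟨δ, hδ, H⟩ := huc (η / 4) (by positivity)
  obtain ⟨m', hm'⟩ := exists_nat_one_div_lt hδ
  set m : ℕ := m' + 1 with hm
  have hm0 : (0 : ℝ) < m := by positivity
  have hmδ : 1 / (m : ℝ) < δ := by rw [hm]; push_cast; exact hm'
  have key : ∀ i : ℕ, i ≤ m → ∃ v : S × ℝ → E, Continuous v ∧ (∀ s, v (s, 1) = v₀ s) ∧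
      (∀ s ∈ D, ∀ t, v (s, t) = v₀ s) ∧
      (∀ s, ∀ t ∈ Set.Icc (1 - i / m : ℝ) 1, ‖B (s, t) (v (s, t))‖ < η * ‖v (s, t)‖) ∧
      ∀ s, ‖B (s, 1 - i / m) (v (s, 1 - i / m))‖ < η / 2 * ‖v (s, 1 - i / m)‖ := by
    intro i
    induction i with
    | zero =>
      intro _
      refine ⟨fun q => v₀ q.1, hv.comp continuous_fst, fun _ => rfl, fun _ _ _ => rfl, ?_, ?_⟩
      · intro s t ht
        have : t = 1 := le_antisymm ht.2 (by simpa using ht.1)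
        subst this
        have := norm_pos_iff.mpr (hv0 s)
        simp only [hv1, norm_zero]
        positivity
      · intro s
        have := norm_pos_iff.mpr (hv0 s)
        simp only [Nat.cast_zero, zero_div, sub_zero, hv1, norm_zero]
        positivity
    | succ i ih =>
      intro hi
      obtain ⟨v, hvc, hva, hvb, hvq, hve⟩ := ih (by omega)
      set T : ℝ := 1 - i / m with hT
      set T' : ℝ := 1 - (i + 1 : ℕ) / m with hT'
      have hTT : T' = T - 1 / m := by rw [hT, hT']; push_cast; ring
      have hT'0 : 0 ≤ T' := by
        rw [hT', sub_nonneg, div_le_one hm0]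
        exact_mod_cast hi
      have hT1 : T ≤ 1 := by rw [hT]; simp; positivity
      have h1m : 0 < 1 / (m : ℝ) := by positivity
      have hTI : T ∈ Set.Icc (0 : ℝ) 1 := ⟨by linarith, hT1⟩
      obtain ⟨W, hWc, hW0, hWD, hWq, hW1⟩ := improve (B := fun s => B (s, T))
        (hB.comp (by fun_prop)) (hP T hTI) hD (v := fun s => v (s, T))
        (hvc.comp (by fun_prop)) (fun s hs => by rw [hvb s hs]; exact hvD s hs T hTI)
        hve (ε₁ := η / 4) (by positivity)
      have hclose : ∀ s, ∀ t ∈ Set.Icc T' T, dist (B (s, T)) (B (s, t)) ≤ η / 4 := by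
        intro s t ht
        refine (H (s, T) ⟨trivial, hTI⟩ (s, t) ⟨trivial, hT'0.trans ht.1, ht.2.trans hT1⟩ ?_).le
        rw [Prod.dist_eq, dist_self, Real.dist_eq]
        refine max_lt hδ ?_
        rw [abs_of_nonneg (by linarith [ht.2])]
        linarith [ht.1]
      refine ⟨fun q => if T ≤ q.2 then v q else W (q.1, (T - q.2) * m), ?_, ?_, ?_, ?_, ?_⟩
      · refine Continuous.if_le hvc (hWc.comp (by fun_prop)) continuous_const continuous_snd ?_
        rintro ⟨s, t⟩ rfl
        simp [hW0]
      · intro s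
        simp [hT1, hva]
      · intro s hs t
        by_cases h : T ≤ t
        · simp [h, hvb s hs]
        · simp [h, hWD s hs, hvb s hs]
      · intro s t ht
        by_cases h : T ≤ t
        · simpa [h] using hvq s t ⟨h, ht.2⟩
        · have h' := not_le.mp h
          simp only [h, if_false]
          have hq := hWq s ((T - t) * m) ⟨mul_nonneg (by linarith) hm0.le, by
            rw [← le_div_iff₀ hm0]; linarith [ht.1]⟩
          have := quality_change (hclose s t ⟨ht.1, h'.le⟩) hq
          refine this.trans_le ?_
          gcongr
          linarith
      · intro s
        have h : ¬ T ≤ T' := by rw [hTT]; linarith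
        simp only [h, if_false]
        have e : (T - T') * m = 1 := by rw [hTT]; field_simp; ring
        rw [e]
        have := quality_change (hclose s T' ⟨le_rfl, by linarith⟩) (hW1 s)
        refine this.trans_le ?_
        gcongr
        linarith
  obtain ⟨v, hvc, hva, hvb, hvq, -⟩ := key m le_rfl
  refine ⟨v, hvc, hva, hvb, fun s t ht => hvq s t ?_⟩
  rwa [div_self hm0.ne', sub_self]

end Improve
end
end

section
open Filter Topology
open Filter Topology

noncomputable section

section Vec
variable {V X E F : Type*} [NormedAddCommGroup V] [InnerProductSpace ℂ V] [FiniteDimensional ℂ V]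
  [CompleteSpace V]
  [NormedAddCommGroup E] [InnerProductSpace ℂ E] [FiniteDimensional ℂ E]
  [NormedAddCommGroup F] [InnerProductSpace ℂ F] [FiniteDimensional ℂ F]
  [CompleteSpace E] [CompleteSpace F]
  [NormedAddCommGroup X] [NormedSpace ℂ X]

theorem vec_retraction (T : V ≃L[ℂ] X × E) (L : X → E →L[ℂ] F) {U : Set X} (hU : IsOpen U)
    (hL : ∀ x ∈ U, AnalyticAt ℂ L x) {K : Set X} (hK : IsCompact K) (hKU : K ⊆ U)
    {ε : ℝ} (hε : 0 < ε) :
    ∃ η > 0, ∃ R : X × E → X × E, ∀ x ∈ K, ∀ v : E, ‖v‖ = 1 → ‖L x v‖ < η →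
      ContinuousAt R (x, v) ∧ (R (x, v)).1 ∈ U ∧ (R (x, v)).2 ≠ 0 ∧
      L (R (x, v)).1 (R (x, v)).2 = 0 ∧ dist (R (x, v)).1 x < ε ∧
      (L x v = 0 → R (x, v) = (x, v)) := by
  set Φ : V → F := fun q => L (T q).1 (T q).2 with hΦ
  have hOm : IsOpen {q : V | (T q).1 ∈ U ∧ (T q).2 ≠ 0} := by
    refine (hU.preimage (continuous_fst.comp T.continuous)).inter ?_
    exact isOpen_ne.preimage (continuous_snd.comp T.continuous)
  have hΦA : ∀ z ∈ {q : V | (T q).1 ∈ U ∧ (T q).2 ≠ 0}, AnalyticAt ℂ Φ z := by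
    rintro z ⟨hz, -⟩
    have hT : AnalyticAt ℂ (fun q => T q) z := T.toContinuousLinearMap.analyticAt z
    have h1 : AnalyticAt ℂ (fun q => L (T q).1) z :=
      (hL _ hz).comp_of_eq (f := fun q => (T q).1)
        (analyticAt_fst.comp_of_eq (f := fun q => T q) hT rfl) rfl
    have h2 : AnalyticAt ℂ (fun q => (T q).2) z :=
      analyticAt_snd.comp_of_eq (f := fun q => T q) hT rfl
    exact (h1.contDiffAt.clm_apply h2.contDiffAt : ContDiffAt ℂ ⊤ Φ z).analyticAt
  have hLc : ContinuousOn L U := fun x hx => (hL x hx).continuousAt.continuousWithinAt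
  set Q : Set (X × E) := K ×ˢ Metric.sphere (0 : E) 1 with hQ
  have hQc : IsCompact Q := by
    have : ProperSpace E := FiniteDimensional.proper ℂ E
    exact hK.prod (isCompact_sphere _ _)
  have hfc : ContinuousOn (fun q : X × E => ‖L q.1 q.2‖) Q := by
    refine ContinuousOn.norm ?_
    exact (hLc.comp continuousOn_fst (fun q hq => hKU hq.1)).clm_apply continuousOn_snd
  set Z0 : Set (X × E) := {q ∈ Q | ‖L q.1 q.2‖ = 0} with hZ0
  have hZ0c : IsCompact Z0 := by
    have : Z0 = Q ∩ (fun q : X × E => ‖L q.1 q.2‖) ⁻¹' {0} := by ext; simp [hZ0]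
    rw [this]
    exact hQc.of_isClosed_subset (hfc.preimage_isClosed_of_isClosed hQc.isClosed
      isClosed_singleton) Set.inter_subset_left
  set C : ℝ := ‖T.toContinuousLinearMap‖ + 1 with hC
  have hC0 : 0 < C := by positivity
  obtain ⟨O, hO, hZO, hOΩ, R, hR⟩ := retraction hOm hΦA (Z := T.symm '' Z0)
    (hZ0c.image T.symm.continuous) (by
      rintro _ ⟨q, ⟨hq, -⟩, rfl⟩
      refine ⟨by simpa using hKU hq.1, ?_⟩
      have h2 := hq.2
      rw [mem_sphere_zero_iff_norm] at h2
      intro h0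
      simp only [ContinuousLinearEquiv.apply_symm_apply] at h0
      rw [h0, norm_zero] at h2
      exact zero_ne_one h2) (by
      rintro _ ⟨q, ⟨-, hq⟩, rfl⟩
      simpa [hΦ] using hq) (ε := ε / C) (by positivity)
  -- quality bound
  have hO' : IsOpen (T.symm ⁻¹' O) := hO.preimage T.symm.continuous
  obtain ⟨η, hη, hηb⟩ := (hQc.diff hO').exists_forall_le' (f := fun q : X × E => ‖L q.1 q.2‖)
    (hfc.mono Set.diff_subset) (a := 0) (by
      rintro q ⟨hq, hqO⟩
      refine lt_of_le_of_ne (norm_nonneg _) fun h => hqO ?_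
      exact hZO ⟨q, ⟨hq, h.symm⟩, rfl⟩)
  refine ⟨η, hη, fun q => T (R (T.symm q)), fun x hx v hv hLv => ?_⟩
  have hmem : T.symm (x, v) ∈ O := by
    by_contra h
    have := hηb (x, v) ⟨⟨hx, by simpa using hv⟩, h⟩
    exact absurd hLv (not_lt.mpr this)
  obtain ⟨h1, ⟨h2, h2'⟩, h3, h4, h5⟩ := hR _ hmem
  refine ⟨?_, h2, h2', h3, ?_, ?_⟩
  · exact T.continuous.continuousAt.comp
      (ContinuousAt.comp (f := fun q => T.symm q) h1 T.symm.continuous.continuousAt)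
  · have e : dist (T (R (T.symm (x, v)))).1 x ≤ dist (T (R (T.symm (x, v)))) (T (T.symm (x, v))) := by
      rw [ContinuousLinearEquiv.apply_symm_apply, Prod.dist_eq]
      exact le_max_left _ _
    refine e.trans_lt ?_
    rw [dist_eq_norm, ← map_sub]
    calc ‖T (R (T.symm (x, v)) - T.symm (x, v))‖
        ≤ ‖T.toContinuousLinearMap‖ * ‖R (T.symm (x, v)) - T.symm (x, v)‖ :=
          T.toContinuousLinearMap.le_opNorm _
      _ ≤ C * ‖R (T.symm (x, v)) - T.symm (x, v)‖ := by gcongr; rw [hC]; linarith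
      _ < C * (ε / C) := by
          rw [← dist_eq_norm]
          gcongr
      _ = ε := by field_simp
  · intro h0
    have : R (T.symm (x, v)) = T.symm (x, v) := h5 (by simpa [hΦ] using h0)
    simp [this]

lemma gen_inverse (B : E →L[ℂ] F) : ∃ M : F →L[ℂ] E, ∀ v, B (M (B v)) = B v := by
  obtain ⟨g, hg⟩ := B.toLinearMap.rangeRestrict.exists_rightInverse_of_surjective
    (LinearMap.range_rangeRestrict _)
  obtain ⟨M, hM⟩ := LinearMap.exists_extend g
  refine ⟨LinearMap.toContinuousLinearMap M, fun v => ?_⟩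
  have h1 : M (B v) = g (B.toLinearMap.rangeRestrict v) :=
    LinearMap.congr_fun hM (B.toLinearMap.rangeRestrict v)
  have h2 := LinearMap.congr_fun hg (B.toLinearMap.rangeRestrict v)
  have h3 := congrArg Subtype.val h2
  change B (M (B v)) = B v
  rw [h1]
  exact h3

theorem vec_lift (T : V ≃L[ℂ] X × E) (L : X → E →L[ℂ] F) {U : Set X} (hU : IsOpen U)
    (hL : ∀ x ∈ U, AnalyticAt ℂ L x) {S : Type*} [MetricSpace S] [CompactSpace S]
    {G : S × ℝ → X} (hG : Continuous G) (hGU : ∀ q, G q ∈ U)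
    (hP : ∀ t, Pert fun s => L (G (s, t))) {D : Set S} (hD : IsClosed D) {b : X}
    (hGb : ∀ s, ∀ t ≤ 1 / 2, G (s, t) = b) (hGD : ∀ s ∈ D, ∀ t, G (s, t) = b)
    {v₀ : S → E} (hv : Continuous v₀) (hv0 : ∀ s, ‖v₀ s‖ = 1)
    (hv1 : ∀ s, L (G (s, 1)) (v₀ s) = 0) {ε : ℝ} (hε : 0 < ε) :
    ∃ z : S × unitInterval → X × E, Continuous z ∧ (∀ q, (z q).1 ∈ U ∧ (z q).2 ≠ 0 ∧
      L (z q).1 (z q).2 = 0 ∧ dist (z q).1 (G (q.1, q.2)) < ε) ∧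
      (∀ s, z (s, 1) = (G (s, 1), v₀ s)) ∧ (∀ s, (z (s, 0)).1 = b) ∧
      ∀ s ∈ D, ∀ t, z (s, t) = (b, v₀ s) := by
  have hLc : ContinuousOn L U := fun x hx => (hL x hx).continuousAt.continuousWithinAt
  have hK : IsCompact (G '' (Set.univ ×ˢ Set.Icc (0 : ℝ) 1)) :=
    (isCompact_univ.prod isCompact_Icc).image hG
  obtain ⟨η, hη, R, hR⟩ := vec_retraction T L hU hL hK
    (by rintro _ ⟨q, -, rfl⟩; exact hGU q) hε
  obtain ⟨M, hM⟩ := gen_inverse (L b)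
  set η' : ℝ := min (η / 2) (1 / (2 * (‖M‖ + 1))) with hη'
  have hM1 : 0 < ‖M‖ + 1 := by positivity
  have hη'0 : 0 < η' := lt_min (by positivity) (by positivity)
  have hBc : Continuous fun q => L (G q) := hLc.comp_continuous hG hGU
  obtain ⟨v, hvc, hva, hvb, hvq⟩ := approx_lift (B := fun q => L (G q)) hBc (fun t _ => hP t) hD hv
    (fun s h => by have := hv0 s; rw [h, norm_zero] at this; exact zero_ne_one this) hv1
    (fun s hs t _ => by rw [hGD s hs, ← hGD s hs 1]; exact hv1 s) hη'0
  set θ : ℝ → ℝ := fun t => min 1 (2 * t) with hθ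
  have hθc : Continuous θ := by fun_prop
  set v' : S × ℝ → E := fun q => v q - (1 - θ q.2) • M (L b (v q)) with hv'
  have hv'c : Continuous v' := by fun_prop
  have hv'q : ∀ s, ∀ t ∈ Set.Icc (0 : ℝ) 1, 0 < ‖v' (s, t)‖ ∧
      ‖L (G (s, t)) (v' (s, t))‖ < η * ‖v' (s, t)‖ := by
    intro s t ht
    have hq := hvq s t ht
    have hpos : 0 < ‖v (s, t)‖ := by
      by_contra h
      have h0 : ‖v (s, t)‖ = 0 := le_antisymm (not_lt.mp h) (norm_nonneg _)
      rw [h0, mul_zero] at hq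
      exact absurd hq (not_lt.mpr (norm_nonneg _))
    have hηη : η' ≤ η / 2 := min_le_left _ _
    by_cases h : 1 / 2 ≤ t
    · have hθ1 : θ t = 1 := min_eq_left (by linarith)
      have e : v' (s, t) = v (s, t) := by simp [hv', hθ1]
      rw [e]
      refine ⟨hpos, hq.trans_le ?_⟩
      gcongr
      linarith
    · have hb := hGb s t (le_of_lt (not_le.mp h))
      rw [hb] at hq ⊢
      have hθ0 : 0 ≤ θ t := le_min zero_le_one (by linarith [ht.1])
      have hθ1 : θ t ≤ 1 := min_le_left _ _
      have e : L b (v' (s, t)) = (θ t) • L b (v (s, t)) := by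
        simp only [hv', map_sub]
        rw [ContinuousLinearMap.map_smul_of_tower, hM, sub_smul, one_smul]
        abel
      have h1 : ‖(1 - θ t) • M (L b (v (s, t)))‖ ≤ ‖v (s, t)‖ / 2 := by
        rw [norm_smul, Real.norm_eq_abs, abs_of_nonneg (by linarith)]
        calc (1 - θ t) * ‖M (L b (v (s, t)))‖ ≤ 1 * ‖M (L b (v (s, t)))‖ := by
              gcongr; linarith
          _ ≤ ‖M‖ * ‖L b (v (s, t))‖ := by rw [one_mul]; exact M.le_opNorm _
          _ ≤ (‖M‖ + 1) * (η' * ‖v (s, t)‖) := by gcongr; linarith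
          _ ≤ (‖M‖ + 1) * (1 / (2 * (‖M‖ + 1)) * ‖v (s, t)‖) := by
              gcongr; exact min_le_right _ _
          _ = ‖v (s, t)‖ / 2 := by field_simp
      have h2 : ‖v (s, t)‖ / 2 ≤ ‖v' (s, t)‖ := by
        have := norm_sub_norm_le (v (s, t)) ((1 - θ t) • M (L b (v (s, t))))
        simp only [hv']
        linarith
      refine ⟨by linarith, ?_⟩
      rw [e, norm_smul, Real.norm_eq_abs, abs_of_nonneg hθ0]
      calc θ t * ‖L b (v (s, t))‖ ≤ 1 * ‖L b (v (s, t))‖ := by gcongr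
        _ < η' * ‖v (s, t)‖ := by rw [one_mul]; exact hq
        _ ≤ η / 2 * (2 * ‖v' (s, t)‖) := by gcongr; linarith
        _ = _ := by ring
  set w : S × unitInterval → E := fun q => (‖v' (q.1, (q.2 : ℝ))‖⁻¹ : ℝ) • v' (q.1, (q.2 : ℝ)) with hw
  have hcc : Continuous fun q : S × unitInterval => v' (q.1, (q.2 : ℝ)) := hv'c.comp (by fun_prop)
  have hwc : Continuous w :=
    (hcc.norm.inv₀ fun q => (hv'q q.1 q.2 q.2.2).1.ne').smul hcc
  have hw1 : ∀ q, ‖w q‖ = 1 := by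
    intro q
    have := (hv'q q.1 q.2 q.2.2).1
    simp only [hw, norm_smul, norm_inv, norm_norm]
    field_simp
  have hwq : ∀ q : S × unitInterval, ‖L (G (q.1, (q.2 : ℝ))) (w q)‖ < η := by
    intro q
    obtain ⟨h1, h2⟩ := hv'q q.1 q.2 q.2.2
    simp only [hw]
    rw [ContinuousLinearMap.map_smul_of_tower, norm_smul, norm_inv, norm_norm, inv_mul_lt_iff₀ h1]
    linarith
  have hprop : ∀ q : S × unitInterval, _ := fun q => hR (G (q.1, (q.2 : ℝ)))
    ⟨(q.1, (q.2 : ℝ)), ⟨trivial, q.2.2⟩, rfl⟩ (w q) (hw1 q) (hwq q)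
  have hwv : ∀ s t, v' (s, (t : unitInterval)) = v₀ s → w (s, t) = v₀ s := by
    intro s t h
    simp only [hw, h, hv0]
    simp
  refine ⟨fun q => R (G (q.1, (q.2 : ℝ)), w q), ?_, ?_, ?_, ?_, ?_⟩
  · rw [continuous_iff_continuousAt]
    intro q
    have hpc : Continuous fun q : S × unitInterval => (G (q.1, (q.2 : ℝ)), w q) :=
      (hG.comp (by fun_prop)).prodMk hwc
    exact ContinuousAt.comp (f := fun q : S × unitInterval => (G (q.1, (q.2 : ℝ)), w q))
      (hprop q).1 hpc.continuousAt
  · intro q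
    obtain ⟨-, h2, h3, h4, h5, -⟩ := hprop q
    exact ⟨h2, h3, h4, h5⟩
  · intro s
    have e : w (s, 1) = v₀ s := hwv s 1 (by
      have : θ 1 = 1 := by simp [hθ]
      simp [hv', this, hva])
    have := (hprop (s, 1)).2.2.2.2.2 (by rw [e]; exact hv1 s)
    simp only [e] at this ⊢
    exact this
  · intro s
    have e : L b (w (s, 0)) = 0 := by
      have h0 : θ 0 = 0 := by simp [hθ]
      simp only [hw]
      rw [ContinuousLinearMap.map_smul_of_tower]
      have : L b (v' (s, ((0 : unitInterval) : ℝ))) = 0 := by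
        simp [hv', h0, hM]
      rw [this, smul_zero]
    have hb : G (s, ((0 : unitInterval) : ℝ)) = b := hGb s _ (by simp)
    have := (hprop (s, 0)).2.2.2.2.2 (by simp only [hb]; exact e)
    simp only at this ⊢
    rw [this, hb]
  · intro s hs t
    have hb : ∀ t, G (s, t) = b := hGD s hs
    have hLb : L b (v₀ s) = 0 := by rw [← hb 1]; exact hv1 s
    have e : w (s, t) = v₀ s := hwv s t (by simp [hv', hvb s hs, hLb])
    have := (hprop (s, t)).2.2.2.2.2 (by simp only [hb, e]; exact hLb)
    simp only [hb, e] at this ⊢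
    exact this

end Vec
end
end

section
open Filter Topology
open Filter Topology
noncomputable section

/-- The linear map attached to a matrix, between Euclidean spaces. -/
def elemMap {p n : ℕ} (i : Fin p) (k : Fin n) :
    EuclideanSpace ℂ (Fin n) →L[ℂ] EuclideanSpace ℂ (Fin p) :=
  (EuclideanSpace.proj k : EuclideanSpace ℂ (Fin n) →L[ℂ] ℂ).smulRight (EuclideanSpace.single i 1)

def matMap {p n : ℕ} (M : Matrix (Fin p) (Fin n) ℂ) :
    EuclideanSpace ℂ (Fin n) →L[ℂ] EuclideanSpace ℂ (Fin p) :=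
  ∑ i, ∑ k, M i k • elemMap i k

lemma matMap_apply {p n : ℕ} (M : Matrix (Fin p) (Fin n) ℂ) (v : EuclideanSpace ℂ (Fin n)) :
    matMap M v = WithLp.toLp 2 (M.mulVec (WithLp.ofLp v)) := by
  ext i
  simp [matMap, elemMap, Matrix.mulVec, dotProduct, Finset.sum_apply, Pi.single_apply]

lemma matMap_eq_zero {p n : ℕ} (M : Matrix (Fin p) (Fin n) ℂ) (v : EuclideanSpace ℂ (Fin n)) :
    matMap M v = 0 ↔ M.mulVec (WithLp.ofLp v) = 0 := by
  rw [matMap_apply]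
  exact WithLp.toLp_eq_zero 2

lemma matMap_ker {p n : ℕ} (M : Matrix (Fin p) (Fin n) ℂ) :
    Module.finrank ℂ (LinearMap.ker (matMap M).toLinearMap)
      = Module.finrank ℂ (LinearMap.ker M.mulVecLin) := by
  have : LinearMap.ker (matMap M).toLinearMap
      = (LinearMap.ker M.mulVecLin).comap (WithLp.linearEquiv 2 ℂ (Fin n → ℂ)).toLinearMap := by
    ext v
    simp [matMap_eq_zero]
  rw [this]
  exact ((WithLp.linearEquiv 2 ℂ (Fin n → ℂ)).submoduleMap _ |>.finrank_eq).trans (by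
    rw [Submodule.map_comap_eq_of_surjective (WithLp.linearEquiv 2 ℂ (Fin n → ℂ)).surjective])

lemma matMap_analytic {N p n : ℕ} {U : Set (Fin N → ℂ)}
    {A : (Fin N → ℂ) → Matrix (Fin p) (Fin n) ℂ}
    (hA : ∀ (i : Fin p) (j : Fin n), AnalyticOnNhd ℂ (fun x => A x i j) U) :
    ∀ x ∈ U, AnalyticAt ℂ (fun x => matMap (A x)) x := by
  intro x hx
  unfold matMap
  refine Finset.analyticAt_fun_sum _ fun i _ => Finset.analyticAt_fun_sum _ fun k _ => ?_
  exact (hA i k x hx).fun_smul analyticAt_const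

lemma matMap_adjoint {N p n : ℕ} {U : Set (Fin N → ℂ)}
    {A : (Fin N → ℂ) → Matrix (Fin p) (Fin n) ℂ}
    (hA : ∀ (i : Fin p) (j : Fin n), AnalyticOnNhd ℂ (fun x => A x i j) U)
    (y : EuclideanSpace ℂ (Fin p)) :
    ContDiffOn ℝ 1 (fun x => ContinuousLinearMap.adjoint (matMap (A x)) y) U := by
  have e : (fun x => ContinuousLinearMap.adjoint (matMap (A x)) y)
      = fun x => ∑ i, ∑ k, Complex.conjCLE (A x i k) •
        (ContinuousLinearMap.adjoint (elemMap (n := n) i k) y) := by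
    funext x
    simp [matMap, map_sum, map_smulₛₗ]
  rw [e]
  have h : ∀ i k, ContDiffOn ℝ 1 (fun x => Complex.conjCLE (A x i k)) U := fun i k =>
    Complex.conjCLE.contDiff.comp_contDiffOn fun x hx =>
      ((hA i k x hx).contDiffAt.restrict_scalars ℝ).contDiffWithinAt
  refine ContDiffOn.sum fun i _ => ContDiffOn.sum fun k _ => ?_
  exact (h i k).smul contDiffOn_const

def decomp (N n : ℕ) : WithLp 2 (EuclideanSpace ℂ (Fin N) × EuclideanSpace ℂ (Fin n)) ≃L[ℂ]
    (Fin N → ℂ) × EuclideanSpace ℂ (Fin n) :=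
  (WithLp.prodContinuousLinearEquiv 2 ℂ _ _).trans
    ((EuclideanSpace.equiv (Fin N) ℂ).prodCongr (ContinuousLinearEquiv.refl ℂ _))

theorem mat_lift {N p n k j : ℕ} {U : Set (Fin N → ℂ)} (hU : IsOpen U)
    {A : (Fin N → ℂ) → Matrix (Fin p) (Fin n) ℂ}
    (hA : ∀ (i : Fin p) (j : Fin n), AnalyticOnNhd ℂ (fun x => A x i j) U)
    (hk : ∀ x ∈ U, k ≤ Module.finrank ℂ (LinearMap.ker (A x).mulVecLin)) (hj : j < 2 * k)
    {G : (Fin j → unitInterval) × ℝ → (Fin N → ℂ)} (hG : Continuous G) (hGU : ∀ q, G q ∈ U)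
    {D : Set (Fin j → unitInterval)} (hD : IsClosed D) {b : Fin N → ℂ}
    (hGb : ∀ s, ∀ t ≤ 1 / 2, G (s, t) = b)
    (hGD : ∀ s ∈ D, ∀ t, G (s, t) = b) {v₀ : (Fin j → unitInterval) → EuclideanSpace ℂ (Fin n)}
    (hv : Continuous v₀)
    (hv0 : ∀ s, ‖v₀ s‖ = 1) (hv1 : ∀ s, (A (G (s, 1))).mulVec (WithLp.ofLp (v₀ s)) = 0)
    {ε : ℝ} (hε : 0 < ε) :
    ∃ z : (Fin j → unitInterval) × unitInterval → (Fin N → ℂ) × EuclideanSpace ℂ (Fin n),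
      Continuous z ∧
      (∀ q, (z q).1 ∈ U ∧ (z q).2 ≠ 0 ∧ (A (z q).1).mulVec (WithLp.ofLp (z q).2) = 0 ∧
        dist (z q).1 (G (q.1, q.2)) < ε) ∧
      (∀ s, z (s, 1) = (G (s, 1), v₀ s)) ∧ (∀ s, (z (s, 0)).1 = b) ∧
      ∀ s ∈ D, ∀ t, z (s, t) = (b, v₀ s) := by
  have hL := matMap_analytic hA
  obtain ⟨z, h1, h2, h3⟩ := vec_lift (decomp N n) (fun x => matMap (A x)) hU hL hG hGU
    (fun t => pert_of (j := j) (k := k) (fun x => matMap (A x)) hU (matMap_adjoint hA)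
      (fun x hx => (hL x hx).continuousAt.continuousWithinAt)
      (fun x hx => by rw [matMap_ker]; exact hk x hx)
      (by
        refine (hk _ (hGU (fun _ => 0, 0))).trans ((Submodule.finrank_le _).trans ?_)
        simp) hj (G := fun s => G (s, t)) (hG.comp (by fun_prop)) (fun s => hGU _))
    hD hGb hGD hv hv0 (fun s => (matMap_eq_zero _ _).2 (hv1 s)) hε
  refine ⟨z, h1, fun q => ?_, h3⟩
  obtain ⟨a, b, c, d⟩ := h2 q
  exact ⟨a, b, (matMap_eq_zero _ _).1 c, d⟩
end
end

section
open Filter Topology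
open Filter Topology
noncomputable section

section Proj
variable {n : ℕ}

def rawProj (v : Fin n → ℂ) : EuclideanSpace ℂ (Fin n) →L[ℂ] EuclideanSpace ℂ (Fin n) :=
  (((‖WithLp.toLp 2 v‖ ^ 2 : ℝ) : ℂ)⁻¹) •
    (innerSL ℂ (WithLp.toLp 2 v)).smulRight (WithLp.toLp 2 v)

lemma rawProj_apply (v : Fin n → ℂ) (w : EuclideanSpace ℂ (Fin n)) :
    rawProj v w = ((((‖WithLp.toLp 2 v‖ ^ 2 : ℝ) : ℂ)⁻¹) * inner ℂ (WithLp.toLp 2 v) w) •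
      WithLp.toLp 2 v := by
  simp [rawProj, smul_smul]

lemma rawProj_smul (c : ℂ) (hc : c ≠ 0) (v : Fin n → ℂ) : rawProj (c • v) = rawProj v := by
  ext1 w
  rw [rawProj_apply, rawProj_apply, WithLp.toLp_smul, norm_smul, inner_smul_left, smul_smul]
  congr 1
  have h : (starRingEnd ℂ) c * c = ((‖c‖ ^ 2 : ℝ) : ℂ) := by
    rw [mul_comm, Complex.mul_conj, Complex.normSq_eq_norm_sq]
  have hc' : ((‖c‖ ^ 2 : ℝ) : ℂ) ≠ 0 := by
    exact_mod_cast pow_ne_zero 2 (norm_ne_zero_iff.2 hc)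
  rw [mul_pow, Complex.ofReal_mul, mul_inv]
  calc _ = ((‖c‖ ^ 2 : ℝ) : ℂ)⁻¹ * ((starRingEnd ℂ) c * c) *
        (((‖WithLp.toLp 2 v‖ ^ 2 : ℝ) : ℂ)⁻¹ * inner ℂ (WithLp.toLp 2 v) w) := by ring
    _ = _ := by rw [h, inv_mul_cancel₀ hc', one_mul]

lemma rawProj_self {v : Fin n → ℂ} (hv : v ≠ 0) :
    rawProj v (WithLp.toLp 2 v) = WithLp.toLp 2 v := by
  rw [rawProj_apply, inner_self_eq_norm_sq_to_K]
  have : ‖WithLp.toLp 2 v‖ ≠ 0 := norm_ne_zero_iff.2 (by simpa using hv)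
  have h2 : ((‖WithLp.toLp 2 v‖ : ℝ) : ℂ) ≠ 0 := by exact_mod_cast this
  push_cast
  erw [inv_mul_cancel₀ (pow_ne_zero 2 h2), one_smul]

lemma rawProj_continuous : Continuous fun v : {v : Fin n → ℂ // v ≠ 0} => rawProj v.1 := by
  unfold rawProj
  have h : Continuous fun v : {v : Fin n → ℂ // v ≠ 0} => WithLp.toLp 2 v.1 :=
    (PiLp.continuous_toLp 2 _).comp continuous_subtype_val
  have h1 : Continuous fun v : {v : Fin n → ℂ // v ≠ 0} =>
      (((‖WithLp.toLp 2 v.1‖ ^ 2 : ℝ) : ℂ)⁻¹) := by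
    refine Continuous.inv₀ (by fun_prop) fun v => ?_
    have : ‖WithLp.toLp 2 v.1‖ ≠ 0 := norm_ne_zero_iff.2 (by simpa using v.2)
    exact_mod_cast pow_ne_zero 2 this
  have h2 := (ContinuousLinearMap.smulRightL ℂ (EuclideanSpace ℂ (Fin n))
      (EuclideanSpace ℂ (Fin n))).continuous₂
  exact h1.smul (h2.comp (((innerSL ℂ).continuous.comp h).prodMk h))

/-- Orthogonal projector onto a line. -/
def lineProj (l : Projectivization ℂ (Fin n → ℂ)) :
    EuclideanSpace ℂ (Fin n) →L[ℂ] EuclideanSpace ℂ (Fin n) :=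
  Projectivization.lift (fun v : {v : Fin n → ℂ // v ≠ 0} => rawProj v.1) (by
    rintro ⟨a, ha⟩ ⟨b, hb⟩ t h
    have h : a = t • b := h
    simp only
    rw [h]
    refine rawProj_smul t ?_ b
    rintro rfl
    exact ha (by simpa using h)) l

lemma lineProj_mk (v : Fin n → ℂ) (hv : v ≠ 0) :
    lineProj (Projectivization.mk ℂ v hv) = rawProj v := rfl

lemma lineProj_continuous : Continuous (lineProj (n := n)) :=
  Continuous.quotient_lift rawProj_continuous _

lemma mk_continuous : Continuous fun v : {v : Fin n → ℂ // v ≠ 0} =>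
    Projectivization.mk ℂ v.1 v.2 := continuous_quotient_mk'

/-- `w` represents the line `l`. -/
def Reps (w : EuclideanSpace ℂ (Fin n)) (l : Projectivization ℂ (Fin n → ℂ)) : Prop :=
  ∃ h : WithLp.ofLp w ≠ 0, Projectivization.mk ℂ (WithLp.ofLp w) h = l

lemma Reps.smul {w : EuclideanSpace ℂ (Fin n)} {l} (h : Reps w l) {c : ℂ} (hc : c ≠ 0) :
    Reps (c • w) l := by
  obtain ⟨h, rfl⟩ := h
  refine ⟨by simpa using ⟨hc, by simpa using h⟩, ?_⟩
  rw [Projectivization.mk_eq_mk_iff']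
  exact ⟨c, rfl⟩

lemma Reps.lineProj {w : EuclideanSpace ℂ (Fin n)} {l} (h : Reps w l) : lineProj l w = w := by
  obtain ⟨h, rfl⟩ := h
  exact rawProj_self h

lemma reps_lineProj {w : EuclideanSpace ℂ (Fin n)} {l} (h : _root_.lineProj l w ≠ 0) :
    Reps (_root_.lineProj l w) l := by
  induction l using Projectivization.ind with
  | h v hv =>
    rw [lineProj_mk, rawProj_apply] at *
    have h0 : Reps (WithLp.toLp 2 v) (Projectivization.mk ℂ v hv) := ⟨hv, rfl⟩
    refine h0.smul ?_
    intro h1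
    rw [h1, zero_smul] at h
    exact h rfl

lemma lift_homotopy {S : Type*} [MetricSpace S] [CompactSpace S]
    {h : unitInterval × S → Projectivization ℂ (Fin n → ℂ)} (hh : Continuous h)
    {w₀ : S → EuclideanSpace ℂ (Fin n)} (hw₀ : Continuous w₀) (h0 : ∀ s, Reps (w₀ s) (h (0, s))) :
    ∀ r : unitInterval, ∃ w : S → EuclideanSpace ℂ (Fin n), Continuous w ∧
      ∀ s, Reps (w s) (h (r, s)) := by
  have hc : Continuous fun q => lineProj (h q) := lineProj_continuous.comp hh
  have hu := CompactSpace.uniformContinuous_of_continuous hc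
  obtain ⟨δ, hδ, H⟩ := Metric.uniformContinuous_iff.1 hu 1 one_pos
  have key : ∀ i : ℕ, ∀ r : unitInterval, (r : ℝ) ≤ i * (δ / 2) →
      ∃ w : S → EuclideanSpace ℂ (Fin n), Continuous w ∧ ∀ s, Reps (w s) (h (r, s)) := by
    intro i
    induction i with
    | zero =>
      intro r hr
      have : r = 0 := Subtype.ext (le_antisymm (by simpa using hr) r.2.1)
      subst this
      exact ⟨w₀, hw₀, h0⟩
    | succ i ih =>
      intro r hr
      push_cast at hr
      obtain ⟨w, hw, hwr⟩ := ih ⟨max 0 (r - δ / 2), le_max_left _ _,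
        max_le zero_le_one (by linarith [r.2.2])⟩ (max_le (by positivity) (by linarith))
      refine ⟨fun s => lineProj (h (r, s)) (w s), (hc.comp (by fun_prop)).clm_apply hw,
        fun s => reps_lineProj ?_⟩
      intro hz
      have hd := @H (⟨max 0 (r - δ / 2), le_max_left _ _,
        max_le zero_le_one (by linarith [r.2.2])⟩, s) (r, s) (by
          rw [Prod.dist_eq, dist_self, max_eq_left dist_nonneg, Subtype.dist_eq, Real.dist_eq,
            abs_lt]
          have := r.2.1
          constructor
          · have := le_max_right 0 ((r : ℝ) - δ / 2)
            simp only
            linarith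
          · have : max 0 ((r : ℝ) - δ / 2) ≤ r := max_le r.2.1 (by linarith)
            simp only
            linarith)
      rw [dist_eq_norm] at hd
      have e := (hwr s).lineProj
      have hne : w s ≠ 0 := by
        obtain ⟨h, -⟩ := hwr s
        intro h'
        exact h (by simp [h'])
      have e2 := ContinuousLinearMap.le_opNorm (lineProj (h (⟨max 0 (r - δ / 2), le_max_left _ _,
        max_le zero_le_one (by linarith [r.2.2])⟩, s)) - lineProj (h (r, s))) (w s)
      rw [sub_apply, e, hz, sub_zero] at e2
      have hp := norm_pos_iff.2 hne
      have := mul_lt_mul_of_pos_right hd hp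
      linarith
  intro r
  obtain ⟨i, hi⟩ := exists_nat_ge ((r : ℝ) / (δ / 2))
  exact key i r ((div_le_iff₀ (by positivity)).1 hi)

theorem cube_lift {j : ℕ} {g : (Fin j → unitInterval) → Projectivization ℂ (Fin n → ℂ)}
    (hg : Continuous g) : ∃ v : (Fin j → unitInterval) → EuclideanSpace ℂ (Fin n),
      Continuous v ∧ (∀ s, ‖v s‖ = 1) ∧ ∀ s, Reps (v s) (g s) := by
  obtain ⟨w, hw, hr⟩ := lift_homotopy (S := Fin j → unitInterval)
    (h := fun q => g fun a => q.1 * q.2 a)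
    (hg.comp (by fun_prop)) (w₀ := fun _ => WithLp.toLp 2 (g fun _ => 0).rep) continuous_const
    (fun s => ⟨Projectivization.rep_nonzero _, by
      simp only [zero_mul]
      exact Projectivization.mk_rep _⟩) 1
  have hne : ∀ s, ‖w s‖ ≠ 0 := by
    intro s
    obtain ⟨h, -⟩ := hr s
    intro h'
    rw [norm_eq_zero] at h'
    exact h (by simp [h'])
  refine ⟨fun s => ((‖w s‖⁻¹ : ℝ) : ℂ) • w s, ?_, fun s => ?_, fun s => ?_⟩
  · refine Continuous.smul (Complex.continuous_ofReal.comp (hw.norm.inv₀ hne)) hw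
  · rw [norm_smul, Complex.norm_real, norm_inv, norm_norm, inv_mul_cancel₀ (hne s)]
  · have := (hr s).smul (c := ((‖w s‖⁻¹ : ℝ) : ℂ)) (by exact_mod_cast inv_ne_zero (hne s))
    simpa only [one_mul] using this

end Proj
end
end

section
open Filter Topology
open Filter Topology
noncomputable section

/-- Compression property in dimension `j`. -/
def Compress {A H : Type*} [TopologicalSpace A] [TopologicalSpace H] (ι : C(A, H)) (j : ℕ) : Prop :=
  ∀ u : C(Fin j → unitInterval, H), (∀ s ∈ Cube.boundary (Fin j), u s ∈ Set.range ι) →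
    ∃ w : C(Fin j → unitInterval, A), u.HomotopicRel (ι.comp w) (Cube.boundary (Fin j))

lemma homotopicRel_eqOn {X Y : Type*} [TopologicalSpace X] [TopologicalSpace Y] {f g : C(X, Y)}
    {S : Set X} (h : f.HomotopicRel g S) {x : X} (hx : x ∈ S) : f x = g x :=
  h.some.fst_eq_snd hx

lemma piMap_surjective {A H : Type*} [TopologicalSpace A] [TopologicalSpace H] (ι : C(A, H))
    (hinj : Function.Injective ι) {j : ℕ} (hC : Compress ι j) (a : A) :
    Function.Surjective (piMap j ι ι.continuous a) := by
  intro q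
  induction q using Quotient.inductionOn with
  | h l =>
    obtain ⟨w, hw⟩ := hC l.1 (fun s hs => ⟨a, (l.2 s hs).symm⟩)
    have hwb : ∀ s ∈ Cube.boundary (Fin j), w s = a := fun s hs =>
      hinj ((homotopicRel_eqOn hw hs).symm.trans (l.2 s hs))
    refine ⟨Quotient.mk _ ⟨w, hwb⟩, ?_⟩
    exact Quotient.sound (s := GenLoop.Homotopic.setoid _ _) hw.symm

lemma piMap_injective {A H : Type*} [TopologicalSpace A] [TopologicalSpace H] (ι : C(A, H))
    (hinj : Function.Injective ι) {j : ℕ} (hC : Compress ι (j + 1)) (a : A) :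
    Function.Injective (piMap j ι ι.continuous a) := by
  intro q₁ q₂
  induction q₁ using Quotient.inductionOn with
  | h l₁ =>
  induction q₂ using Quotient.inductionOn with
  | h l₂ =>
  intro h
  have h' : GenLoop.Homotopic (GenLoop.induced (Fin j) ι ι.continuous a l₁)
      (GenLoop.induced (Fin j) ι ι.continuous a l₂) :=
    Quotient.exact (s := GenLoop.Homotopic.setoid _ _) h
  obtain ⟨K⟩ := h'
  have hbd : ∀ s ∈ Cube.boundary (Fin (j + 1)), ∃ y : A, ι y = K (s 0, fun i => s i.succ) ∧
      (s 0 = 0 → y = l₁.1 fun i => s i.succ) ∧ (s 0 = 1 → y = l₂.1 fun i => s i.succ) ∧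
      ((fun i : Fin j => s i.succ) ∈ Cube.boundary (Fin j) → y = a) := by
    intro s hs
    have hb : (fun i : Fin j => s i.succ) ∈ Cube.boundary (Fin j) →
        K (s 0, fun i => s i.succ) = ι a := by
      intro hb
      rw [K.eq_fst _ hb]
      exact congrArg ι (l₁.2 _ hb)
    have h0 : s 0 = 0 → K (s 0, fun i => s i.succ) = ι (l₁.1 fun i => s i.succ) := by
      intro h0
      rw [h0, K.apply_zero]
      rfl
    have h1 : s 0 = 1 → K (s 0, fun i => s i.succ) = ι (l₂.1 fun i => s i.succ) := by
      intro h0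
      rw [h0, K.apply_one]
      rfl
    obtain ⟨y, hy⟩ : ∃ y, ι y = K (s 0, fun i => s i.succ) := by
      obtain ⟨i, hi⟩ := hs
      induction i using Fin.cases with
      | zero =>
        rcases hi with hi | hi
        · exact ⟨_, (h0 hi).symm⟩
        · exact ⟨_, (h1 hi).symm⟩
      | succ i => exact ⟨a, (hb ⟨i, hi⟩).symm⟩
    exact ⟨y, hy, fun h => hinj (hy.trans (h0 h)), fun h => hinj (hy.trans (h1 h)),
      fun h => hinj (hy.trans (hb h))⟩
  obtain ⟨w, hw⟩ := hC ⟨fun s => K (s 0, fun i => s i.succ), K.continuous.comp (by fun_prop)⟩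
    (fun s hs => by
      obtain ⟨y, hy, -⟩ := hbd s hs
      exact ⟨y, hy⟩)
  have hwb : ∀ s ∈ Cube.boundary (Fin (j + 1)),
      (s 0 = 0 → w s = l₁.1 fun i => s i.succ) ∧ (s 0 = 1 → w s = l₂.1 fun i => s i.succ) ∧
      ((fun i : Fin j => s i.succ) ∈ Cube.boundary (Fin j) → w s = a) := by
    intro s hs
    obtain ⟨y, hy, h⟩ := hbd s hs
    have : w s = y := hinj ((homotopicRel_eqOn hw hs).symm.trans hy.symm)
    rw [this]
    exact h
  have hcons : Continuous fun q : unitInterval × (Fin j → unitInterval) =>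
      (Fin.cons q.1 q.2 : Fin (j + 1) → unitInterval) := by
    refine continuous_pi fun i => ?_
    induction i using Fin.cases with
    | zero => simpa using continuous_fst
    | succ i =>
      simp only [Fin.cons_succ]
      fun_prop
  refine Quotient.sound (s := GenLoop.Homotopic.setoid _ _) ?_
  refine ⟨⟨⟨⟨fun q => w (Fin.cons q.1 q.2), w.continuous.comp hcons⟩, fun s => ?_, fun s => ?_⟩,
    fun t s hs => ?_⟩⟩
  · exact (hwb (Fin.cons 0 s) ⟨0, by simp⟩).1 (by simp)
  · exact (hwb (Fin.cons 1 s) ⟨0, by simp⟩).2.1 (by simp)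
  · have h1 := (hwb (Fin.cons t s) (by
      obtain ⟨i, hi⟩ := hs
      exact ⟨i.succ, by simpa using hi⟩)).2.2 (by simpa using hs)
    exact h1.trans (l₁.2 s hs).symm

lemma weakEquiv_of_compress {A H : Type*} [TopologicalSpace A] [TopologicalSpace H] (ι : A → H)
    (hc : Continuous ι)
    (hinj : Function.Injective ι) {m : ℕ} (hC : ∀ j ≤ m, Compress ⟨ι, hc⟩ j) :
    IsWeakEquivUpTo m ι :=
  ⟨hc, fun a _ hj => ⟨piMap_injective ⟨ι, hc⟩ hinj (hC _ hj) a,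
    piMap_surjective ⟨ι, hc⟩ hinj (hC _ hj.le) a⟩,
    fun a => piMap_surjective ⟨ι, hc⟩ hinj (hC _ le_rfl) a⟩
end
end

section
open Filter Topology
open Filter Topology
noncomputable section

section Fib
variable {E B Y S : Type*} [TopologicalSpace E] [TopologicalSpace B] [TopologicalSpace Y]
  [TopologicalSpace S]

def mkFib (f : E → B) (b : B) (g : Y → E) (Γ : Y × unitInterval → B) (hg : Continuous g)
    (hΓ : Continuous Γ) (h0 : ∀ y, Γ (y, 0) = b) (h1 : ∀ y, Γ (y, 1) = f (g y)) :
    C(Y, HomotopyFiber f b) :=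
  ⟨fun y => ⟨(g y, ⟨fun t => Γ (y, t), hΓ.comp (by fun_prop)⟩), h0 y, h1 y⟩,
    Continuous.subtype_mk (hg.prodMk
      (ContinuousMap.curry ⟨Γ, hΓ⟩).continuous) _⟩

lemma fib_ext {f : E → B} {b : B} {p q : HomotopyFiber f b} (h1 : p.1.1 = q.1.1)
    (h2 : ∀ t, p.1.2 t = q.1.2 t) : p = q :=
  Subtype.ext (Prod.ext h1 (ContinuousMap.ext h2))

lemma fib_homotopic (f : E → B) (b : B) (g : unitInterval × S → E)
    (Γ : (unitInterval × S) × unitInterval → B) (hg : Continuous g)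
    (hΓ : Continuous Γ) (h0 : ∀ y, Γ (y, 0) = b) (h1 : ∀ y, Γ (y, 1) = f (g y))
    (u₀ u₁ : C(S, HomotopyFiber f b)) (D : Set S)
    (e0 : ∀ s, g (0, s) = (u₀ s).1.1) (e0' : ∀ s t, Γ ((0, s), t) = (u₀ s).1.2 t)
    (e1 : ∀ s, g (1, s) = (u₁ s).1.1) (e1' : ∀ s t, Γ ((1, s), t) = (u₁ s).1.2 t)
    (eD : ∀ s ∈ D, ∀ r, g (r, s) = (u₀ s).1.1)
    (eD' : ∀ s ∈ D, ∀ r t, Γ ((r, s), t) = (u₀ s).1.2 t) :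
    u₀.HomotopicRel u₁ D :=
  ⟨⟨⟨mkFib f b g Γ hg hΓ h0 h1, fun s => fib_ext (e0 s) (e0' s),
    fun s => fib_ext (e1 s) (e1' s)⟩, fun r s hs => fib_ext (eD s hs r) (eD' s hs r)⟩⟩

lemma fiberTo_continuous (f : E → B) (b : B) : Continuous (fiberToHomotopyFiber f b) :=
  Continuous.subtype_mk (continuous_subtype_val.prodMk continuous_const) _

lemma fiberTo_injective (f : E → B) (b : B) : Function.Injective (fiberToHomotopyFiber f b) := by
  intro x y h
  exact Subtype.ext (congrArg (fun q => q.1.1) h)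

end Fib
end
end

section
open Filter Topology
open Filter Topology
noncomputable section

lemma mk_sub_ker {p n : ℕ} (M : Matrix (Fin p) (Fin n) ℂ) (v : Fin n → ℂ) (hv : v ≠ 0) :
    (Projectivization.mk ℂ v hv).submodule ≤ LinearMap.ker M.mulVecLin ↔ M.mulVec v = 0 := by
  rw [Projectivization.submodule_mk, Submodule.span_singleton_le_iff_mem, LinearMap.mem_ker,
    Matrix.mulVecLin_apply]

/-- Reparametrisation. -/
def repar (r t : ℝ) : unitInterval :=
  Set.projIcc 0 1 zero_le_one ((1 - r) * t + r * (2 * t - 1))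

lemma repar_continuous : Continuous fun q : ℝ × ℝ => repar q.1 q.2 :=
  continuous_projIcc.comp (by fun_prop)

lemma repar_zero (t : unitInterval) : repar 0 t = t := by
  simp [repar]

lemma repar_at_one (r : ℝ) : repar r 1 = 1 := by
  have : (1 - r) * 1 + r * (2 * 1 - 1) = 1 := by ring
  rw [repar, this]
  simp

lemma repar_at_zero {r : ℝ} (hr : 0 ≤ r) : repar r 0 = 0 := by
  have : (1 - r) * 0 + r * (2 * 0 - 1) ≤ 0 := by linarith
  rw [repar, Set.projIcc_of_le_left _ this]
  rfl

lemma repar_half {t : ℝ} (ht : t ≤ 1 / 2) : repar 1 t = 0 := by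
  have : (1 - 1) * t + 1 * (2 * t - 1) ≤ 0 := by linarith
  rw [repar, Set.projIcc_of_le_left _ this]
  rfl

/-- The total space of projectivized kernels. -/
def projKer {N p n : ℕ} (U : Set (Fin N → ℂ)) (A : (Fin N → ℂ) → Matrix (Fin p) (Fin n) ℂ) :
    Set ((Fin N → ℂ) × Projectivization ℂ (Fin n → ℂ)) :=
  {q | q.1 ∈ U ∧ q.2.submodule ≤ LinearMap.ker (A q.1).mulVecLin}

theorem compress_projKer {N p n k j : ℕ} {U : Set (Fin N → ℂ)} (hU : IsOpen U)
    {A : (Fin N → ℂ) → Matrix (Fin p) (Fin n) ℂ}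
    (hA : ∀ (i : Fin p) (j : Fin n), AnalyticOnNhd ℂ (fun x => A x i j) U)
    (hk : ∀ x ∈ U, k ≤ Module.finrank ℂ (LinearMap.ker (A x).mulVecLin)) (hj : j < 2 * k)
    (f : projKer U A → U) (hf : ∀ q, (f q : Fin N → ℂ) = q.1.1) (b : U) :
    Compress ⟨fiberToHomotopyFiber f b, fiberTo_continuous f b⟩ j := by
  intro u hu
  let S := Fin j → unitInterval
  let D : Set S := Cube.boundary (Fin j)
  have hD : IsClosed D := by
    have : D = ⋃ i : Fin j, {y | y i = 0 ∨ y i = 1} := by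
      ext y
      simp only [Set.mem_iUnion]
      exact Iff.rfl
    rw [this]
    refine isClosed_iUnion_of_finite fun i => ?_
    exact (isClosed_eq (continuous_apply i) continuous_const).union
      (isClosed_eq (continuous_apply i) continuous_const)
  let g : S → projKer U A := fun s => (u s).1.1
  let P : S × unitInterval → U := fun q => (u q.1).1.2 q.2
  have hg : Continuous g := continuous_fst.comp (continuous_subtype_val.comp u.continuous)
  have hγ : Continuous fun s => (u s).1.2 :=
    continuous_snd.comp (continuous_subtype_val.comp u.continuous)
  have hP : Continuous P := (hγ.comp continuous_fst).eval continuous_snd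
  have hP0 : ∀ s, P (s, 0) = b := fun s => (u s).2.1
  have hP1 : ∀ s, P (s, 1) = f (g s) := fun s => (u s).2.2
  have hPD : ∀ s ∈ D, ∀ t, P (s, t) = b := by
    intro s hs t
    obtain ⟨x, hx⟩ := hu s hs
    simp only [P, ← hx]
    rfl
  let Q : S × ℝ → U := fun q => P (q.1, repar 1 q.2)
  have hrep : Continuous fun t : ℝ => repar 1 t :=
    repar_continuous.comp (continuous_const.prodMk continuous_id)
  have hQ : Continuous Q := hP.comp (continuous_fst.prodMk (hrep.comp continuous_snd))
  have hQ0 : ∀ s, ∀ t ≤ 1 / 2, Q (s, t) = b := fun s t ht => by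
    simp only [Q, repar_half ht, hP0]
  have hQ1 : ∀ s, Q (s, 1) = f (g s) := fun s => by
    simp only [Q, repar_at_one, hP1]
  have hQD : ∀ s ∈ D, ∀ t, Q (s, t) = b := fun s hs t => hPD s hs _
  -- lift to vectors
  obtain ⟨v₀, hv, hv0, hvr⟩ := cube_lift (j := j) (g := fun s => (g s).1.2)
    (continuous_snd.comp (continuous_subtype_val.comp hg))
  have hv1 : ∀ s, (A (Q (s, 1))).mulVec (WithLp.ofLp (v₀ s)) = 0 := by
    intro s
    obtain ⟨h1, h2⟩ := hvr s
    rw [hQ1, hf, ← mk_sub_ker _ _ h1, h2]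
    exact (g s).2.2
  -- tube around the compact image
  have hK : IsCompact (Set.range fun q : S × unitInterval => (P q : Fin N → ℂ)) :=
    isCompact_range (continuous_subtype_val.comp hP)
  obtain ⟨δ, hδ, hth⟩ := hK.exists_thickening_subset_open hU (by
    rintro _ ⟨q, rfl⟩
    exact (P q).2)
  obtain ⟨z, hz, hzp, hz1, hz0, hzD⟩ := mat_lift hU hA hk hj
    (G := fun q => (Q q : Fin N → ℂ)) (continuous_subtype_val.comp hQ) (fun q => (Q q).2)
    hD (b := b) (fun s t ht => by rw [hQ0 s t ht]) (fun s hs t => by rw [hQD s hs t])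
    hv hv0 hv1 hδ
  have hzne : ∀ q, WithLp.ofLp (z q).2 ≠ 0 := fun q => by
    simpa using (hzp q).2.1
  let zl : S × unitInterval → projKer U A := fun q =>
    ⟨((z q).1, Projectivization.mk ℂ _ (hzne q)), (hzp q).1,
      (mk_sub_ker _ _ _).2 (hzp q).2.2.1⟩
  have hzl : Continuous zl := by
    refine Continuous.subtype_mk (Continuous.prodMk (continuous_fst.comp hz) ?_) _
    exact mk_continuous.comp (Continuous.subtype_mk
      ((PiLp.continuous_ofLp 2 _).comp (continuous_snd.comp hz)) hzne)
  have hext : ∀ (q : S × unitInterval) s, (z q).1 = (g s).1.1 → (z q).2 = v₀ s →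
      zl q = g s := by
    intro q s h1 h2
    refine Subtype.ext (Prod.ext h1 ?_)
    obtain ⟨h3, h4⟩ := hvr s
    simp only [zl, ← h4, h2]
  have hzl1 : ∀ s, zl (s, 1) = g s := fun s => hext _ s
    (by rw [hz1]; simp only; rw [hQ1, hf]) (by rw [hz1])
  have hfD : ∀ s ∈ D, f (g s) = b := fun s hs => by rw [← hP1, hPD s hs]
  have hzlD : ∀ s ∈ D, ∀ t, zl (s, t) = g s := fun s hs t => hext _ s
    (by rw [hzD s hs, ← hf, hfD s hs]) (by rw [hzD s hs])
  let zx : S × unitInterval → U := fun q => ⟨(z q).1, (hzp q).1⟩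
  have hzx : Continuous zx := Continuous.subtype_mk (continuous_fst.comp hz) _
  have hzxf : ∀ q, zx q = f (zl q) := fun q => Subtype.ext (hf (zl q)).symm
  have hzx0 : ∀ s, zx (s, 0) = b := fun s => Subtype.ext (hz0 s)
  have hzxD : ∀ s ∈ D, ∀ t, zx (s, t) = b := fun s hs t => by
    rw [hzxf, hzlD s hs, hfD s hs]
  have hzx1 : ∀ s, zx (s, 1) = f (g s) := fun s => by rw [hzxf, hzl1]
  -- intermediate maps
  have hQ' : Continuous fun q : S × unitInterval => Q (q.1, (q.2 : ℝ)) := hQ.comp (by fun_prop)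
  let u₁ : C(S, HomotopyFiber f b) := mkFib f b g (fun q => Q (q.1, (q.2 : ℝ))) hg hQ'
    (fun s => hQ0 s _ (by simp)) (fun s => by simpa using hQ1 s)
  let u₂ : C(S, HomotopyFiber f b) := mkFib f b g zx hg hzx hzx0 hzx1
  have hwmem : ∀ s, zl (s, 0) ∈ f ⁻¹' {b} := fun s => (hzxf (s, 0)).symm.trans (hzx0 s)
  have hwc : Continuous fun s => zl (s, 0) := hzl.comp (by fun_prop)
  let w : C(S, f ⁻¹' {b}) := ⟨fun s => ⟨zl (s, 0), hwmem s⟩, Continuous.subtype_mk hwc hwmem⟩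
  refine ⟨w, ContinuousMap.HomotopicRel.trans (g := u₁) ?_
    (ContinuousMap.HomotopicRel.trans (g := u₂) ?_ ?_)⟩
  · refine fib_homotopic f b (fun q => g q.2) (fun q => P (q.1.2, repar q.1.1 q.2))
      (hg.comp continuous_snd) (hP.comp ?_) ?_ ?_ _ _ _ ?_ ?_ ?_ ?_ ?_ ?_
    · exact (continuous_snd.comp continuous_fst).prodMk (repar_continuous.comp
        (by fun_prop : Continuous fun q : (unitInterval × S) × unitInterval =>
          ((q.1.1 : ℝ), (q.2 : ℝ))))
    · rintro ⟨r, s⟩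
      simp only [Set.Icc.coe_zero, repar_at_zero r.2.1, hP0]
    · rintro ⟨r, s⟩
      simp only [Set.Icc.coe_one, repar_at_one, hP1]
    · intro s; rfl
    · intro s t
      simp only [Set.Icc.coe_zero, repar_zero]
      rfl
    · intro s; rfl
    · intro s t
      rfl
    · intro s hs r; rfl
    · intro s hs r t
      exact (hPD s hs _).trans (hPD s hs t).symm
  · have hmem : ∀ q : (unitInterval × S) × unitInterval,
        (1 - (q.1.1 : ℝ)) • (Q (q.1.2, (q.2 : ℝ)) : Fin N → ℂ) +
          (q.1.1 : ℝ) • (zx (q.1.2, q.2) : Fin N → ℂ) ∈ U := by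
      rintro ⟨⟨r, s⟩, t⟩
      refine hth (Metric.mem_thickening_iff.2 ⟨Q (s, (t : ℝ)), ⟨(s, repar 1 t), rfl⟩, ?_⟩)
      have hd := (hzp (s, t)).2.2.2
      rw [dist_eq_norm] at hd ⊢
      have e : (1 - (r : ℝ)) • (Q (s, (t : ℝ)) : Fin N → ℂ) +
          (r : ℝ) • (zx (s, t) : Fin N → ℂ) - Q (s, (t : ℝ))
          = (r : ℝ) • ((z (s, t)).1 - Q (s, (t : ℝ))) := by
        simp only [zx]
        module
      simp only
      rw [e, norm_smul, Real.norm_eq_abs, abs_of_nonneg r.2.1]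
      exact lt_of_le_of_lt (mul_le_of_le_one_left (norm_nonneg _) r.2.2) hd
    have hsame : ∀ (r : ℝ) (x : Fin N → ℂ), (1 - r) • x + r • x = x := fun r x => by module
    refine fib_homotopic f b (fun q => g q.2) (fun q => ⟨_, hmem q⟩)
      (hg.comp continuous_snd) (Continuous.subtype_mk ?_ _) ?_ ?_ _ _ _ ?_ ?_ ?_ ?_ ?_ ?_
    · have h1 : Continuous fun q : (unitInterval × S) × unitInterval =>
          (Q (q.1.2, (q.2 : ℝ)) : Fin N → ℂ) :=
        continuous_subtype_val.comp (hQ.comp (by fun_prop))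
      have h2 : Continuous fun q : (unitInterval × S) × unitInterval =>
          (zx (q.1.2, q.2) : Fin N → ℂ) :=
        continuous_subtype_val.comp (hzx.comp (by fun_prop))
      have h3 : Continuous fun q : (unitInterval × S) × unitInterval => (q.1.1 : ℝ) := by fun_prop
      exact ((continuous_const.sub h3).smul h1).add (h3.smul h2)
    · rintro ⟨r, s⟩
      refine Subtype.ext ?_
      simp only [hzx0, Set.Icc.coe_zero, hQ0 s 0 (by norm_num), hsame]
    · rintro ⟨r, s⟩
      refine Subtype.ext ?_
      simp only [hzx1, Set.Icc.coe_one, hQ1, hsame]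
    · intro s; rfl
    · intro s t
      refine Subtype.ext ?_
      simp only [Set.Icc.coe_zero, sub_zero, one_smul, zero_smul, add_zero]
      rfl
    · intro s; rfl
    · intro s t
      refine Subtype.ext ?_
      simp only [Set.Icc.coe_one, sub_self, one_smul, zero_smul, zero_add]
      rfl
    · intro s hs r; rfl
    · intro s hs r t
      refine Subtype.ext ?_
      simp only [hzxD s hs, hQD s hs, hsame]
      exact congrArg Subtype.val (hQD s hs t).symm
  · refine fib_homotopic f b (fun q => zl (q.2, unitInterval.symm q.1))
      (fun q => zx (q.1.2, unitInterval.symm q.1.1 * q.2))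
      (hzl.comp (by fun_prop)) (hzx.comp (by fun_prop)) ?_ ?_ _ _ _ ?_ ?_ ?_ ?_ ?_ ?_
    · rintro ⟨r, s⟩
      simp only [mul_zero, hzx0]
    · rintro ⟨r, s⟩
      simp only [mul_one, hzxf]
    · intro s
      simp only [unitInterval.symm_zero, hzl1]
      rfl
    · intro s t
      simp only [unitInterval.symm_zero, one_mul]
      rfl
    · intro s
      simp only [unitInterval.symm_one]
      rfl
    · intro s t
      simp only [unitInterval.symm_one, zero_mul, hzx0]
      rfl
    · intro s hs r
      simp only [hzlD s hs]
      rfl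
    · intro s hs r t
      exact (hzxD s hs _).trans (hzxD s hs t).symm

end
end

/-- The projectivization of the kernel of a holomorphic morphism of trivial bundles over an open
set `U ⊆ ℂ^N` is a quasifibration over `U` up to dimension `2k - 1`, where `k` is the minimal
fibrewise kernel dimension. -/
theorem projectivized_kernel_quasifibration
    {N p n : ℕ}
    (U : Set (Fin N → ℂ)) (hUopen : IsOpen U) (hUne : U.Nonempty)
    (A : (Fin N → ℂ) → Matrix (Fin p) (Fin n) ℂ)
    (hA : ∀ (i : Fin p) (j : Fin n), AnalyticOnNhd ℂ (fun x => A x i j) U)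
    (k : ℕ) (hk1 : 1 ≤ k)
    (hk : IsLeast {d : ℕ | ∃ x ∈ U,
      Module.finrank ℂ (LinearMap.ker (A x).mulVecLin) = d} k)
    (PL : Set ((Fin N → ℂ) × Projectivization ℂ (Fin n → ℂ)))
    (hPL : PL = {q | q.1 ∈ U ∧ q.2.submodule ≤ LinearMap.ker (A q.1).mulVecLin}) :
    IsQuasifibrationUpTo (2 * k - 1)
      (fun q : PL => (⟨q.1.1, (hPL.subset q.2).1⟩ : U)) := by
  subst hPL
  refine ⟨Continuous.subtype_mk (continuous_fst.comp continuous_subtype_val) _, fun b => ?_⟩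
  refine weakEquiv_of_compress _ (fiberTo_continuous _ b) (fiberTo_injective _ b) fun j hj => ?_
  exact compress_projKer hUopen hA (fun x hx => hk.2 ⟨x, hx, rfl⟩) (by omega) _ (fun q => rfl) b

end
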